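/- arXiv:math/0701251 — 2 statements merged into one kernel-verified Lean document; each statement's English description precedes it below -/
import Mathlib

section
/- Let a_n be the coefficient of q^n in ∏_{m=1}^∞ (1 - q^m)^2. Then there exists a real constant D > 0 such that ∑_{n=0}^{N} a_n^2 is asymptotically equivalent to D·N as N → ∞, and D = 4·L, where L is the limit as x → ∞ of the finite product over primes p ≤ x given by ∏_{p ≤ x, p ≡ 5,7,11 (mod 12)} (1 + 1/p)^{-1} · ∏_{p ≤ x, p ≡ 1 (mod 12)} (1 + 1/p)(1 - 1/p)^{-2}. -/
open Filter

namespace EtaSquare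

open Finset Topology
open scoped ArithmeticFunction ArithmeticFunction.Moebius

/-- Dirichlet's hyperbola identity with cutting point `y`. -/
theorem sum_Ioc_mul_hyperbola (F G : ArithmeticFunction ℂ) (N y : ℕ) :
    ∑ n ∈ Ioc 0 N, (F * G) n =
      ∑ d ∈ Ioc 0 y, G d * ∑ m ∈ Ioc 0 (N / d), F m +
      ∑ m ∈ Ioc 0 (N / (y + 1)), F m * (∑ d ∈ Ioc 0 (N / m), G d - ∑ d ∈ Ioc 0 y, G d) := by
  have key : ∀ m d : ℕ, 0 < m → 0 < d → (d ≤ N / m ↔ m ≤ N / d) := by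
    intro m d hm hd
    rw [Nat.le_div_iff_mul_le hm, Nat.le_div_iff_mul_le hd, mul_comm]
  rw [ArithmeticFunction.sum_Ioc_mul_eq_sum_sum]
  have h1 : ∑ d ∈ Ioc 0 y, G d * ∑ m ∈ Ioc 0 (N / d), F m =
      ∑ m ∈ Ioc 0 N, ∑ d ∈ Ioc 0 (min y (N / m)), F m * G d := by
    simp_rw [mul_sum]
    rw [sum_comm' (t' := Ioc 0 N) (s' := fun m => Ioc 0 (min y (N / m)))]
    · simp_rw [mul_comm]
    · intro d m
      simp only [mem_Ioc, le_min_iff]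
      constructor
      · rintro ⟨⟨hd, hy⟩, hm, hmN⟩
        exact ⟨⟨hd, hy, (key m d hm hd).2 hmN⟩, hm, hmN.trans (Nat.div_le_self _ _)⟩
      · rintro ⟨⟨hd, hy, hmd⟩, hm, _⟩
        exact ⟨⟨hd, hy⟩, hm, (key m d hm hd).1 hmd⟩
  have h2 : ∑ m ∈ Ioc 0 (N / (y + 1)), F m * (∑ d ∈ Ioc 0 (N / m), G d - ∑ d ∈ Ioc 0 y, G d) =
      ∑ m ∈ Ioc 0 N, F m * ∑ d ∈ Ioc y (N / m), G d := by
    symm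
    rw [← sum_subset (s₁ := Ioc 0 (N / (y + 1)))]
    · refine sum_congr rfl fun m hm => ?_
      rw [mem_Ioc] at hm
      have : y + 1 ≤ N / m := (key m (y + 1) hm.1 y.succ_pos).2 hm.2
      rw [← sum_Ioc_consecutive (G ·) (Nat.zero_le y) (by omega : y ≤ N / m), add_sub_cancel_left]
    · exact Ioc_subset_Ioc_right (Nat.div_le_self _ _)
    · intro m hm hm'
      rw [mem_Ioc] at hm hm'
      have : ¬ (y + 1 ≤ N / m) := fun h => hm' ⟨hm.1, (key m (y + 1) hm.1 y.succ_pos).1 h⟩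
      rw [Ioc_eq_empty_of_le (by omega), sum_empty, mul_zero]
  rw [h1, h2, ← sum_add_distrib]
  refine sum_congr rfl fun m _ => ?_
  rw [← mul_sum, ← mul_add]
  congr 1
  rcases le_total y (N / m) with h | h
  · rw [min_eq_left h, sum_Ioc_consecutive (G ·) (Nat.zero_le y) h]
  · rw [min_eq_right h, Ioc_eq_empty_of_le h, sum_empty, add_zero]

/-- Partial summation against `1 / √m` for terms with linearly bounded sums. -/
theorem sum_div_sqrt_le {a : ℕ → ℝ} {C : ℝ} (hC0 : 0 ≤ C)
    (hC : ∀ n : ℕ, ∑ m ∈ Ioc 0 n, a m ≤ C * n) (n : ℕ) :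
    ∑ m ∈ Ioc 0 n, a m / √m ≤ 2 * C * √n := by
  have hstep : ∀ n : ℕ, ∑ m ∈ Ioc 0 n, a m / √m - (∑ m ∈ Ioc 0 n, a m) / √n ≤ C * √n := by
    intro n
    induction n with
    | zero => simp
    | succ n ih =>
      rw [sum_Ioc_succ_top (Nat.zero_le n), sum_Ioc_succ_top (Nat.zero_le n)]
      have hA := hC n
      set W := ∑ m ∈ Ioc 0 n, a m / √m
      set A := ∑ m ∈ Ioc 0 n, a m with hAdef
      have ht : 0 < √((n + 1 : ℕ) : ℝ) := Real.sqrt_pos.2 (by positivity)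
      have hst : √(n : ℝ) ≤ √((n + 1 : ℕ) : ℝ) := Real.sqrt_le_sqrt (by push_cast; linarith)
      have hsn : √(n : ℝ) * √(n : ℝ) = n := Real.mul_self_sqrt (by positivity)
      rcases Nat.eq_zero_or_pos n with rfl | hn
      · simpa [W, A] using hC0
      · have hs : 0 < √(n : ℝ) := Real.sqrt_pos.2 (by exact_mod_cast hn)
        set s := √(n : ℝ)
        set t := √((n + 1 : ℕ) : ℝ)
        have h1 : A * (1 / s - 1 / t) ≤ C * n * (1 / s - 1 / t) :=
          mul_le_mul_of_nonneg_right hA (sub_nonneg.2 (one_div_le_one_div_of_le hs hst))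
        have h2 : C * n * (1 / s - 1 / t) + C * s ≤ C * t := by
          rw [← hsn]
          have : C * t - (C * (s * s) * (1 / s - 1 / t) + C * s) = C * (t - s) ^ 2 / t := by
            field_simp
            ring
          have h3 : 0 ≤ C * (t - s) ^ 2 / t := by positivity
          linarith
        have h4 : W + a (n + 1) / t - (A + a (n + 1)) / t = (W - A / s) + A * (1 / s - 1 / t) := by
          ring
        rw [h4]
        linarith
  have h := hstep n
  have h2 : (∑ m ∈ Ioc 0 n, a m) / √n ≤ C * √n := by
    rcases Nat.eq_zero_or_pos n with rfl | hn
    · simp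
    · rw [div_le_iff₀ (Real.sqrt_pos.2 (by exact_mod_cast hn)), mul_assoc,
        Real.mul_self_sqrt (by positivity)]
      exact hC n
  linarith

/-- A sequence uniformly approximated by convergent sequences converges. -/
theorem exists_tendsto_of_approx {u : ℕ → ℂ} {v : ℕ → ℕ → ℂ} {w : ℕ → ℂ} {e : ℕ → ℝ}
    (hv : ∀ y, Tendsto (v y) atTop (𝓝 (w y))) (he : Tendsto e atTop (𝓝 0))
    (h : ∀ y N, ‖u N - v y N‖ ≤ e y) : ∃ c, Tendsto u atTop (𝓝 c) := by
  apply cauchySeq_tendsto_of_complete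
  rw [Metric.cauchySeq_iff']
  intro ε hε
  obtain ⟨y, hy⟩ := (he.eventually (gt_mem_nhds (show 0 < ε / 4 by positivity))).exists
  have hev := Metric.tendsto_nhds.1 (hv y) (ε / 4) (by positivity)
  obtain ⟨M, hM⟩ := eventually_atTop.1 hev
  have key : ∀ n ≥ M, dist (u n) (w y) < ε / 2 := fun n hn => by
    have h1 : dist (u n) (v y n) < ε / 4 := by
      rw [dist_eq_norm]; exact (h y n).trans_lt hy
    have := dist_triangle (u n) (v y n) (w y)
    have := hM n hn
    linarith
  refine ⟨M, fun n hn => ?_⟩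
  have := dist_triangle_right (u n) (u M) (w y)
  have := key n hn
  have := key M le_rfl
  linarith

theorem tendsto_natDiv_div (d : ℕ) (hd : 0 < d) :
    Tendsto (fun N : ℕ => ((N / d : ℕ) : ℂ) / N) atTop (𝓝 ((d : ℂ)⁻¹)) := by
  have h1 : Tendsto (fun N : ℕ => ((⌊((d : ℝ)⁻¹) * (N : ℝ)⌋₊ : ℝ)) / (N : ℝ)) atTop
      (𝓝 ((d : ℝ)⁻¹)) :=
    (tendsto_nat_floor_mul_div_atTop (by positivity)).comp tendsto_natCast_atTop_atTop
  have h2 : Tendsto (fun N : ℕ => (((N / d : ℕ) : ℝ) / N)) atTop (𝓝 ((d : ℝ)⁻¹)) := by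
    refine h1.congr fun N => ?_
    rw [← Nat.floor_div_eq_div (K := ℝ), div_eq_inv_mul (N : ℝ) (d : ℝ)]
  have h3 := (Complex.continuous_ofReal.tendsto _).comp h2
  refine (h3.congr fun N => ?_).trans_eq ?_ <;> simp

/-- If `F` has a mean value and `G` has partial sums `O(√n)`, then `F * G` has a mean value. -/
theorem exists_mean_mul {F G : ArithmeticFunction ℂ} {c : ℂ} {B C : ℝ}
    (hF : Tendsto (fun n : ℕ => (∑ m ∈ Ioc 0 n, F m) / n) atTop (𝓝 c))
    (hC : ∀ n : ℕ, ∑ m ∈ Ioc 0 n, ‖F m‖ ≤ C * n)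
    (hG : ∀ n : ℕ, ‖∑ m ∈ Ioc 0 n, G m‖ ≤ B * √n) :
    ∃ c', Tendsto (fun n : ℕ => (∑ m ∈ Ioc 0 n, (F * G) m) / n) atTop (𝓝 c') := by
  have hB0 : 0 ≤ B := by simpa using (norm_nonneg _).trans (hG 1)
  have hC0 : 0 ≤ C := by simpa using (norm_nonneg _).trans ((by simpa using hC 1) : ‖F 1‖ ≤ C)
  refine exists_tendsto_of_approx
    (v := fun y N => (∑ d ∈ Ioc 0 y, G d * ∑ m ∈ Ioc 0 (N / d), F m) / N)
    (w := fun y => ∑ d ∈ Ioc 0 y, G d * (c * (d : ℂ)⁻¹))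
    (e := fun y => 4 * B * C / √((y : ℝ) + 1)) ?_ ?_ ?_
  · intro y
    simp_rw [sum_div]
    refine tendsto_finsetSum _ fun d hd => ?_
    have hd0 : 0 < d := (mem_Ioc.1 hd).1
    simp_rw [mul_div_assoc]
    refine Tendsto.const_mul _ ?_
    have h1 := (hF.comp (Nat.tendsto_div_const_atTop hd0.ne')).mul (tendsto_natDiv_div d hd0)
    refine h1.congr' ?_
    filter_upwards [eventually_ge_atTop d] with N hN
    have : ((N / d : ℕ) : ℂ) ≠ 0 := by
      exact_mod_cast (Nat.div_pos hN hd0).ne'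
    simp only [Function.comp]
    field_simp
  · have : Tendsto (fun y : ℕ => √((y : ℝ) + 1)) atTop atTop :=
      Real.tendsto_sqrt_atTop.comp (tendsto_atTop_add_const_right _ _ tendsto_natCast_atTop_atTop)
    exact this.const_div_atTop _
  · intro y N
    rcases Nat.eq_zero_or_pos N with rfl | hN
    · simp; positivity
    rw [sum_Ioc_mul_hyperbola F G N y, add_div, add_sub_cancel_left, norm_div, Complex.norm_natCast,
      div_le_iff₀ (by exact_mod_cast hN)]
    have hyp : 0 < √((y : ℝ) + 1) := Real.sqrt_pos.2 (by positivity)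
    calc ‖∑ m ∈ Ioc 0 (N / (y + 1)), F m * (∑ d ∈ Ioc 0 (N / m), G d - ∑ d ∈ Ioc 0 y, G d)‖
        ≤ ∑ m ∈ Ioc 0 (N / (y + 1)), 2 * B * √N * (‖F m‖ / √m) := by
          refine norm_sum_le_of_le _ fun m hm => ?_
          rw [mem_Ioc] at hm
          have hm0 : (0 : ℝ) < m := by exact_mod_cast hm.1
          rw [norm_mul]
          have h1 : √((N / m : ℕ) : ℝ) ≤ √N / √m := by
            rw [← Real.sqrt_div (by positivity)]
            exact Real.sqrt_le_sqrt Nat.cast_div_le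
          have h2 : √(y : ℝ) ≤ √N / √m := by
            rw [← Real.sqrt_div (by positivity)]
            apply Real.sqrt_le_sqrt
            rw [le_div_iff₀ hm0]
            have := (Nat.le_div_iff_mul_le y.succ_pos).1 hm.2
            have : y * m ≤ N := by nlinarith
            exact_mod_cast this
          have h3 : ‖∑ d ∈ Ioc 0 (N / m), G d - ∑ d ∈ Ioc 0 y, G d‖ ≤ 2 * B * (√N / √m) := by
            refine (norm_sub_le _ _).trans ?_
            have h4 := hG (N / m)
            have h5 := hG y
            have h6 := mul_le_mul_of_nonneg_left h1 hB0
            have h7 := mul_le_mul_of_nonneg_left h2 hB0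
            linarith
          calc _ ≤ ‖F m‖ * (2 * B * (√N / √m)) := by gcongr
            _ = _ := by ring
      _ = 2 * B * √N * ∑ m ∈ Ioc 0 (N / (y + 1)), ‖F m‖ / √m := by rw [mul_sum]
      _ ≤ 2 * B * √N * (2 * C * √((N / (y + 1) : ℕ) : ℝ)) := by
          gcongr
          exact sum_div_sqrt_le hC0 hC _
      _ ≤ 2 * B * √N * (2 * C * (√N / √((y : ℝ) + 1))) := by
          gcongr
          rw [← Real.sqrt_div (by positivity)]
          apply Real.sqrt_le_sqrt
          exact_mod_cast (Nat.cast_div_le (α := ℝ) (m := N) (n := y + 1))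
      _ = 4 * B * C / √((y : ℝ) + 1) * (√N * √N) := by ring
      _ = _ := by rw [Real.mul_self_sqrt (by positivity)]

/-- The convolution of two bounded functions with bounded partial sums has partial sums
`O(√n)`. -/
theorem norm_sum_mul_le {F G : ArithmeticFunction ℂ} {B : ℝ}
    (hF1 : ∀ n, ‖F n‖ ≤ 1) (hG1 : ∀ n, ‖G n‖ ≤ 1)
    (hF : ∀ n : ℕ, ‖∑ m ∈ Ioc 0 n, F m‖ ≤ B) (hG : ∀ n : ℕ, ‖∑ m ∈ Ioc 0 n, G m‖ ≤ B) (N : ℕ) :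
    ‖∑ m ∈ Ioc 0 N, (F * G) m‖ ≤ 3 * B * √N := by
  have hB0 : 0 ≤ B := (norm_nonneg _).trans (hF 0)
  set y := Nat.sqrt N
  have hy : (y : ℝ) ≤ √N := Real.nat_sqrt_le_real_sqrt
  have hM : ((N / (y + 1) : ℕ) : ℝ) ≤ √N := by
    refine le_trans ?_ hy
    have : N / (y + 1) < y + 1 :=
      Nat.div_lt_of_lt_mul (Nat.lt_succ_sqrt N)
    exact_mod_cast Nat.lt_succ_iff.1 this
  rw [sum_Ioc_mul_hyperbola F G N y]
  have h1 : ‖∑ d ∈ Ioc 0 y, G d * ∑ m ∈ Ioc 0 (N / d), F m‖ ≤ y * B := by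
    refine (norm_sum_le_of_le (n := fun _ => B) _ fun d _ => ?_).trans_eq (by simp)
    rw [norm_mul]
    have := mul_le_mul (hG1 d) (hF (N / d)) (norm_nonneg _) zero_le_one
    linarith
  have h2 : ‖∑ m ∈ Ioc 0 (N / (y + 1)), F m * (∑ d ∈ Ioc 0 (N / m), G d - ∑ d ∈ Ioc 0 y, G d)‖ ≤
      ((N / (y + 1) : ℕ) : ℝ) * (2 * B) := by
    refine (norm_sum_le_of_le (n := fun _ => 2 * B) _ fun m _ => ?_).trans_eq (by simp)
    rw [norm_mul]
    have h3 : ‖∑ d ∈ Ioc 0 (N / m), G d - ∑ d ∈ Ioc 0 y, G d‖ ≤ 2 * B := by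
      refine (norm_sub_le _ _).trans ?_
      have := hG (N / m)
      have := hG y
      linarith
    have := mul_le_mul (hF1 m) h3 (norm_nonneg _) zero_le_one
    linarith
  refine (norm_add_le _ _).trans ?_
  have h3 := mul_le_mul_of_nonneg_right hy hB0
  have h4 := mul_le_mul_of_nonneg_right hM hB0
  linarith

/-- Abel's theorem for the weights `k ^ (-δ)` as `δ → 0⁺`. -/
theorem tendsto_of_tendsto_sum {c : ℕ → ℂ} {B : ℂ}
    (hc : Tendsto (fun n => ∑ k ∈ Ioc 0 n, c k) atTop (𝓝 B)) {g : ℝ → ℂ}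
    (hg : ∀ δ > 0, Tendsto (fun N => ∑ k ∈ Ioc 0 N, c k * (((k : ℝ) ^ (-δ) : ℝ) : ℂ)) atTop
      (𝓝 (g δ))) :
    Tendsto g (𝓝[>] 0) (𝓝 B) := by
  set E : ℕ → ℂ := fun n => ∑ k ∈ Ioc 0 n, c k - B with hE
  have hE0 : Tendsto E atTop (𝓝 0) := by simpa [hE] using hc.sub_const B
  obtain ⟨C, hC⟩ : ∃ C, ∀ n, ‖E n‖ ≤ C := by
    obtain ⟨C, hC⟩ := (Metric.isBounded_range_of_tendsto E hE0).exists_norm_le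
    exact ⟨C, fun n => hC _ ⟨n, rfl⟩⟩
  have hC0 : 0 ≤ C := (norm_nonneg _).trans (hC 0)
  rw [Metric.tendsto_nhds]
  intro ε hε
  obtain ⟨M, hM1, hM⟩ : ∃ M ≥ 1, ∀ n ≥ M, ‖E n‖ ≤ ε / 4 := by
    obtain ⟨M, hM⟩ := eventually_atTop.1 (Metric.tendsto_nhds.1 hE0 (ε / 4) (by positivity))
    refine ⟨max M 1, le_max_right _ _, fun n hn => ?_⟩
    have := hM n (le_trans (le_max_left _ _) hn)
    rw [dist_zero_right] at this
    exact this.le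
  have key : ∀ δ > 0, ‖g δ - B‖ ≤ C * (1 - (M : ℝ) ^ (-δ)) + ε / 4 + ε / 4 := by
    intro δ hδ
    set w : ℕ → ℝ := fun k => (k : ℝ) ^ (-δ) with hw
    have hw1 : w 1 = 1 := by simp [hw]
    have hwnn : ∀ k, 0 ≤ w k := fun k => by positivity
    have hwanti : ∀ m n, 1 ≤ m → m ≤ n → w n ≤ w m := by
      intro m n hm hmn
      exact Real.rpow_le_rpow_of_nonpos (by exact_mod_cast hm) (by exact_mod_cast hmn)
        (by linarith)
    have h1 : ∀ n ≥ 1, ‖∑ k ∈ Ioc 0 n, c k * ((w k : ℝ) : ℂ) - B - E n * w n‖ ≤ C * (1 - w n) := by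
      intro n hn
      induction n, hn using Nat.le_induction with
      | base => simp [hw1, hE]
      | succ n hn ih =>
        have h2 : ∑ k ∈ Ioc 0 (n + 1), c k * ((w k : ℝ) : ℂ) - B - E (n + 1) * w (n + 1) =
            (∑ k ∈ Ioc 0 n, c k * ((w k : ℝ) : ℂ) - B - E n * w n) +
              E n * ((w n - w (n + 1) : ℝ) : ℂ) := by
          simp only [hE]
          rw [sum_Ioc_succ_top (Nat.zero_le n), sum_Ioc_succ_top (Nat.zero_le n)]
          push_cast
          ring
        have h4 : 0 ≤ w n - w (n + 1) := sub_nonneg.2 (hwanti n (n + 1) hn n.le_succ)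
        have h3 : ‖E n * ((w n - w (n + 1) : ℝ) : ℂ)‖ ≤ C * (w n - w (n + 1)) := by
          rw [norm_mul, Complex.norm_real, Real.norm_of_nonneg h4]
          exact mul_le_mul_of_nonneg_right (hC n) h4
        rw [h2]
        refine (norm_add_le _ _).trans ?_
        linarith
    have h2 : ∀ n ≥ M, ‖∑ k ∈ Ioc 0 n, c k * ((w k : ℝ) : ℂ) - B - E n * w n‖ ≤
        C * (1 - w M) + ε / 4 * (w M - w n) := by
      intro n hn
      induction n, hn using Nat.le_induction with
      | base => simpa using h1 M hM1
      | succ n hn ih =>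
        have h2 : ∑ k ∈ Ioc 0 (n + 1), c k * ((w k : ℝ) : ℂ) - B - E (n + 1) * w (n + 1) =
            (∑ k ∈ Ioc 0 n, c k * ((w k : ℝ) : ℂ) - B - E n * w n) +
              E n * ((w n - w (n + 1) : ℝ) : ℂ) := by
          simp only [hE]
          rw [sum_Ioc_succ_top (Nat.zero_le n), sum_Ioc_succ_top (Nat.zero_le n)]
          push_cast
          ring
        have h4 : 0 ≤ w n - w (n + 1) := sub_nonneg.2 (hwanti n (n + 1) (hM1.trans hn) n.le_succ)
        have h3 : ‖E n * ((w n - w (n + 1) : ℝ) : ℂ)‖ ≤ ε / 4 * (w n - w (n + 1)) := by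
          rw [norm_mul, Complex.norm_real, Real.norm_of_nonneg h4]
          exact mul_le_mul_of_nonneg_right (hM n hn) h4
        rw [h2]
        refine (norm_add_le _ _).trans ?_
        linarith
    refine le_of_tendsto ((hg δ hδ).sub_const B).norm ?_
    filter_upwards [eventually_ge_atTop M] with n hn
    have h3 : ∑ k ∈ Ioc 0 n, c k * ((w k : ℝ) : ℂ) - B =
        (∑ k ∈ Ioc 0 n, c k * ((w k : ℝ) : ℂ) - B - E n * w n) + E n * w n := by ring
    have h5 : w n ≤ 1 := hw1 ▸ hwanti 1 n le_rfl (hM1.trans hn)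
    have h6 : w M ≤ 1 := hw1 ▸ hwanti 1 M le_rfl hM1
    have h4 : ‖E n * w n‖ ≤ ε / 4 := by
      rw [norm_mul, Complex.norm_real, Real.norm_of_nonneg (hwnn n)]
      have := mul_le_mul (hM n hn) h5 (hwnn n) (by positivity)
      linarith
    rw [h3]
    refine (norm_add_le _ _).trans (add_le_add ((h2 n hn).trans ?_) h4)
    have : ε / 4 * (w M - w n) ≤ ε / 4 * 1 :=
      mul_le_mul_of_nonneg_left (by linarith [hwnn n]) (by positivity)
    linarith
  have hlim : Tendsto (fun δ : ℝ => C * (1 - (M : ℝ) ^ (-δ)) + ε / 4 + ε / 4) (𝓝[>] 0)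
      (𝓝 (ε / 2)) := by
    have hM0 : (0 : ℝ) < M := by exact_mod_cast hM1
    have : Continuous fun δ : ℝ => C * (1 - (M : ℝ) ^ (-δ)) + ε / 4 + ε / 4 := by
      have : Continuous fun δ : ℝ => (M : ℝ) ^ (-δ) :=
        (Real.continuous_const_rpow hM0.ne').comp continuous_neg
      fun_prop
    refine ((this.tendsto 0).mono_left nhdsWithin_le_nhds).trans_eq ?_
    simp
    ring
  filter_upwards [hlim.eventually (gt_mem_nhds (by linarith : ε / 2 < ε)),
    self_mem_nhdsWithin] with δ h1 h2
  rw [dist_eq_norm]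
  exact (key δ h2).trans_lt h1

/-- Dirichlet's test: summation by parts against an eventually antitone nonnegative weight. -/
theorem norm_sum_Ioc_mul_le {g : ℕ → ℂ} {a : ℕ → ℝ} {m : ℕ} {C : ℝ}
    (ha : ∀ k > m, a (k + 1) ≤ a k) (h0 : ∀ k > m, 0 ≤ a k)
    (hg : ∀ k, ‖∑ j ∈ Ioc m k, g j‖ ≤ C) (n : ℕ) :
    ‖∑ k ∈ Ioc m n, g k * (a k : ℂ)‖ ≤ C * a (m + 1) := by
  have hC : 0 ≤ C := (norm_nonneg _).trans (hg 0)
  rcases lt_or_ge n m with hn | hn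
  · rw [Ioc_eq_empty_of_le hn.le, sum_empty, norm_zero]
    exact mul_nonneg hC (h0 _ m.lt_succ_self)
  have h1 : ‖∑ k ∈ Ioc m n, g k * (a k : ℂ) - (∑ k ∈ Ioc m n, g k) * (a (n + 1) : ℂ)‖ ≤
      C * (a (m + 1) - a (n + 1)) := by
    induction n, hn using Nat.le_induction with
    | base => simp
    | succ n hn ih =>
      have h2 : ∑ k ∈ Ioc m (n + 1), g k * (a k : ℂ) -
          (∑ k ∈ Ioc m (n + 1), g k) * (a (n + 1 + 1) : ℂ) =
          (∑ k ∈ Ioc m n, g k * (a k : ℂ) - (∑ k ∈ Ioc m n, g k) * (a (n + 1) : ℂ)) +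
            (∑ k ∈ Ioc m (n + 1), g k) * ((a (n + 1) - a (n + 1 + 1) : ℝ) : ℂ) := by
        rw [sum_Ioc_succ_top hn, sum_Ioc_succ_top hn]
        push_cast
        ring
      have h4 : 0 ≤ a (n + 1) - a (n + 1 + 1) := sub_nonneg.2 (ha _ (by omega))
      have h3 : ‖(∑ k ∈ Ioc m (n + 1), g k) * ((a (n + 1) - a (n + 1 + 1) : ℝ) : ℂ)‖ ≤
          C * (a (n + 1) - a (n + 1 + 1)) := by
        rw [norm_mul, Complex.norm_real, Real.norm_of_nonneg h4]
        exact mul_le_mul_of_nonneg_right (hg _) h4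
      rw [h2]
      refine (norm_add_le _ _).trans ?_
      linarith
  have h3 : ‖(∑ k ∈ Ioc m n, g k) * (a (n + 1) : ℂ)‖ ≤ C * a (n + 1) := by
    have := h0 (n + 1) (by omega)
    rw [norm_mul, Complex.norm_real, Real.norm_of_nonneg this]
    exact mul_le_mul_of_nonneg_right (hg _) this
  have h4 := norm_add_le
    (∑ k ∈ Ioc m n, g k * (a k : ℂ) - (∑ k ∈ Ioc m n, g k) * (a (n + 1) : ℂ))
    ((∑ k ∈ Ioc m n, g k) * (a (n + 1) : ℂ))
  rw [sub_add_cancel] at h4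
  linarith

/-- Partial sums of a convergent-by-tails sequence: a quantitative Cauchy criterion. -/
theorem exists_tendsto_sum_of_tail {c : ℕ → ℂ} {e : ℕ → ℝ} (he : Tendsto e atTop (𝓝 0))
    (h : ∀ᶠ m in atTop, ∀ n, ‖∑ k ∈ Ioc m n, c k‖ ≤ e m) :
    ∃ L, Tendsto (fun n => ∑ k ∈ Ioc 0 n, c k) atTop (𝓝 L) := by
  apply cauchySeq_tendsto_of_complete
  rw [Metric.cauchySeq_iff']
  intro ε hε
  obtain ⟨m, hm1, hm2⟩ := (h.and (he.eventually (gt_mem_nhds hε))).exists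
  refine ⟨m, fun n hn => ?_⟩
  rw [dist_eq_norm, ← sum_Ioc_consecutive c (Nat.zero_le m) hn, add_sub_cancel_left]
  exact (hm1 n).trans_lt hm2

section Character

variable {N : ℕ} [NeZero N] {χ : DirichletCharacter ℂ N}

theorem exists_norm_sum_character_le (hχ : χ ≠ 1) :
    ∃ C : ℝ, ∀ m n : ℕ, ‖∑ k ∈ Ioc m n, χ (k : ZMod N)‖ ≤ C := by
  set S : ℕ → ℂ := fun n => ∑ k ∈ range n, χ (k : ZMod N) with hS
  have hper : Function.Periodic S N := by
    intro n
    simp only [hS]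
    rw [sum_range_add, add_eq_left]
    have : ∀ k : ℕ, χ ((n + k : ℕ) : ZMod N) = χ ((n : ZMod N) + (k : ZMod N)) := by
      intro k; push_cast; rfl
    simp_rw [this]
    have h2 : ∑ x ∈ range N, χ ((n : ZMod N) + (x : ZMod N)) = ∑ x : ZMod N, χ (n + x) := by
      symm
      refine sum_bij' (fun x _ => x.val) (fun k _ => (k : ZMod N)) ?_ ?_ ?_ ?_ ?_
      · intro x _; exact mem_range.2 (ZMod.val_lt x)
      · simp
      · simp
      · intro k hk; exact ZMod.val_cast_of_lt (mem_range.1 hk)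
      · simp
    have h3 := Equiv.sum_comp (Equiv.addLeft (n : ZMod N)) (fun x => χ x)
    rw [h2]
    refine h3.trans ?_
    exact MulChar.sum_eq_zero_of_ne_one hχ
  have hbd : ∀ n, ‖S n‖ ≤ N := by
    intro n
    rw [← hper.map_mod_nat n]
    refine (norm_sum_le_of_le (n := fun _ => (1 : ℝ)) _ fun k _ => χ.norm_le_one _).trans ?_
    simp only [sum_const, card_range, nsmul_eq_mul, mul_one]
    exact_mod_cast (Nat.mod_lt n (NeZero.pos N)).le
  refine ⟨N + N, fun m n => ?_⟩
  rcases lt_or_ge n m with hn | hn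
  · rw [Ioc_eq_empty_of_le hn.le, sum_empty, norm_zero]
    positivity
  have : ∑ k ∈ Ioc m n, χ (k : ZMod N) = S (n + 1) - S (m + 1) := by
    rw [hS]
    simp only
    rw [← sum_Ico_eq_sub _ (by omega)]
    congr 1
    ext k
    simp only [mem_Ioc, mem_Ico]
    omega
  rw [this]
  exact (norm_sub_le _ _).trans (add_le_add (hbd _) (hbd _))

theorem tendsto_one_div_add_one (C : ℝ) :
    Tendsto (fun m : ℕ => C * (1 / ((m : ℝ) + 1))) atTop (𝓝 0) := by
  simpa using (tendsto_one_div_add_atTop_nhds_zero_nat (𝕜 := ℝ)).const_mul C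

theorem tendsto_sum_Ioc_of_LSeriesSummable {f : ℕ → ℂ} {s : ℂ} (h : LSeriesSummable f s) :
    Tendsto (fun n => ∑ k ∈ Ioc 0 n, LSeries.term f s k) atTop (𝓝 (LSeries f s)) := by
  have h1 := (h.hasSum.tendsto_sum_nat).comp (tendsto_add_atTop_nat 1)
  refine h1.congr fun n => ?_
  simp only [Function.comp]
  rw [range_eq_Ico, sum_eq_sum_Ico_succ_bot (Nat.succ_pos n), LSeries.term_zero, zero_add]
  congr 1

theorem tendsto_one_add_nhdsGT :
    Tendsto (fun δ : ℝ => ((1 + δ : ℝ) : ℂ)) (𝓝[>] 0) (𝓝 1) := by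
  have : Continuous fun δ : ℝ => ((1 + δ : ℝ) : ℂ) := by fun_prop
  simpa using (this.tendsto 0).mono_left nhdsWithin_le_nhds

theorem tendsto_LFunction (hχ : χ ≠ 1) :
    Tendsto (fun δ : ℝ => χ.LFunction ((1 + δ : ℝ) : ℂ)) (𝓝[>] 0) (𝓝 (χ.LFunction 1)) :=
  ((DirichletCharacter.differentiable_LFunction hχ).continuous.tendsto 1).comp
    tendsto_one_add_nhdsGT

/-- The series `∑ χ(k)/k` converges to `L(1, χ)` with error `O(1/n)`. -/
theorem exists_norm_LFunction_one_sub_le (hχ : χ ≠ 1) :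
    ∃ C : ℝ, ∀ n : ℕ, ‖χ.LFunction 1 - ∑ k ∈ Ioc 0 n, χ (k : ZMod N) / k‖ ≤
      C * (1 / ((n : ℝ) + 1)) := by
  obtain ⟨C, hC⟩ := exists_norm_sum_character_le hχ
  have htail : ∀ m n : ℕ, ‖∑ k ∈ Ioc m n, χ (k : ZMod N) / k‖ ≤ C * (1 / ((m : ℝ) + 1)) := by
    intro m n
    have := norm_sum_Ioc_mul_le (g := fun k => χ (k : ZMod N)) (a := fun k => 1 / (k : ℝ)) (m := m)
      (C := C) (fun k hk => one_div_le_one_div_of_le (by exact_mod_cast (by omega : 0 < k))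
        (by push_cast; linarith)) (fun k _ => by positivity) (hC m) n
    simpa [div_eq_mul_inv] using this
  obtain ⟨L, hL⟩ := exists_tendsto_sum_of_tail (tendsto_one_div_add_one C)
    (Eventually.of_forall htail)
  have hLeq : L = χ.LFunction 1 := by
    refine tendsto_nhds_unique (tendsto_of_tendsto_sum hL (g := fun δ =>
      χ.LFunction ((1 + δ : ℝ) : ℂ)) ?_) (tendsto_LFunction hχ)
    intro δ hδ
    have hs : 1 < ((1 + δ : ℝ) : ℂ).re := by simpa using hδ
    rw [DirichletCharacter.LFunction_eq_LSeries χ hs]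
    refine (tendsto_sum_Ioc_of_LSeriesSummable
      (DirichletCharacter.LSeriesSummable_of_one_lt_re χ hs)).congr fun n => ?_
    refine sum_congr rfl fun k hk => ?_
    have hk0 : 0 < k := (mem_Ioc.1 hk).1
    have hk1 : (0 : ℝ) < k := by exact_mod_cast hk0
    rw [LSeries.term_of_ne_zero hk0.ne', div_mul_eq_mul_div, mul_div_assoc, div_eq_mul_inv]
    congr 1
    rw [← Complex.ofReal_natCast, ← Complex.ofReal_cpow hk1.le, ← Complex.ofReal_inv,
      ← Complex.ofReal_div]
    congr 1
    rw [Real.rpow_add hk1, Real.rpow_neg hk1.le, Real.rpow_one]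
    field_simp
  refine ⟨C, fun m => ?_⟩
  rw [← hLeq]
  refine le_of_tendsto (hL.sub_const _).norm ?_
  filter_upwards [eventually_ge_atTop m] with n hn
  rw [← sum_Ioc_consecutive (fun k : ℕ => χ (k : ZMod N) / k) (Nat.zero_le m) hn,
    add_sub_cancel_left]
  exact htail m n

theorem exists_norm_sum_log_le (hχ : χ ≠ 1) :
    ∃ C : ℝ, ∀ n : ℕ, ‖∑ k ∈ Ioc 0 n, χ (k : ZMod N) * ((Real.log k / k : ℝ) : ℂ)‖ ≤ C := by
  obtain ⟨C, hC⟩ := exists_norm_sum_character_le hχ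
  set F : ℕ → ℂ := fun k => χ (k : ZMod N) * ((Real.log k / k : ℝ) : ℂ)
  have he : ∀ k : ℕ, k > 3 → Real.exp 1 ≤ k := by
    intro k hk
    have h1 : (3 : ℝ) < k := by exact_mod_cast hk
    linarith [Real.exp_one_lt_d9]
  have htail : ∀ n, ‖∑ k ∈ Ioc 3 n, F k‖ ≤ C * (Real.log (3 + 1 : ℕ) / (3 + 1 : ℕ)) :=
    norm_sum_Ioc_mul_le (g := fun k => χ (k : ZMod N))
      (a := fun k => Real.log k / (k : ℝ)) (m := 3) (C := C)
      (fun k hk => Real.log_div_self_antitoneOn (he k hk) (he (k + 1) (by omega))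
        (by push_cast; linarith))
      (fun k _ => div_nonneg (Real.log_natCast_nonneg k) (by positivity)) (hC 3)
  have hC0 := (norm_nonneg _).trans (htail 0)
  have hsum0 : 0 ≤ ∑ k ∈ Ioc 0 3, ‖F k‖ := sum_nonneg fun _ _ => norm_nonneg _
  refine ⟨∑ k ∈ Ioc 0 3, ‖F k‖ + C * (Real.log (3 + 1 : ℕ) / (3 + 1 : ℕ)), fun n => ?_⟩
  rcases le_total 3 n with hn | hn
  · rw [← sum_Ioc_consecutive F (Nat.zero_le 3) hn]
    exact (norm_add_le _ _).trans (add_le_add (norm_sum_le _ _) (htail n))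
  · refine (norm_sum_le _ _).trans ?_
    have : ∑ k ∈ Ioc 0 n, ‖F k‖ ≤ ∑ k ∈ Ioc 0 3, ‖F k‖ :=
      sum_le_sum_of_subset_of_nonneg (Ioc_subset_Ioc_right hn) fun _ _ _ => norm_nonneg _
    linarith

theorem sum_vonMangoldt_le (n : ℕ) :
    ∑ k ∈ Ioc 0 n, ArithmeticFunction.vonMangoldt k ≤ (Real.log 4 + 4) * n := by
  have := Chebyshev.psi_le_const_mul_self (x := n) (by positivity)
  simpa [Chebyshev.psi] using this

/-- The twisted Chebyshev-type sum `∑ χ(n) Λ(n) / n` is bounded. -/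
theorem exists_norm_sum_vonMangoldt_le (hχ : χ ≠ 1) :
    ∃ C : ℝ, ∀ n : ℕ,
      ‖∑ k ∈ Ioc 0 n, χ (k : ZMod N) * ((ArithmeticFunction.vonMangoldt k / k : ℝ) : ℂ)‖ ≤ C := by
  obtain ⟨C₁, hC₁⟩ := exists_norm_sum_log_le hχ
  obtain ⟨C₂, hC₂⟩ := exists_norm_LFunction_one_sub_le hχ
  have hC₂0 : 0 ≤ C₂ := by
    have := (norm_nonneg _).trans (hC₂ 0)
    simpa using this
  have hL := DirichletCharacter.LFunction_apply_one_ne_zero hχ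
  set F : ArithmeticFunction ℂ :=
    ⟨fun k => χ (k : ZMod N) * ((ArithmeticFunction.vonMangoldt k / k : ℝ) : ℂ), by simp⟩ with hF
  set G : ArithmeticFunction ℂ := ⟨fun k => χ (k : ZMod N) / k, by simp⟩ with hG
  have hFG : ∀ n, (F * G) n = χ (n : ZMod N) * ((Real.log n / n : ℝ) : ℂ) := by
    intro n
    rw [ArithmeticFunction.mul_apply, ← ArithmeticFunction.vonMangoldt_sum,
      Nat.sum_divisorsAntidiagonal (fun x y => F x * G y)]
    push_cast
    rw [sum_div, mul_sum]
    refine sum_congr rfl fun d hd => ?_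
    obtain ⟨hdn, hn⟩ := Nat.mem_divisors.1 hd
    obtain ⟨e, rfl⟩ := hdn
    have hd0 : d ≠ 0 := by rintro rfl; simp at hn
    have he0 : e ≠ 0 := by rintro rfl; simp at hn
    rw [Nat.mul_div_cancel_left _ (Nat.pos_of_ne_zero hd0)]
    simp only [hF, hG, ArithmeticFunction.coe_mk]
    push_cast
    rw [map_mul]
    have : (d : ℂ) ≠ 0 := by exact_mod_cast hd0
    have : (e : ℂ) ≠ 0 := by exact_mod_cast he0
    field_simp
  have hFn : ∀ d : ℕ, 0 < d → ‖F d‖ ≤ ArithmeticFunction.vonMangoldt d / d := by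
    intro d _
    have h0 : 0 ≤ ArithmeticFunction.vonMangoldt d / (d : ℝ) :=
      div_nonneg ArithmeticFunction.vonMangoldt_nonneg (by positivity)
    simp only [hF, ArithmeticFunction.coe_mk]
    rw [norm_mul, Complex.norm_real, Real.norm_of_nonneg h0]
    exact mul_le_of_le_one_left h0 (χ.norm_le_one _)
  refine ⟨(C₁ + C₂ * (Real.log 4 + 4)) / ‖χ.LFunction 1‖, fun n => ?_⟩
  rw [le_div_iff₀ (norm_pos_iff.2 hL), ← norm_mul]
  rcases Nat.eq_zero_or_pos n with rfl | hn
  · simp only [Ioc_self, sum_empty, zero_mul, norm_zero]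
    have := (norm_nonneg _).trans (hC₁ 0)
    have : 0 ≤ Real.log 4 := Real.log_nonneg (by norm_num)
    positivity
  have hn0 : (0 : ℝ) < n := by exact_mod_cast hn
  have h1 : (∑ k ∈ Ioc 0 n, χ (k : ZMod N) * ((ArithmeticFunction.vonMangoldt k / k : ℝ) : ℂ)) *
      χ.LFunction 1 = ∑ k ∈ Ioc 0 n, χ (k : ZMod N) * ((Real.log k / k : ℝ) : ℂ) +
        ∑ d ∈ Ioc 0 n, F d * (χ.LFunction 1 - ∑ k ∈ Ioc 0 (n / d), χ (k : ZMod N) / k) := by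
    have h2 := ArithmeticFunction.sum_Ioc_mul_eq_sum_sum F G n
    simp_rw [hFG] at h2
    rw [h2, ← sum_add_distrib, sum_mul]
    refine sum_congr rfl fun d _ => ?_
    simp only [hF, hG, ArithmeticFunction.coe_mk]
    ring
  rw [h1]
  refine (norm_add_le _ _).trans (add_le_add (hC₁ n) ?_)
  calc _ ≤ ∑ d ∈ Ioc 0 n, C₂ / n * ArithmeticFunction.vonMangoldt d := by
        refine norm_sum_le_of_le _ fun d hd => ?_
        have hd0 : 0 < d := (mem_Ioc.1 hd).1
        have hd1 : (0 : ℝ) < d := by exact_mod_cast hd0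
        rw [norm_mul]
        have h3 : C₂ * (1 / (((n / d : ℕ) : ℝ) + 1)) ≤ C₂ * (d / n) := by
          refine mul_le_mul_of_nonneg_left ?_ hC₂0
          rw [div_le_div_iff₀ (by positivity) hn0, one_mul]
          have : n < d * (n / d + 1) := Nat.lt_mul_div_succ n hd0
          exact_mod_cast this.le
        calc _ ≤ ArithmeticFunction.vonMangoldt d / d * (C₂ * (d / n)) :=
              mul_le_mul (hFn d hd0) ((hC₂ _).trans h3) (norm_nonneg _)
                (div_nonneg ArithmeticFunction.vonMangoldt_nonneg hd1.le)
          _ = _ := by field_simp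
    _ = C₂ / n * ∑ d ∈ Ioc 0 n, ArithmeticFunction.vonMangoldt d := by rw [mul_sum]
    _ ≤ C₂ / n * ((Real.log 4 + 4) * n) := by
        gcongr
        exact sum_vonMangoldt_le n
    _ = _ := by field_simp

theorem exists_norm_sum_prime_log_le (hχ : χ ≠ 1) :
    ∃ C : ℝ, ∀ n : ℕ, ‖∑ k ∈ Ioc 0 n,
      if k.Prime then χ (k : ZMod N) * ((Real.log k / k : ℝ) : ℂ) else 0‖ ≤ C := by
  obtain ⟨C, hC⟩ := exists_norm_sum_vonMangoldt_le hχ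
  have hsum : Summable fun k : ℕ =>
      (if k.Prime then (0 : ℝ) else ArithmeticFunction.vonMangoldt k) / k := by
    refine (ArithmeticFunction.vonMangoldt.summable_residueClass_non_primes_div
      (0 : ZMod 1)).congr fun k => ?_
    congr 1
    split_ifs
    · rfl
    · exact Set.indicator_of_mem (s := {n : ℕ | (n : ZMod 1) = 0})
        (Subsingleton.elim (k : ZMod 1) 0) (ArithmeticFunction.vonMangoldt ·)
  refine ⟨C + ∑' k : ℕ, (if k.Prime then (0 : ℝ) else ArithmeticFunction.vonMangoldt k) / k,
    fun n => ?_⟩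
  have h1 : ∑ k ∈ Ioc 0 n, (if k.Prime then χ (k : ZMod N) * ((Real.log k / k : ℝ) : ℂ) else 0) =
      ∑ k ∈ Ioc 0 n, χ (k : ZMod N) * ((ArithmeticFunction.vonMangoldt k / k : ℝ) : ℂ) -
      ∑ k ∈ Ioc 0 n, χ (k : ZMod N) *
        (((if k.Prime then (0 : ℝ) else ArithmeticFunction.vonMangoldt k) / k : ℝ) : ℂ) := by
    rw [← sum_sub_distrib]
    refine sum_congr rfl fun k _ => ?_
    split_ifs with h
    · rw [ArithmeticFunction.vonMangoldt_apply_prime h]; simp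
    · simp
  have hnn : ∀ k : ℕ,
      0 ≤ (if k.Prime then (0 : ℝ) else ArithmeticFunction.vonMangoldt k) / k := by
    intro k
    split_ifs
    · simp
    · exact div_nonneg ArithmeticFunction.vonMangoldt_nonneg (by positivity)
  rw [h1]
  refine (norm_sub_le _ _).trans (add_le_add (hC n) ?_)
  refine (norm_sum_le_of_le _ fun k _ => ?_).trans (hsum.sum_le_tsum _ fun k _ => hnn k)
  rw [norm_mul, Complex.norm_real, Real.norm_of_nonneg (hnn k)]
  exact mul_le_of_le_one_left (hnn k) (χ.norm_le_one _)

/-- Mertens' theorem for a nontrivial character: `∑ χ(p)/p` converges. -/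
theorem exists_tendsto_sum_prime_div (hχ : χ ≠ 1) :
    ∃ B : ℂ, Tendsto (fun n : ℕ => ∑ k ∈ Ioc 0 n, if k.Prime then χ (k : ZMod N) / k else 0)
      atTop (𝓝 B) := by
  obtain ⟨C, hC⟩ := exists_norm_sum_prime_log_le hχ
  set θ : ℕ → ℂ := fun k => if k.Prime then χ (k : ZMod N) * ((Real.log k / k : ℝ) : ℂ) else 0
    with hθ
  have hC2 : ∀ m k, ‖∑ j ∈ Ioc m k, θ j‖ ≤ C + C := by
    intro m k
    rcases lt_or_ge k m with h | h
    · rw [Ioc_eq_empty_of_le h.le, sum_empty, norm_zero]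
      have := (norm_nonneg _).trans (hC 0)
      linarith
    · rw [← add_sub_cancel_left (∑ j ∈ Ioc 0 m, θ j) (∑ j ∈ Ioc m k, θ j),
        sum_Ioc_consecutive θ (Nat.zero_le m) h]
      exact (norm_sub_le _ _).trans (add_le_add (hC k) (hC m))
  refine exists_tendsto_sum_of_tail
    (e := fun m => (C + C) * (1 / Real.log ((m + 1 : ℕ) : ℝ))) ?_ ?_
  · have h1 : Tendsto (fun m : ℕ => Real.log ((m + 1 : ℕ) : ℝ)) atTop atTop :=
      Real.tendsto_log_atTop.comp (tendsto_natCast_atTop_atTop.comp (tendsto_add_atTop_nat 1))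
    simpa using (h1.inv_tendsto_atTop).const_mul (C + C)
  · filter_upwards [eventually_ge_atTop 1] with m hm n
    have hlog : ∀ k : ℕ, k > m → 0 < Real.log k := fun k hk =>
      Real.log_pos (by exact_mod_cast (by omega : 1 < k))
    have := norm_sum_Ioc_mul_le (g := θ) (a := fun k => 1 / Real.log (k : ℝ)) (m := m) (C := C + C)
      (fun k hk => one_div_le_one_div_of_le (hlog k hk)
        (Real.log_le_log (by exact_mod_cast (by omega : 0 < k)) (by push_cast; linarith)))
      (fun k hk => (one_div_pos.2 (hlog k hk)).le) (hC2 m) n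
    refine le_of_eq_of_le ?_ this
    congr 1
    refine sum_congr rfl fun k hk => ?_
    have h2 := (hlog k (mem_Ioc.1 hk).1).ne'
    have h3 : (Real.log k : ℂ) ≠ 0 := by exact_mod_cast h2
    simp only [hθ]
    split_ifs
    · push_cast at *
      field_simp
    · simp

theorem norm_neg_log_one_sub_sub_le {z : ℂ} (hz : ‖z‖ ≤ 1 / 2) :
    ‖-Complex.log (1 - z) - z‖ ≤ ‖z‖ ^ 2 := by
  have h1 := Complex.norm_log_one_add_sub_self_le (z := -z) (by rw [norm_neg]; linarith)
  rw [norm_neg] at h1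
  have h2 : -Complex.log (1 - z) - z = -(Complex.log (1 + -z) - -z) := by
    rw [← sub_eq_add_neg]; ring
  rw [h2, norm_neg]
  refine h1.trans ?_
  have h3 : (1 - ‖z‖)⁻¹ ≤ 2 := by
    rw [inv_le_comm₀ (by linarith) (by norm_num)]
    linarith
  nlinarith [sq_nonneg ‖z‖]

/-- The Euler product of a nontrivial Dirichlet character converges at `s = 1`. -/
theorem tendsto_prod_euler_one (hχ : χ ≠ 1) :
    Tendsto (fun x : ℕ => ∏ p ∈ (range (x + 1)).filter Nat.Prime, (1 - χ (p : ZMod N) / p)⁻¹)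
      atTop (𝓝 (χ.LFunction 1)) := by
  obtain ⟨B, hB⟩ := exists_tendsto_sum_prime_div hχ
  set c : ℕ → ℂ := fun k => if k.Prime then χ (k : ZMod N) / k else 0 with hc
  set z : ℝ → ℕ → ℂ := fun δ n => χ (n : ZMod N) * (((n : ℝ) ^ (-(1 + δ)) : ℝ) : ℂ) with hz
  set ρ : ℝ → ℕ → ℂ := fun δ n =>
    if n.Prime then -Complex.log (1 - z δ n) - z δ n else 0 with hρ
  have hzn : ∀ δ ≥ 0, ∀ n : ℕ, ‖z δ n‖ ≤ (n : ℝ) ^ (-(1 + δ)) := by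
    intro δ _ n
    have h0 : (0 : ℝ) ≤ (n : ℝ) ^ (-(1 + δ)) := by positivity
    simp only [hz]
    rw [norm_mul, Complex.norm_real, Real.norm_of_nonneg h0]
    exact mul_le_of_le_one_left h0 (χ.norm_le_one _)
  have hzp : ∀ δ ≥ 0, ∀ n : ℕ, n.Prime → ‖z δ n‖ ≤ (n : ℝ)⁻¹ := by
    intro δ hδ n hn
    refine (hzn δ hδ n).trans ?_
    rw [← Real.rpow_neg_one]
    exact Real.rpow_le_rpow_of_exponent_le (by exact_mod_cast hn.one_lt.le) (by linarith)
  have hhalf : ∀ n : ℕ, n.Prime → (n : ℝ)⁻¹ ≤ 1 / 2 := by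
    intro n hn
    rw [← one_div]
    exact one_div_le_one_div_of_le (by norm_num) (by exact_mod_cast hn.two_le)
  have hρb : ∀ δ ≥ 0, ∀ n : ℕ, ‖ρ δ n‖ ≤ ((n : ℝ) ^ 2)⁻¹ := by
    intro δ hδ n
    simp only [hρ]
    split_ifs with hn
    · refine (norm_neg_log_one_sub_sub_le ((hzp δ hδ n hn).trans (hhalf n hn))).trans ?_
      rw [← inv_pow]
      exact pow_le_pow_left₀ (norm_nonneg _) (hzp δ hδ n hn) 2
    · rw [norm_zero]; positivity
  have hsum2 : Summable fun n : ℕ => ((n : ℝ) ^ 2)⁻¹ :=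
    Real.summable_nat_pow_inv.2 (by norm_num)
  have hρsum : ∀ δ ≥ 0, Summable (ρ δ) := fun δ hδ =>
    Summable.of_norm_bounded hsum2 (hρb δ hδ)
  have hzc : ∀ δ : ℝ, ∀ n : ℕ, n.Prime →
      z δ n = χ (n : ZMod N) / n * (((n : ℝ) ^ (-δ) : ℝ) : ℂ) := by
    intro δ n hn
    have hn0 : (0 : ℝ) < n := by exact_mod_cast hn.pos
    simp only [hz]
    rw [neg_add, Real.rpow_add hn0, Real.rpow_neg_one]
    push_cast
    ring
  have hcsum : ∀ δ : ℝ, δ > 0 → Summable fun n : ℕ => c n * (((n : ℝ) ^ (-δ) : ℝ) : ℂ) := by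
    intro δ hδ
    refine Summable.of_norm_bounded (Real.summable_nat_rpow.2 (by linarith : -(1 + δ) < -1))
      fun n => ?_
    by_cases hn : n.Prime
    · simp only [hc, hn, if_true]
      rw [← hzc δ n hn]
      exact hzn δ hδ.le n
    · simp only [hc, hn, if_false, zero_mul, norm_zero]
      positivity
  have hIoc : ∀ f : ℕ → ℂ, Summable f → f 0 = 0 →
      Tendsto (fun n => ∑ k ∈ Ioc 0 n, f k) atTop (𝓝 (∑' k, f k)) := by
    intro f hf h0
    have h1 := (hf.hasSum.tendsto_sum_nat).comp (tendsto_add_atTop_nat 1)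
    refine h1.congr fun n => ?_
    simp only [Function.comp]
    rw [range_eq_Ico, sum_eq_sum_Ico_succ_bot (Nat.succ_pos n), h0, zero_add]
    congr 1
  have hA : Tendsto (fun δ : ℝ => ∑' n : ℕ, c n * (((n : ℝ) ^ (-δ) : ℝ) : ℂ)) (𝓝[>] 0) (𝓝 B) :=
    tendsto_of_tendsto_sum hB fun δ hδ => hIoc _ (hcsum δ hδ) (by simp)
  have hR : Tendsto (fun δ : ℝ => ∑' n : ℕ, ρ δ n) (𝓝[>] 0) (𝓝 (∑' n, ρ 0 n)) := by
    refine tendsto_tsum_of_dominated_convergence hsum2 (fun n => ?_) ?_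
    · by_cases hn : n.Prime
      · simp only [hρ, hn, if_true]
        have hn0 : (n : ℝ) ≠ 0 := by exact_mod_cast hn.ne_zero
        have hzc : Continuous fun δ : ℝ => z δ n := by
          simp only [hz]
          have : Continuous fun δ : ℝ => (n : ℝ) ^ (-(1 + δ)) :=
            (Real.continuous_const_rpow hn0).comp (by fun_prop)
          fun_prop
        have hmem : 1 - z 0 n ∈ Complex.slitPlane := by
          rw [sub_eq_add_neg]
          apply Complex.mem_slitPlane_of_norm_lt_one
          rw [norm_neg]
          have := (hzp 0 le_rfl n hn).trans (hhalf n hn)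
          linarith
        have hct : ContinuousAt (fun δ : ℝ => -Complex.log (1 - z δ n) - z δ n) 0 :=
          (((continuousAt_const.sub hzc.continuousAt).clog hmem).neg).sub hzc.continuousAt
        exact hct.tendsto.mono_left nhdsWithin_le_nhds
      · simp [hρ, hn]
    · filter_upwards [self_mem_nhdsWithin] with δ hδ n
      exact hρb δ (le_of_lt hδ) n
  have hE : ∀ δ : ℝ, δ > 0 →
      Complex.exp (∑' n : ℕ, ρ δ n + ∑' n : ℕ, c n * (((n : ℝ) ^ (-δ) : ℝ) : ℂ)) =
      χ.LFunction ((1 + δ : ℝ) : ℂ) := by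
    intro δ hδ
    have hs : 1 < ((1 + δ : ℝ) : ℂ).re := by simpa using hδ
    rw [DirichletCharacter.LFunction_eq_LSeries χ hs,
      ← DirichletCharacter.LSeries_eulerProduct_exp_log χ hs,
      ← (hρsum δ hδ.le).tsum_add (hcsum δ hδ)]
    congr 1
    have h1 := tsum_subtype {p : ℕ | p.Prime}
      fun p : ℕ => -Complex.log (1 - χ (p : ZMod N) * (p : ℂ) ^ (-((1 + δ : ℝ) : ℂ)))
    refine Eq.trans ?_ h1.symm
    refine tsum_congr fun n => ?_
    by_cases hn : n.Prime
    · rw [Set.indicator_of_mem (by exact hn)]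
      simp only [hρ, hc, hn, if_true]
      rw [← hzc δ n hn, sub_add_cancel]
      simp only [hz]
      rw [Complex.ofReal_cpow (by positivity)]
      push_cast
      rfl
    · rw [Set.indicator_of_notMem (by exact hn)]
      simp [hρ, hc, hn]
  have hval : Complex.exp (∑' n, ρ 0 n + B) = χ.LFunction 1 := by
    refine tendsto_nhds_unique ?_ (tendsto_LFunction hχ)
    refine ((Complex.continuous_exp.tendsto _).comp (hR.add hA)).congr' ?_
    filter_upwards [self_mem_nhdsWithin] with δ hδ
    exact hE δ hδ
  rw [← hval]
  have hfin := (Complex.continuous_exp.tendsto _).comp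
    ((hIoc _ (hρsum 0 le_rfl) (by simp [hρ, Nat.not_prime_zero])).add hB)
  refine hfin.congr fun x => ?_
  simp only [Function.comp]
  rw [← sum_add_distrib, Complex.exp_sum, prod_filter, range_eq_Ico,
    prod_eq_prod_Ico_succ_bot (Nat.succ_pos x)]
  simp only [Nat.not_prime_zero, if_false, one_mul]
  refine prod_congr rfl fun n _ => ?_
  by_cases hn : n.Prime
  · have h1 := hzc 0 n hn
    simp only [neg_zero, Real.rpow_zero, Complex.ofReal_one, mul_one] at h1
    have h2 : ‖χ (n : ZMod N) / (n : ℂ)‖ ≤ 1 / 2 := h1 ▸ (hzp 0 le_rfl n hn).trans (hhalf n hn)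
    have h3 : 1 - χ (n : ZMod N) / (n : ℂ) ≠ 0 := by
      intro h
      rw [sub_eq_zero] at h
      rw [← h, norm_one] at h2
      norm_num at h2
    simp only [hρ, hn, if_true]
    rw [h1, sub_add_cancel, Complex.exp_neg, Complex.exp_log h3]
  · simp [hρ, hn]

end Character

section Characters

/-- Values of the nontrivial character modulo `4`. -/
def chiFourTable : ZMod 12 → ℤ := ![0, 1, 0, 0, 0, 1, 0, -1, 0, 0, 0, -1]

/-- The nontrivial character modulo `4`, induced to modulus `12`. -/
def chiFour : MulChar (ZMod 12) ℤ where
  toFun := chiFourTable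
  map_one' := by decide
  map_mul' := by decide
  map_nonunit' a ha := by
    have h : ∀ a : ZMod 12, chiFourTable a = 0 ∨ a * a = 1 := by decide
    exact (h a).resolve_right fun hb => ha (IsUnit.of_mul_eq_one a hb)

/-- Values of the nontrivial character modulo `3`. -/
def chiThreeTable : ZMod 12 → ℤ := ![0, 1, 0, 0, 0, -1, 0, 1, 0, 0, 0, -1]

/-- The nontrivial character modulo `3`, induced to modulus `12`. -/
def chiThree : MulChar (ZMod 12) ℤ where
  toFun := chiThreeTable
  map_one' := by decide
  map_mul' := by decide
  map_nonunit' a ha := by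
    have h : ∀ a : ZMod 12, chiThreeTable a = 0 ∨ a * a = 1 := by decide
    exact (h a).resolve_right fun hb => ha (IsUnit.of_mul_eq_one a hb)

/-- Values of the primitive quadratic character modulo `12`. -/
def chiTwelveTable : ZMod 12 → ℤ := ![0, 1, 0, 0, 0, -1, 0, -1, 0, 0, 0, 1]

/-- The primitive quadratic character modulo `12`. -/
def chiTwelve : MulChar (ZMod 12) ℤ where
  toFun := chiTwelveTable
  map_one' := by decide
  map_mul' := by decide
  map_nonunit' a ha := by
    have h : ∀ a : ZMod 12, chiTwelveTable a = 0 ∨ a * a = 1 := by decide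
    exact (h a).resolve_right fun hb => ha (IsUnit.of_mul_eq_one a hb)

/-- Values of the principal character modulo `12`. -/
def chiOneTable : ZMod 12 → ℤ := ![0, 1, 0, 0, 0, 1, 0, 1, 0, 0, 0, 1]

/-- The principal character modulo `12`. -/
def chiOne : MulChar (ZMod 12) ℤ where
  toFun := chiOneTable
  map_one' := by decide
  map_mul' := by decide
  map_nonunit' a ha := by
    have h : ∀ a : ZMod 12, chiOneTable a = 0 ∨ a * a = 1 := by decide
    exact (h a).resolve_right fun hb => ha (IsUnit.of_mul_eq_one a hb)

/-- The arithmetic function attached to a character modulo `12`. -/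
def charFun (χ : MulChar (ZMod 12) ℤ) : ArithmeticFunction ℤ :=
  ⟨fun n => χ (n : ZMod 12), by
    rw [Nat.cast_zero]; exact χ.map_nonunit (by decide)⟩

theorem charFun_apply (χ : MulChar (ZMod 12) ℤ) (n : ℕ) : charFun χ n = χ (n : ZMod 12) := rfl

theorem charFun_mul (χ : MulChar (ZMod 12) ℤ) (m n : ℕ) :
    charFun χ (m * n) = charFun χ m * charFun χ n := by
  simp [charFun_apply]

theorem charFun_pow (χ : MulChar (ZMod 12) ℤ) (m n : ℕ) :
    charFun χ (m ^ n) = charFun χ m ^ n := by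
  simp [charFun_apply]

theorem isMultiplicative_charFun (χ : MulChar (ZMod 12) ℤ) :
    (charFun χ).IsMultiplicative :=
  ⟨by simp [charFun_apply], fun _ => charFun_mul χ _ _⟩

/-- The function supported on squares with value `μ(d) χ₀(d)` at `d²`. -/
def squareMoebius : ArithmeticFunction ℤ :=
  ⟨fun n => if n.sqrt * n.sqrt = n then μ n.sqrt * charFun chiOne n.sqrt else 0, by simp⟩

theorem squareMoebius_sq (d : ℕ) : squareMoebius (d * d) = μ d * charFun chiOne d := by
  simp [squareMoebius, Nat.sqrt_eq]

theorem squareMoebius_of_not {n : ℕ} (h : ∀ d, d * d ≠ n) : squareMoebius n = 0 := by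
  simp [squareMoebius, h]

theorem isMultiplicative_squareMoebius : squareMoebius.IsMultiplicative := by
  refine ⟨by simpa [charFun_apply] using squareMoebius_sq 1, fun {m n} hmn => ?_⟩
  have hsq : ∀ {m n : ℕ}, m.Coprime n → ∀ d, d * d = m * n → ∃ a, a * a = m := by
    intro m n hmn d hd
    obtain ⟨a, ha⟩ := exists_eq_pow_of_mul_eq_pow (a := m) (b := n) (c := d) (k := 2)
      (Nat.isUnit_iff.2 hmn) (by rw [← hd, sq])
    exact ⟨a, by rw [ha, sq]⟩
  by_cases hm : ∃ a, a * a = m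
  · by_cases hn : ∃ b, b * b = n
    · obtain ⟨a, rfl⟩ := hm
      obtain ⟨b, rfl⟩ := hn
      have hab : a.Coprime b := (hmn.coprime_mul_right).coprime_mul_right_right
      rw [mul_mul_mul_comm, squareMoebius_sq, squareMoebius_sq, squareMoebius_sq, charFun_mul,
        ArithmeticFunction.isMultiplicative_moebius.map_mul_of_coprime hab]
      ring
    · push Not at hn
      rw [squareMoebius_of_not hn, mul_zero]
      refine squareMoebius_of_not fun d hd => ?_
      obtain ⟨b, hb⟩ := hsq hmn.symm d (by rw [hd, mul_comm])
      exact hn b hb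
  · push Not at hm
    rw [squareMoebius_of_not hm, zero_mul]
    refine squareMoebius_of_not fun d hd => ?_
    obtain ⟨b, hb⟩ := hsq hmn d hd
    exact hm b hb

/-- The convolution `χ₀ * χ₋₄`. -/
def twoChar : ArithmeticFunction ℤ := charFun chiOne * charFun chiFour

/-- The convolution of the four characters modulo `12`. -/
def fourChar : ArithmeticFunction ℤ := twoChar * (charFun chiThree * charFun chiTwelve)

/-- The multiplicative function whose values at `12n+1` are the squared coefficients of the
square of Euler's product. -/
def etaFun : ArithmeticFunction ℤ := fourChar * squareMoebius

theorem isMultiplicative_twoChar : twoChar.IsMultiplicative :=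
  (isMultiplicative_charFun _).mul (isMultiplicative_charFun _)

theorem isMultiplicative_fourChar : fourChar.IsMultiplicative :=
  isMultiplicative_twoChar.mul ((isMultiplicative_charFun _).mul (isMultiplicative_charFun _))

theorem isMultiplicative_etaFun : etaFun.IsMultiplicative :=
  isMultiplicative_fourChar.mul isMultiplicative_squareMoebius

open PowerSeries in
/-- The Bell series of an arithmetic function at `p`. -/
noncomputable def bell (p : ℕ) (f : ArithmeticFunction ℤ) : PowerSeries ℤ := mk fun k => f (p ^ k)

theorem bell_mul {p : ℕ} (hp : p.Prime) (f g : ArithmeticFunction ℤ) :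
    bell p (f * g) = bell p f * bell p g := by
  ext k
  rw [PowerSeries.coeff_mul]
  simp only [bell, PowerSeries.coeff_mk]
  rw [ArithmeticFunction.mul_apply, Nat.sum_divisorsAntidiagonal (fun x y => f x * g y),
    Nat.divisors_prime_pow hp, sum_map, Nat.sum_antidiagonal_eq_sum_range_succ_mk]
  refine sum_congr rfl fun i hi => ?_
  have hi : i ≤ k := Nat.lt_succ_iff.1 (mem_range.1 hi)
  simp only [Function.Embedding.coeFn_mk]
  rw [Nat.pow_div hi hp.pos]

/-- The geometric series with ratio `c`. -/
noncomputable def geom (c : ℤ) : PowerSeries ℤ := PowerSeries.mk fun k => c ^ k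

theorem bell_charFun (p : ℕ) (χ : MulChar (ZMod 12) ℤ) :
    bell p (charFun χ) = geom (charFun χ p) := by
  ext k
  simp [bell, geom, charFun_pow]

theorem one_sub_mul_geom (c : ℤ) : (1 - PowerSeries.C c * PowerSeries.X) * geom c = 1 := by
  ext k
  rw [sub_mul, one_mul, mul_assoc]
  cases k with
  | zero => simp [geom]
  | succ k =>
    rw [map_sub, PowerSeries.coeff_C_mul, PowerSeries.coeff_succ_X_mul]
    simp [geom, pow_succ', PowerSeries.coeff_one]

theorem bell_squareMoebius {p : ℕ} (hp : p.Prime) :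
    bell p squareMoebius = 1 - PowerSeries.C (charFun chiOne p) * PowerSeries.X ^ 2 := by
  ext k
  simp only [bell, PowerSeries.coeff_mk, map_sub, PowerSeries.coeff_one, PowerSeries.coeff_C_mul,
    PowerSeries.coeff_X_pow]
  rcases Nat.even_or_odd k with ⟨i, rfl⟩ | hk
  · rw [pow_add, squareMoebius_sq]
    rcases i with _ | _ | i
    · simp [charFun_apply]
    · simp [ArithmeticFunction.moebius_apply_prime hp]
    · rw [ArithmeticFunction.moebius_apply_prime_pow hp (by omega), if_neg (by omega),
        if_neg (by omega), if_neg (by omega)]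
      simp
  · rw [squareMoebius_of_not, if_neg, if_neg]
    · simp
    · rintro rfl; exact absurd hk (by decide)
    · rintro rfl; exact absurd hk (by decide)
    · intro d hd
      have h1 : d ∣ p ^ k := ⟨d, hd.symm⟩
      obtain ⟨i, -, rfl⟩ := (Nat.dvd_prime_pow hp).1 h1
      rw [← pow_add] at hd
      have := Nat.pow_right_injective hp.two_le hd
      obtain ⟨j, hj⟩ := hk
      omega

theorem bell_twoChar {p : ℕ} (hp : p.Prime) :
    bell p twoChar = geom (charFun chiOne p) * geom (charFun chiFour p) := by
  rw [twoChar, bell_mul hp, bell_charFun, bell_charFun]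

theorem bell_fourChar {p : ℕ} (hp : p.Prime) :
    bell p fourChar = geom (charFun chiOne p) * geom (charFun chiFour p) *
      (geom (charFun chiThree p) * geom (charFun chiTwelve p)) := by
  rw [fourChar, bell_mul hp, bell_twoChar hp, bell_mul hp, bell_charFun, bell_charFun]

/-- Values of the four characters at a natural number, by residue modulo `12`. -/
theorem charFun_cases (n : ℕ) :
    (charFun chiOne n = 0 ∧ charFun chiFour n = 0 ∧ charFun chiThree n = 0 ∧
      charFun chiTwelve n = 0 ∧ (2 ∣ n ∨ 3 ∣ n)) ∨
    (charFun chiOne n = 1 ∧ charFun chiFour n = 1 ∧ charFun chiThree n = 1 ∧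
      charFun chiTwelve n = 1 ∧ n % 12 = 1) ∨
    (charFun chiOne n = 1 ∧ charFun chiFour n = 1 ∧ charFun chiThree n = -1 ∧
      charFun chiTwelve n = -1 ∧ n % 12 = 5) ∨
    (charFun chiOne n = 1 ∧ charFun chiFour n = -1 ∧ charFun chiThree n = 1 ∧
      charFun chiTwelve n = -1 ∧ n % 12 = 7) ∨
    (charFun chiOne n = 1 ∧ charFun chiFour n = -1 ∧ charFun chiThree n = -1 ∧
      charFun chiTwelve n = 1 ∧ n % 12 = 11) := by
  have h : ∀ χ : MulChar (ZMod 12) ℤ, charFun χ n = χ ((n % 12 : ℕ) : ZMod 12) := by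
    intro χ; rw [charFun_apply, ZMod.natCast_mod]
  have h2 : (2 ∣ n ↔ n % 12 % 2 = 0) := by omega
  have h3 : (3 ∣ n ↔ n % 12 % 3 = 0) := by omega
  rw [h2, h3, h, h, h, h]
  have hlt : n % 12 < 12 := Nat.mod_lt _ (by norm_num)
  generalize n % 12 = r at hlt
  interval_cases r <;> decide

theorem eq_two_or_three {p : ℕ} (hp : p.Prime) (h : 2 ∣ p ∨ 3 ∣ p) : p = 2 ∨ p = 3 := by
  rcases h with h | h
  · exact Or.inl ((Nat.prime_dvd_prime_iff_eq Nat.prime_two hp).1 h).symm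
  · exact Or.inr ((Nat.prime_dvd_prime_iff_eq Nat.prime_three hp).1 h).symm

/-- Power series all of whose coefficients are nonnegative. -/
def NonnegCoeff (f : PowerSeries ℤ) : Prop := ∀ k, 0 ≤ PowerSeries.coeff k f

theorem NonnegCoeff.mul {f g : PowerSeries ℤ} (hf : NonnegCoeff f) (hg : NonnegCoeff g) :
    NonnegCoeff (f * g) := fun k => by
  rw [PowerSeries.coeff_mul]
  exact sum_nonneg fun _ _ => mul_nonneg (hf _) (hg _)

theorem nonnegCoeff_geom {c : ℤ} (hc : 0 ≤ c) : NonnegCoeff (geom c) := fun k => by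
  simpa [geom] using pow_nonneg hc k

/-- The series `∑ X^{2k}`. -/
noncomputable def evenSeries : PowerSeries ℤ := PowerSeries.mk fun k => if Even k then 1 else 0

theorem one_sub_mul_evenSeries : (1 - PowerSeries.X ^ 2) * evenSeries = 1 := by
  ext k
  rw [sub_mul, one_mul, map_sub, PowerSeries.coeff_X_pow_mul']
  rcases k with _ | _ | k
  · simp [evenSeries]
  · simp [evenSeries, PowerSeries.coeff_one]
  · simp [evenSeries, PowerSeries.coeff_one, Nat.even_add]

theorem geom_mul_geom_neg : geom 1 * geom (-1) = evenSeries := by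
  have h1 := one_sub_mul_geom 1
  have h2 := one_sub_mul_geom (-1)
  have h3 := one_sub_mul_evenSeries
  simp only [map_one, map_neg, one_mul] at h1 h2
  calc geom 1 * geom (-1) = geom 1 * geom (-1) * ((1 - PowerSeries.X ^ 2) * evenSeries) := by
        rw [h3, mul_one]
    _ = ((1 - PowerSeries.X) * geom 1) * ((1 - -1 * PowerSeries.X) * geom (-1)) * evenSeries := by
        ring
    _ = evenSeries := by rw [h1, h2]; ring

theorem nonnegCoeff_evenSeries : NonnegCoeff evenSeries := fun k => by
  simp only [evenSeries, PowerSeries.coeff_mk]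
  split_ifs <;> simp

theorem nonneg_of_bell {f : ArithmeticFunction ℤ} (hf : f.IsMultiplicative)
    (h : ∀ p : ℕ, p.Prime → NonnegCoeff (bell p f)) (n : ℕ) : 0 ≤ f n := by
  rcases eq_or_ne n 0 with rfl | hn
  · simp
  rw [hf.multiplicative_factorization f hn]
  refine prod_nonneg fun p hp => ?_
  have := h p (Nat.prime_of_mem_primeFactors (by simpa using hp)) (n.factorization p)
  simpa [bell] using this

theorem twoChar_nonneg (n : ℕ) : 0 ≤ twoChar n := by
  refine nonneg_of_bell isMultiplicative_twoChar (fun p hp => ?_) n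
  rw [bell_twoChar hp]
  rcases charFun_cases p with h | h | h | h | h <;> rw [h.1, h.2.1]
  · exact (nonnegCoeff_geom le_rfl).mul (nonnegCoeff_geom le_rfl)
  · exact (nonnegCoeff_geom zero_le_one).mul (nonnegCoeff_geom zero_le_one)
  · exact (nonnegCoeff_geom zero_le_one).mul (nonnegCoeff_geom zero_le_one)
  · rw [geom_mul_geom_neg]; exact nonnegCoeff_evenSeries
  · rw [geom_mul_geom_neg]; exact nonnegCoeff_evenSeries

theorem bell_fourChar_eq_evenSeries {p : ℕ} (hp : p.Prime)
    (h : p % 12 = 5 ∨ p % 12 = 7 ∨ p % 12 = 11) :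
    bell p fourChar = evenSeries * evenSeries := by
  rw [bell_fourChar hp, ← geom_mul_geom_neg]
  rcases charFun_cases p with hc | hc | hc | hc | hc <;> rw [hc.1, hc.2.1, hc.2.2.1, hc.2.2.2.1]
  · rcases eq_two_or_three hp hc.2.2.2.2 with rfl | rfl <;> omega
  · omega
  all_goals ring

theorem fourChar_nonneg (n : ℕ) : 0 ≤ fourChar n := by
  refine nonneg_of_bell isMultiplicative_fourChar (fun p hp => ?_) n
  have key : p % 12 = 5 ∨ p % 12 = 7 ∨ p % 12 = 11 → NonnegCoeff (bell p fourChar) := fun h => by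
    rw [bell_fourChar_eq_evenSeries hp h]
    exact nonnegCoeff_evenSeries.mul nonnegCoeff_evenSeries
  have h0 := nonnegCoeff_geom le_rfl
  have h1 := nonnegCoeff_geom zero_le_one
  rcases charFun_cases p with h | h | h | h | h
  · rw [bell_fourChar hp, h.1, h.2.1, h.2.2.1, h.2.2.2.1]
    exact (h0.mul h0).mul (h0.mul h0)
  · rw [bell_fourChar hp, h.1, h.2.1, h.2.2.1, h.2.2.2.1]
    exact (h1.mul h1).mul (h1.mul h1)
  all_goals exact key (by omega)

theorem etaFun_prime_pow_of_dvd {p : ℕ} (hp : p.Prime) (h : p = 2 ∨ p = 3) {k : ℕ} (hk : k ≠ 0) :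
    etaFun (p ^ k) = 0 := by
  have h1 : bell p etaFun = 1 := by
    have h0 : geom 0 = 1 := by simpa using one_sub_mul_geom 0
    rw [etaFun, bell_mul hp, bell_squareMoebius hp, bell_fourChar hp]
    rcases charFun_cases p with hc | hc | hc | hc | hc
    · rw [hc.1, hc.2.1, hc.2.2.1, hc.2.2.2.1, h0]
      simp
    all_goals rcases h with rfl | rfl <;> omega
  have := congrArg (PowerSeries.coeff k) h1
  simpa [bell, PowerSeries.coeff_one, hk] using this

theorem etaFun_prime_pow_of_ne_one {p : ℕ} (hp : p.Prime)
    (h : p % 12 = 5 ∨ p % 12 = 7 ∨ p % 12 = 11) (k : ℕ) :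
    etaFun (p ^ k) = if Even k then 1 else 0 := by
  have h1 : bell p etaFun = evenSeries := by
    rw [etaFun, bell_mul hp, bell_squareMoebius hp, bell_fourChar_eq_evenSeries hp h]
    have hone : charFun chiOne p = 1 := by
      rcases charFun_cases p with hc | hc | hc | hc | hc
      · rcases eq_two_or_three hp hc.2.2.2.2 with rfl | rfl <;> omega
      all_goals exact hc.1
    have h3 := one_sub_mul_evenSeries
    rw [hone, map_one, one_mul, mul_comm, ← mul_assoc, h3, one_mul]
  have := congrArg (PowerSeries.coeff k) h1
  simpa [bell, evenSeries] using this

theorem one_sub_mul_mk (a : ℕ → ℤ) :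
    (1 - PowerSeries.X) * PowerSeries.mk a =
      PowerSeries.mk fun k => a k - if k = 0 then 0 else a (k - 1) := by
  ext k
  rw [sub_mul, one_mul, map_sub]
  cases k with
  | zero => simp
  | succ k => simp

theorem etaFun_prime_pow_of_eq_one {p : ℕ} (hp : p.Prime) (h : p % 12 = 1) (k : ℕ) :
    etaFun (p ^ k) = ((k : ℤ) + 1) ^ 2 := by
  have h1 : bell p etaFun = PowerSeries.mk fun k => ((k : ℤ) + 1) ^ 2 := by
    rw [etaFun, bell_mul hp, bell_squareMoebius hp, bell_fourChar hp]
    have hone : charFun chiOne p = 1 ∧ charFun chiFour p = 1 ∧ charFun chiThree p = 1 ∧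
        charFun chiTwelve p = 1 := by
      rcases charFun_cases p with hc | hc | hc | hc | hc
      · rcases eq_two_or_three hp hc.2.2.2.2 with rfl | rfl <;> omega
      · tauto
      all_goals omega
    rw [hone.1, hone.2.1, hone.2.2.1, hone.2.2.2, map_one, one_mul]
    have hg := one_sub_mul_geom 1
    rw [map_one, one_mul] at hg
    have hT : (1 - PowerSeries.X) * ((1 - PowerSeries.X) * ((1 - PowerSeries.X) *
        ((1 - PowerSeries.X) * PowerSeries.mk fun k => ((k : ℤ) + 1) ^ 2))) =
        1 - PowerSeries.X ^ 2 := by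
      rw [one_sub_mul_mk, one_sub_mul_mk, one_sub_mul_mk, one_sub_mul_mk]
      ext k
      rcases k with _ | _ | _ | _ | k
      · simp
      · simp [PowerSeries.coeff_one, PowerSeries.coeff_X_pow]
      · simp [PowerSeries.coeff_one, PowerSeries.coeff_X_pow]
      · simp [PowerSeries.coeff_one, PowerSeries.coeff_X_pow]
      · simp [PowerSeries.coeff_one, PowerSeries.coeff_X_pow]
        ring
    rw [← hT]
    set T : PowerSeries ℤ := PowerSeries.mk fun k => ((k : ℤ) + 1) ^ 2
    calc _ = ((1 - PowerSeries.X) * geom 1) ^ 4 * T := by ring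
      _ = T := by rw [hg, one_pow, one_mul]
  have := congrArg (PowerSeries.coeff k) h1
  simpa [bell] using this

end Characters

section MeanValue

/-- The complex Dirichlet character attached to an integral character modulo `12`. -/
noncomputable def dir (χ : MulChar (ZMod 12) ℤ) : DirichletCharacter ℂ 12 :=
  χ.ringHomComp (Int.castRingHom ℂ)

theorem dir_apply (χ : MulChar (ZMod 12) ℤ) (n : ℕ) :
    dir χ (n : ZMod 12) = (charFun χ : ArithmeticFunction ℂ) n := by
  simp [dir, charFun_apply, MulChar.ringHomComp_apply, ArithmeticFunction.intCoe_apply]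

theorem dir_chiOne : dir chiOne = 1 := by
  ext u
  rw [MulChar.one_apply_coe]
  have h : ∀ a : ZMod 12, chiOne a = 0 ∨ chiOne a = 1 := by
    change ∀ a : ZMod 12, chiOneTable a = 0 ∨ chiOneTable a = 1
    decide
  have h1 : chiOne u * chiOne (u⁻¹ : (ZMod 12)ˣ) = 1 := by
    rw [← map_mul, Units.mul_inv, map_one]
  rcases h u with h0 | h0
  · simp [h0] at h1
  · simp [dir, MulChar.ringHomComp_apply, h0]

theorem dir_ne_one {χ : MulChar (ZMod 12) ℤ} {a : ZMod 12} (ha : χ a = -1) : dir χ ≠ 1 := by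
  intro h
  have hu : IsUnit a := by
    by_contra hu
    rw [χ.map_nonunit hu] at ha
    norm_num at ha
  have h1 : dir χ a = 1 := by rw [h, MulChar.one_apply hu]
  simp only [dir, MulChar.ringHomComp_apply, ha] at h1
  norm_num at h1

theorem dir_chiFour_ne_one : dir chiFour ≠ 1 :=
  dir_ne_one (a := 11) (show chiFourTable 11 = -1 by decide)

theorem dir_chiThree_ne_one : dir chiThree ≠ 1 :=
  dir_ne_one (a := 11) (show chiThreeTable 11 = -1 by decide)

theorem dir_chiTwelve_ne_one : dir chiTwelve ≠ 1 :=
  dir_ne_one (a := 7) (show chiTwelveTable 7 = -1 by decide)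

theorem exists_norm_sum_charFun_le {χ : MulChar (ZMod 12) ℤ} (h : dir χ ≠ 1) :
    ∃ B : ℝ, ∀ n : ℕ, ‖∑ m ∈ Ioc 0 n, (charFun χ : ArithmeticFunction ℂ) m‖ ≤ B := by
  obtain ⟨C, hC⟩ := exists_norm_sum_character_le h
  refine ⟨C, fun n => ?_⟩
  simpa only [dir_apply] using hC 0 n

theorem norm_charFun_le (χ : MulChar (ZMod 12) ℤ) (n : ℕ) :
    ‖(charFun χ : ArithmeticFunction ℂ) n‖ ≤ 1 := by
  rw [← dir_apply]
  exact (dir χ).norm_le_one _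

theorem tendsto_mean_chiOne :
    Tendsto (fun n : ℕ => (∑ m ∈ Ioc 0 n, (charFun chiOne : ArithmeticFunction ℂ) m) / n) atTop
      (𝓝 (1 / 3)) := by
  have hval : ∀ n : ℕ, charFun chiOne n = chiOneTable ((n % 12 : ℕ) : ZMod 12) := fun n => by
    rw [ZMod.natCast_mod]; rfl
  have hsum : ∀ n : ℕ, ∑ m ∈ Ioc 0 n, charFun chiOne m =
      4 * ((n / 12 : ℕ) : ℤ) + ∑ m ∈ Ioc 0 (n % 12), charFun chiOne m := by
    intro n
    induction n with
    | zero => simp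
    | succ n ih =>
      rw [← Finset.insert_Ioc_right_eq_Ioc_add_one (Nat.zero_le n), sum_insert (by simp), ih, hval]
      have hlt : n % 12 < 12 := Nat.mod_lt _ (by norm_num)
      have h1 : (n + 1) % 12 = (n % 12 + 1) % 12 := by omega
      have h2 : (n + 1) / 12 = n / 12 + (n % 12 + 1) / 12 := by omega
      rw [h1, h2]
      generalize n % 12 = r at hlt
      generalize n / 12 = q
      push_cast
      rw [mul_add]
      have h3 : ∀ r < 12, chiOneTable (((r + 1) % 12 : ℕ) : ZMod 12) +
          ∑ m ∈ Ioc 0 r, charFun chiOne m =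
          4 * (((r + 1) / 12 : ℕ) : ℤ) + ∑ m ∈ Ioc 0 ((r + 1) % 12), charFun chiOne m := by
        decide
      have := h3 r hlt
      push_cast at this ⊢
      linarith
  have hbd : ∀ n : ℕ, |3 * ∑ m ∈ Ioc 0 n, charFun chiOne m - (n : ℤ)| ≤ 12 := by
    intro n
    rw [hsum]
    have hlt : n % 12 < 12 := Nat.mod_lt _ (by norm_num)
    have h3 : ∀ r < 12, |3 * ∑ m ∈ Ioc 0 r, charFun chiOne m - (r : ℤ)| ≤ 12 := by decide
    have h4 : (n : ℤ) = 12 * ((n / 12 : ℕ) : ℤ) + ((n % 12 : ℕ) : ℤ) := by omega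
    have h5 := h3 (n % 12) hlt
    have h6 : 3 * (4 * ((n / 12 : ℕ) : ℤ) + ∑ m ∈ Ioc 0 (n % 12), charFun chiOne m) - (n : ℤ) =
        3 * ∑ m ∈ Ioc 0 (n % 12), charFun chiOne m - ((n % 12 : ℕ) : ℤ) := by
      linarith
    rw [h6]
    exact h5
  rw [tendsto_iff_norm_sub_tendsto_zero]
  have hlim : Tendsto (fun n : ℕ => (4 : ℝ) / n) atTop (𝓝 0) :=
    tendsto_const_div_atTop_nhds_zero_nat 4
  refine squeeze_zero' (Eventually.of_forall fun _ => norm_nonneg _) ?_ hlim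
  filter_upwards [eventually_gt_atTop 0] with n hn
  have hn' : (0 : ℝ) < n := by exact_mod_cast hn
  have hn'' : (n : ℂ) ≠ 0 := by exact_mod_cast hn.ne'
  have h1 : (∑ m ∈ Ioc 0 n, (charFun chiOne : ArithmeticFunction ℂ) m) / n - 1 / 3 =
      ((3 * ∑ m ∈ Ioc 0 n, charFun chiOne m - (n : ℤ) : ℤ) : ℂ) / (3 * n) := by
    simp only [ArithmeticFunction.intCoe_apply]
    push_cast
    field_simp
  rw [h1, norm_div, Complex.norm_intCast, norm_mul, Complex.norm_natCast, Complex.norm_ofNat,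
    div_le_div_iff₀ (by positivity) hn']
  have h2 : ((|3 * ∑ m ∈ Ioc 0 n, charFun chiOne m - (n : ℤ)| : ℤ) : ℝ) ≤ 12 := by
    exact_mod_cast hbd n
  rw [← Int.cast_abs]
  nlinarith

theorem isSquare_sum_le (n : ℕ) :
    ‖∑ m ∈ Ioc 0 n, (squareMoebius : ArithmeticFunction ℂ) m‖ ≤ √(n : ℝ) := by
  have h1 : ∑ m ∈ Ioc 0 n, (squareMoebius : ArithmeticFunction ℂ) m =
      ∑ d ∈ Ioc 0 n.sqrt, (squareMoebius : ArithmeticFunction ℂ) (d * d) := by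
    rw [← sum_image (f := fun m => (squareMoebius : ArithmeticFunction ℂ) m) (g := fun d => d * d)
      (fun a _ b _ h => Nat.mul_self_inj.1 h)]
    symm
    refine sum_subset ?_ ?_
    · intro m hm
      obtain ⟨d, hd, rfl⟩ := mem_image.1 hm
      rw [mem_Ioc] at hd ⊢
      exact ⟨Nat.mul_pos hd.1 hd.1, Nat.le_sqrt.1 hd.2⟩
    · intro m hm hm'
      rw [ArithmeticFunction.intCoe_apply, squareMoebius_of_not, Int.cast_zero]
      rintro d rfl
      rw [mem_Ioc] at hm
      refine hm' (mem_image.2 ⟨d, mem_Ioc.2 ⟨?_, Nat.le_sqrt.2 hm.2⟩, rfl⟩)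
      exact Nat.pos_of_ne_zero fun h => by simp [h] at hm
  rw [h1]
  refine (norm_sum_le _ _).trans ?_
  calc ∑ d ∈ Ioc 0 n.sqrt, ‖(squareMoebius : ArithmeticFunction ℂ) (d * d)‖
      ≤ ∑ d ∈ Ioc 0 n.sqrt, (1 : ℝ) := by
        refine sum_le_sum fun d _ => ?_
        rw [ArithmeticFunction.intCoe_apply, squareMoebius_sq, Int.cast_mul, norm_mul]
        have h2 := norm_charFun_le chiOne d
        rw [ArithmeticFunction.intCoe_apply] at h2
        have h3 : ‖((μ d : ℤ) : ℂ)‖ ≤ 1 := by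
          rw [Complex.norm_intCast]
          exact_mod_cast ArithmeticFunction.abs_moebius_le_one
        exact mul_le_one₀ h3 (norm_nonneg _) h2
    _ = (n.sqrt : ℝ) := by simp
    _ ≤ √(n : ℝ) := Real.nat_sqrt_le_real_sqrt

/-- A nonnegative function with a mean value has linearly bounded sums of absolute values. -/
theorem exists_sum_norm_le {f : ArithmeticFunction ℤ} (hf : ∀ n, 0 ≤ f n) {c : ℂ}
    (h : Tendsto (fun n : ℕ => (∑ m ∈ Ioc 0 n, (f : ArithmeticFunction ℂ) m) / n) atTop (𝓝 c)) :
    ∃ C : ℝ, ∀ n : ℕ, ∑ m ∈ Ioc 0 n, ‖(f : ArithmeticFunction ℂ) m‖ ≤ C * n := by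
  obtain ⟨C, hC⟩ := (h.norm.isBoundedUnder_le).bddAbove_range
  refine ⟨C, fun n => ?_⟩
  have h1 : ∑ m ∈ Ioc 0 n, ‖(f : ArithmeticFunction ℂ) m‖ =
      ‖∑ m ∈ Ioc 0 n, (f : ArithmeticFunction ℂ) m‖ := by
    simp only [ArithmeticFunction.intCoe_apply]
    rw [← Int.cast_sum, Complex.norm_intCast, ← Int.cast_abs,
      abs_of_nonneg (sum_nonneg fun i _ => hf i), Int.cast_sum]
    refine sum_congr rfl fun i _ => ?_
    rw [Complex.norm_intCast, ← Int.cast_abs, abs_of_nonneg (hf i)]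
  rcases Nat.eq_zero_or_pos n with rfl | hn
  · simp
  have hn' : (0 : ℝ) < n := by exact_mod_cast hn
  have h2 := hC ⟨n, rfl⟩
  simp only [norm_div, Complex.norm_natCast] at h2
  rw [h1]
  exact (div_le_iff₀ hn').1 h2

/-- Linear growth of the sums of absolute values gives absolute convergence to the right
of `1`. -/
theorem exists_mean_twoChar : ∃ c : ℂ,
    Tendsto (fun n : ℕ => (∑ m ∈ Ioc 0 n, (twoChar : ArithmeticFunction ℂ) m) / n) atTop
      (𝓝 c) := by
  obtain ⟨B, hB⟩ := exists_norm_sum_charFun_le dir_chiFour_ne_one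
  rw [twoChar, ArithmeticFunction.intCoe_mul]
  refine exists_mean_mul (C := 1) (B := B) tendsto_mean_chiOne (fun n => ?_) fun n => ?_
  · calc _ ≤ ∑ m ∈ Ioc 0 n, (1 : ℝ) := sum_le_sum fun m _ => norm_charFun_le _ m
      _ = 1 * n := by simp
  · have hB0 : 0 ≤ B := (norm_nonneg _).trans (hB 0)
    rcases Nat.eq_zero_or_pos n with rfl | hn
    · simp
    · exact (hB n).trans (le_mul_of_one_le_right hB0
        (Real.one_le_sqrt.2 (by exact_mod_cast hn)))

theorem exists_mean_fourChar : ∃ c : ℂ,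
    Tendsto (fun n : ℕ => (∑ m ∈ Ioc 0 n, (fourChar : ArithmeticFunction ℂ) m) / n) atTop
      (𝓝 c) := by
  obtain ⟨c, hc⟩ := exists_mean_twoChar
  obtain ⟨C, hC⟩ := exists_sum_norm_le twoChar_nonneg hc
  obtain ⟨B₁, hB₁⟩ := exists_norm_sum_charFun_le dir_chiThree_ne_one
  obtain ⟨B₂, hB₂⟩ := exists_norm_sum_charFun_le dir_chiTwelve_ne_one
  rw [fourChar, ArithmeticFunction.intCoe_mul,
    ArithmeticFunction.intCoe_mul (f := charFun chiThree)]
  exact exists_mean_mul hc hC (norm_sum_mul_le (B := max B₁ B₂) (norm_charFun_le _)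
    (norm_charFun_le _) (fun n => (hB₁ n).trans (le_max_left _ _))
    (fun n => (hB₂ n).trans (le_max_right _ _)))

theorem exists_mean_etaFun : ∃ c : ℂ,
    Tendsto (fun n : ℕ => (∑ m ∈ Ioc 0 n, (etaFun : ArithmeticFunction ℂ) m) / n) atTop
      (𝓝 c) := by
  obtain ⟨c, hc⟩ := exists_mean_fourChar
  obtain ⟨C, hC⟩ := exists_sum_norm_le fourChar_nonneg hc
  rw [etaFun, ArithmeticFunction.intCoe_mul]
  exact exists_mean_mul (B := 1) hc hC (fun n => by simpa using isSquare_sum_le n)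

end MeanValue

section EulerProduct

theorem LSeriesSummable_charFun (χ : MulChar (ZMod 12) ℤ) {s : ℂ} (hs : 1 < s.re) :
    LSeriesSummable (fun n => (charFun χ : ArithmeticFunction ℂ) n) s :=
  LSeriesSummable_of_bounded_of_one_lt_re (fun n _ => norm_charFun_le χ n) hs

theorem LSeries_charFun (χ : MulChar (ZMod 12) ℤ) {s : ℂ} (hs : 1 < s.re) :
    LSeries (fun n => (charFun χ : ArithmeticFunction ℂ) n) s = (dir χ).LFunction s := by
  rw [DirichletCharacter.LFunction_eq_LSeries _ hs]
  simp only [dir_apply]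

theorem LSeriesSummable_squareMoebius {s : ℂ} (hs : 1 < s.re) :
    LSeriesSummable (fun n => (squareMoebius : ArithmeticFunction ℂ) n) s := by
  refine LSeriesSummable_of_bounded_of_one_lt_re (m := 1) (fun n _ => ?_) hs
  rw [ArithmeticFunction.intCoe_apply]
  by_cases h : ∃ d, d * d = n
  · obtain ⟨d, rfl⟩ := h
    rw [squareMoebius_sq, Int.cast_mul, norm_mul]
    have h2 := norm_charFun_le chiOne d
    rw [ArithmeticFunction.intCoe_apply] at h2
    have h3 : ‖((μ d : ℤ) : ℂ)‖ ≤ 1 := by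
      rw [Complex.norm_intCast]
      exact_mod_cast ArithmeticFunction.abs_moebius_le_one
    exact mul_le_one₀ h3 (norm_nonneg _) h2
  · push Not at h
    simp [squareMoebius_of_not h]

theorem LSeries_squareMoebius {s : ℂ} (hs : 1 < s.re) :
    LSeries (fun n => (squareMoebius : ArithmeticFunction ℂ) n) s =
      ((dir chiOne).LFunction (2 * s))⁻¹ := by
  have hs2 : 1 < (2 * s).re := by
    simp only [Complex.mul_re, Complex.re_ofNat, Complex.im_ofNat, zero_mul, sub_zero]
    linarith
  have h1 := DirichletCharacter.LSeries.mul_mu_eq_one (dir chiOne) hs2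
  rw [DirichletCharacter.LFunction_eq_LSeries _ hs2]
  refine eq_inv_of_mul_eq_one_right ?_
  rw [← h1]
  congr 1
  rw [LSeries, LSeries]
  rw [← Function.Injective.tsum_eq (g := fun d : ℕ => d * d) fun a b h => Nat.mul_self_inj.1 h]
  · refine tsum_congr fun d => ?_
    rcases eq_or_ne d 0 with rfl | hd
    · simp
    rw [LSeries.term_of_ne_zero (mul_ne_zero hd hd), LSeries.term_of_ne_zero hd,
      ArithmeticFunction.intCoe_apply, squareMoebius_sq, Pi.mul_apply, dir_apply,
      ArithmeticFunction.intCoe_apply, Nat.cast_mul, Complex.natCast_mul_natCast_cpow,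
      two_mul, Complex.cpow_add _ _ (by exact_mod_cast hd)]
    push_cast
    ring
  · intro n hn
    by_contra h
    refine hn ?_
    have h0 : squareMoebius n = 0 := squareMoebius_of_not fun d hd => h ⟨d, hd⟩
    simp [LSeries.term, ArithmeticFunction.intCoe_apply, h0]

theorem LSeriesSummable_etaFun {s : ℂ} (hs : 1 < s.re) :
    LSeriesSummable (fun n => (etaFun : ArithmeticFunction ℂ) n) s := by
  simp only [etaFun, fourChar, twoChar, ArithmeticFunction.intCoe_mul]
  have h := fun χ => LSeriesSummable_charFun χ hs
  exact ArithmeticFunction.LSeriesSummable_mul (ArithmeticFunction.LSeriesSummable_mul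
    (ArithmeticFunction.LSeriesSummable_mul (h _) (h _))
    (ArithmeticFunction.LSeriesSummable_mul (h _) (h _))) (LSeriesSummable_squareMoebius hs)

theorem LSeries_etaFun {s : ℂ} (hs : 1 < s.re) :
    LSeries (fun n => (etaFun : ArithmeticFunction ℂ) n) s =
      (dir chiOne).LFunction s * (dir chiFour).LFunction s *
        ((dir chiThree).LFunction s * (dir chiTwelve).LFunction s) *
          ((dir chiOne).LFunction (2 * s))⁻¹ := by
  have h := fun χ => LSeriesSummable_charFun χ hs
  have hm := @ArithmeticFunction.LSeriesSummable_mul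
  simp only [etaFun, fourChar, twoChar, ArithmeticFunction.intCoe_mul]
  rw [ArithmeticFunction.LSeries_mul' (hm (hm (h _) (h _)) (hm (h _) (h _)))
      (LSeriesSummable_squareMoebius hs), ArithmeticFunction.LSeries_mul' (hm (h _) (h _))
      (hm (h _) (h _)), ArithmeticFunction.LSeries_mul' (h _) (h _),
    ArithmeticFunction.LSeries_mul' (h _) (h _), LSeries_squareMoebius hs]
  simp only [LSeries_charFun _ hs]

/-- The value of the limiting Euler product in terms of `L`-values. -/
noncomputable def eulerValue : ℂ :=
  (dir chiFour).LFunction 1 * ((dir chiThree).LFunction 1 * (dir chiTwelve).LFunction 1) *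
    ((dir chiOne).LFunction 2)⁻¹

theorem LFunction_chiOne_two_ne_zero : (dir chiOne).LFunction 2 ≠ 0 := by
  rw [DirichletCharacter.LFunction_eq_LSeries _ (by simp)]
  exact DirichletCharacter.LSeries_ne_zero_of_one_lt_re _ (by simp)

theorem eulerValue_ne_zero : eulerValue ≠ 0 :=
  mul_ne_zero (mul_ne_zero
    (DirichletCharacter.LFunction_apply_one_ne_zero dir_chiFour_ne_one)
    (mul_ne_zero (DirichletCharacter.LFunction_apply_one_ne_zero dir_chiThree_ne_one)
      (DirichletCharacter.LFunction_apply_one_ne_zero dir_chiTwelve_ne_one)))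
    (inv_ne_zero LFunction_chiOne_two_ne_zero)

theorem tendsto_ofReal_nhdsGT_one :
    Tendsto (fun s : ℝ => (s : ℂ)) (𝓝[>] 1) (𝓝[≠] 1) := by
  refine tendsto_nhdsWithin_iff.2 ⟨?_, ?_⟩
  · exact (Complex.continuous_ofReal.tendsto 1).mono_left nhdsWithin_le_nhds
  · filter_upwards [self_mem_nhdsWithin] with s hs
    have : s ≠ 1 := ne_of_gt hs
    simpa using this

theorem tendsto_LSeries_etaFun :
    Tendsto (fun s : ℝ => ((s : ℂ) - 1) * LSeries (fun n => (etaFun : ArithmeticFunction ℂ) n) s)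
      (𝓝[>] 1) (𝓝 (eulerValue / 3)) := by
  have ht := tendsto_ofReal_nhdsGT_one
  have ht' := ht.mono_right nhdsWithin_le_nhds
  have hcont : ∀ {χ : DirichletCharacter ℂ 12}, χ ≠ 1 →
      Tendsto (fun s : ℝ => χ.LFunction s) (𝓝[>] 1) (𝓝 (χ.LFunction 1)) := fun hχ =>
    ((DirichletCharacter.differentiable_LFunction hχ).continuous.tendsto 1).comp ht'
  have hres : Tendsto (fun s : ℝ => ((s : ℂ) - 1) * (dir chiOne).LFunction s) (𝓝[>] 1)
      (𝓝 (1 / 3)) := by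
    have h := (DirichletCharacter.LFunctionTrivChar_residue_one (N := 12)).comp ht
    have hp : (12 : ℕ).primeFactors = {2, 3} := by
      rw [show (12 : ℕ) = 2 ^ 2 * 3 by norm_num, Nat.primeFactors_mul (by norm_num) (by norm_num),
        Nat.primeFactors_prime_pow (by norm_num) Nat.prime_two, Nat.prime_three.primeFactors]
      rfl
    rw [hp, prod_pair (by norm_num)] at h
    have hv : (1 - ((2 : ℕ) : ℂ)⁻¹) * (1 - ((3 : ℕ) : ℂ)⁻¹) = 1 / 3 := by norm_num
    rw [hv] at h
    rw [dir_chiOne]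
    exact h
  have h2 : Tendsto (fun s : ℝ => ((dir chiOne).LFunction (2 * s))⁻¹) (𝓝[>] 1)
      (𝓝 ((dir chiOne).LFunction 2)⁻¹) := by
    refine Tendsto.inv₀ ?_ LFunction_chiOne_two_ne_zero
    have hd := (DirichletCharacter.differentiableAt_LFunction (dir chiOne) 2
      (Or.inl (by norm_num))).continuousAt.tendsto
    refine hd.comp ?_
    simpa using ht'.const_mul (2 : ℂ)
  have hall := (hres.mul ((hcont dir_chiFour_ne_one).mul
    ((hcont dir_chiThree_ne_one).mul (hcont dir_chiTwelve_ne_one)))).mul h2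
  have hval : 1 / 3 * ((dir chiFour).LFunction 1 * ((dir chiThree).LFunction 1 *
      (dir chiTwelve).LFunction 1)) * ((dir chiOne).LFunction 2)⁻¹ = eulerValue / 3 := by
    rw [eulerValue]; ring
  rw [hval] at hall
  refine hall.congr' ?_
  filter_upwards [self_mem_nhdsWithin] with s hs
  rw [LSeries_etaFun (by simpa using hs)]
  ring

theorem tendsto_mean_etaFun :
    Tendsto (fun n : ℕ => (∑ m ∈ Ioc 0 n, (etaFun : ArithmeticFunction ℂ) m) / n) atTop
      (𝓝 (eulerValue / 3)) := by
  obtain ⟨c, hc⟩ := exists_mean_etaFun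
  have h := LSeries_tendsto_sub_mul_nhds_one_of_tendsto_sum_div
    (f := fun n => (etaFun : ArithmeticFunction ℂ) n) hc
    fun s hs => LSeriesSummable_etaFun (by simpa using hs)
  rwa [tendsto_nhds_unique h tendsto_LSeries_etaFun] at hc

/-- The factor at `p` of the Euler product. -/
noncomputable def eulerFactor (p : ℕ) : ℝ :=
  if p % 12 = 5 ∨ p % 12 = 7 ∨ p % 12 = 11 then (1 + (p : ℝ)⁻¹)⁻¹
  else if p % 12 = 1 then (1 + (p : ℝ)⁻¹) * ((1 - (p : ℝ)⁻¹)⁻¹) ^ 2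
  else 1

theorem eulerFactor_nonneg (p : ℕ) : 0 ≤ eulerFactor p := by
  rw [eulerFactor]
  split_ifs <;> positivity

theorem eulerFactor_eq {p : ℕ} (hp : p.Prime) :
    (eulerFactor p : ℂ) =
      (1 - dir chiFour (p : ZMod 12) / p)⁻¹ * ((1 - dir chiThree (p : ZMod 12) / p)⁻¹ *
        (1 - dir chiTwelve (p : ZMod 12) / p)⁻¹) *
          (1 - dir chiOne (p : ZMod 12) * (p : ℂ) ^ (-2 : ℂ)) := by
  have hp0 : (p : ℂ) ≠ 0 := by exact_mod_cast hp.ne_zero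
  have h1 : (p : ℂ) - 1 ≠ 0 := sub_ne_zero.2 (by exact_mod_cast hp.one_lt.ne')
  have h2 : (p : ℂ) + 1 ≠ 0 := by exact_mod_cast p.succ_ne_zero
  have hpow : (p : ℂ) ^ (-2 : ℂ) = ((p : ℂ) ^ 2)⁻¹ := by
    rw [Complex.cpow_neg, Complex.cpow_ofNat]
  have e1 : (1 : ℂ) - (p : ℂ)⁻¹ ≠ 0 := by
    have : (1 : ℂ) - (p : ℂ)⁻¹ = (p - 1) / p := by field_simp
    rw [this]; exact div_ne_zero h1 hp0
  have e2 : (1 : ℂ) + (p : ℂ)⁻¹ ≠ 0 := by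
    have : (1 : ℂ) + (p : ℂ)⁻¹ = (p + 1) / p := by field_simp
    rw [this]; exact div_ne_zero h2 hp0
  have hsq : (1 : ℂ) - ((p : ℂ) ^ 2)⁻¹ = (1 - (p : ℂ)⁻¹) * (1 + (p : ℂ)⁻¹) := by
    rw [← inv_pow]; ring
  simp only [dir_apply, ArithmeticFunction.intCoe_apply, hpow]
  rw [eulerFactor]
  rcases charFun_cases p with h | h | h | h | h <;>
    rw [h.1, h.2.1, h.2.2.1, h.2.2.2.1]
  · have h0 := eq_two_or_three hp h.2.2.2.2
    rw [if_neg (by rcases h0 with rfl | rfl <;> decide),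
      if_neg (by rcases h0 with rfl | rfl <;> decide)]
    simp
  · rw [if_neg (by omega), if_pos (by omega)]
    push_cast
    rw [one_mul, hsq, one_div]
    field_simp
  · rw [if_pos (by omega)]
    push_cast
    rw [one_mul, hsq, neg_div, one_div, sub_neg_eq_add]
    field_simp
  · rw [if_pos (by omega)]
    push_cast
    rw [one_mul, hsq, neg_div, one_div, sub_neg_eq_add]
    field_simp
  · rw [if_pos (by omega)]
    push_cast
    rw [one_mul, hsq, neg_div, one_div, sub_neg_eq_add]
    field_simp

theorem tendsto_prod_eulerFactor :
    Tendsto (fun x : ℕ => ((∏ p ∈ (range (x + 1)).filter Nat.Prime, eulerFactor p : ℝ) : ℂ)) atTop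
      (𝓝 eulerValue) := by
  have hone : Tendsto (fun x : ℕ => ∏ p ∈ (range (x + 1)).filter Nat.Prime,
      (1 - dir chiOne (p : ZMod 12) * (p : ℂ) ^ (-2 : ℂ))) atTop
      (𝓝 ((dir chiOne).LFunction 2)⁻¹) := by
    have h := (DirichletCharacter.LSeries_eulerProduct (s := 2) (dir chiOne) (by simp)).comp
      (tendsto_add_atTop_nat 1)
    rw [← DirichletCharacter.LFunction_eq_LSeries _ (by simp)] at h
    refine (h.inv₀ LFunction_chiOne_two_ne_zero).congr fun x => ?_
    simp [Nat.primesBelow, prod_inv_distrib]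
  have h := ((tendsto_prod_euler_one dir_chiFour_ne_one).mul
    ((tendsto_prod_euler_one dir_chiThree_ne_one).mul
      (tendsto_prod_euler_one dir_chiTwelve_ne_one))).mul hone
  refine h.congr fun x => ?_
  rw [Complex.ofReal_prod, ← prod_mul_distrib, ← prod_mul_distrib, ← prod_mul_distrib]
  exact prod_congr rfl fun p hp => (eulerFactor_eq (mem_filter.1 hp).2).symm

/-- The Euler product converges to a positive limit, three times the mean value of `etaFun`. -/
theorem exists_limit_eulerFactor : ∃ L : ℝ, 0 < L ∧
    Tendsto (fun x : ℕ => ∏ p ∈ (range (x + 1)).filter Nat.Prime, eulerFactor p) atTop (𝓝 L) ∧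
    Tendsto (fun n : ℕ => (∑ m ∈ Ioc 0 n, (etaFun m : ℝ)) / n) atTop (𝓝 (L / 3)) := by
  have h := (Complex.continuous_re.tendsto _).comp tendsto_prod_eulerFactor
  simp only [Function.comp_def, Complex.ofReal_re] at h
  have heq : ((eulerValue.re : ℝ) : ℂ) = eulerValue :=
    tendsto_nhds_unique ((Complex.continuous_ofReal.tendsto _).comp h) tendsto_prod_eulerFactor
  refine ⟨eulerValue.re, lt_of_le_of_ne ?_ ?_, h, ?_⟩
  · exact ge_of_tendsto' h fun x => prod_nonneg fun p _ => eulerFactor_nonneg p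
  · intro h0
    rw [← h0] at heq
    exact eulerValue_ne_zero (by simpa using heq.symm)
  · have h2 := (Complex.continuous_re.tendsto _).comp tendsto_mean_etaFun
    rw [← heq, show ((eulerValue.re : ℝ) : ℂ) / 3 = ((eulerValue.re / 3 : ℝ) : ℂ) by push_cast; rfl,
      Complex.ofReal_re] at h2
    refine h2.congr fun n => ?_
    have : (∑ m ∈ Ioc 0 n, (etaFun : ArithmeticFunction ℂ) m) / n =
        (((∑ m ∈ Ioc 0 n, (etaFun m : ℝ)) / n : ℝ) : ℂ) := by
      simp only [ArithmeticFunction.intCoe_apply]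
      push_cast
      rfl
    rw [Function.comp_apply, this, Complex.ofReal_re]

end EulerProduct

section Gaussian

/-- The component at `2` of the Hecke character. -/
def psiTwo (a b : ZMod 2) : GaussianInt := if a = b then 0 else if a = 1 then 1 else -1

/-- The component at `3` of the Hecke character. -/
def psiThree (a b : ZMod 3) : GaussianInt :=
  if a = 0 then (if b = 0 then 0 else -1)
  else if b = 0 then 1 else if a = b then ⟨0, 1⟩ else ⟨0, -1⟩

/-- A Hecke character of order `4` and modulus `6` on the Gaussian integers. -/
def psi (α : GaussianInt) : GaussianInt := psiTwo α.re α.im * psiThree α.re α.im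

theorem psiTwo_mul : ∀ a b c d : ZMod 2,
    psiTwo (a * c - b * d) (a * d + b * c) = psiTwo a b * psiTwo c d := by decide

set_option maxRecDepth 10000 in
theorem psiThree_mul : ∀ a b c d : ZMod 3,
    psiThree (a * c - b * d) (a * d + b * c) = psiThree a b * psiThree c d := by decide

theorem psi_mul (α β : GaussianInt) : psi (α * β) = psi α * psi β := by
  have h2 := psiTwo_mul α.re α.im β.re β.im
  have h3 := psiThree_mul α.re α.im β.re β.im
  have hre : (α * β).re = α.re * β.re - α.im * β.im := by rw [Zsqrtd.re_mul]; ring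
  have him : (α * β).im = α.re * β.im + α.im * β.re := by rw [Zsqrtd.im_mul]
  rw [psi, hre, him]
  push_cast
  rw [h2, h3, psi, psi]
  ring

theorem norm_eq (α : GaussianInt) : α.norm = α.re * α.re + α.im * α.im := by
  rw [Zsqrtd.norm_def]; ring

/-- The Gaussian integers of norm `m`. -/
noncomputable def ofNorm (m : ℕ) : Finset GaussianInt :=
  ((Icc (-(m : ℤ)) m ×ˢ Icc (-(m : ℤ)) m).image fun z => (⟨z.1, z.2⟩ : GaussianInt)).filter
    fun α => α.norm = m

theorem mem_ofNorm {m : ℕ} {α : GaussianInt} : α ∈ ofNorm m ↔ α.norm = m := by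
  rw [ofNorm, mem_filter, and_iff_right_iff_imp]
  intro h
  rw [norm_eq] at h
  refine mem_image.2 ⟨(α.re, α.im), ?_, rfl⟩
  rw [mem_product, mem_Icc, mem_Icc]
  refine ⟨⟨?_, ?_⟩, ?_, ?_⟩ <;> dsimp only <;> nlinarith [mul_self_nonneg α.re,
    mul_self_nonneg α.im, Int.le_self_sq α.re, Int.le_self_sq α.im, Int.le_self_sq (-α.re),
    Int.le_self_sq (-α.im)]

/-- The sum of the Hecke character over the Gaussian integers of norm `m`. -/
noncomputable def heckeSum (m : ℕ) : GaussianInt := ∑ α ∈ ofNorm m, psi α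

theorem heckeSum_one : heckeSum 1 = 4 := by decide

theorem psi_of_two_dvd {α : GaussianInt} (h : 2 ∣ α.norm) : psi α = 0 := by
  have h1 : ∀ a b : ZMod 2, a * a + b * b = 0 → psiTwo a b = 0 := by decide
  have h2 := (ZMod.intCast_zmod_eq_zero_iff_dvd _ 2).2 h
  rw [norm_eq] at h2
  push_cast at h2
  rw [psi, h1 _ _ h2, zero_mul]

theorem psi_of_three_dvd {α : GaussianInt} (h : 3 ∣ α.norm) : psi α = 0 := by
  have h1 : ∀ a b : ZMod 3, a * a + b * b = 0 → psiThree a b = 0 := by decide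
  have h2 := (ZMod.intCast_zmod_eq_zero_iff_dvd _ 3).2 h
  rw [norm_eq] at h2
  push_cast at h2
  rw [psi, h1 _ _ h2, mul_zero]

theorem psi_star_of_one_mod {α : GaussianInt} (h : α.norm % 12 = 1) :
    psi (star α) = psi α ∧ psi α ^ 2 = 1 := by
  have h1 : ∀ a b : ZMod 2, a * a + b * b = 1 →
    psiTwo a (-b) = psiTwo a b ∧ psiTwo a b ^ 2 = 1 := by decide
  have h2 : ∀ a b : ZMod 3, a * a + b * b = 1 →
    psiThree a (-b) = psiThree a b ∧ psiThree a b ^ 2 = 1 := by decide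
  have e2 := (ZMod.intCast_eq_intCast_iff_dvd_sub 1 α.norm 2).2 (by omega)
  have e3 := (ZMod.intCast_eq_intCast_iff_dvd_sub 1 α.norm 3).2 (by omega)
  rw [norm_eq] at e2 e3
  push_cast at e2 e3
  obtain ⟨a1, a2⟩ := h1 _ _ e2.symm
  obtain ⟨b1, b2⟩ := h2 _ _ e3.symm
  rw [psi, psi, Zsqrtd.re_star, Zsqrtd.im_star]
  push_cast
  rw [a1, b1, mul_pow, a2, b2, one_mul]
  exact ⟨rfl, rfl⟩

theorem psi_star_of_five_mod {α : GaussianInt} (h : α.norm % 12 = 5) :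
    psi (star α) = -psi α ∧ psi α ^ 2 = -1 := by
  have h1 : ∀ a b : ZMod 2, a * a + b * b = 1 →
    psiTwo a (-b) = psiTwo a b ∧ psiTwo a b ^ 2 = 1 := by decide
  have h2 : ∀ a b : ZMod 3, a * a + b * b = 2 →
    psiThree a (-b) = -psiThree a b ∧ psiThree a b ^ 2 = -1 := by decide
  have e2 := (ZMod.intCast_eq_intCast_iff_dvd_sub 1 α.norm 2).2 (by omega)
  have e3 := (ZMod.intCast_eq_intCast_iff_dvd_sub 2 α.norm 3).2 (by omega)
  rw [norm_eq] at e2 e3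
  push_cast at e2 e3
  obtain ⟨a1, a2⟩ := h1 _ _ e2.symm
  obtain ⟨b1, b2⟩ := h2 _ _ e3.symm
  rw [psi, psi, Zsqrtd.re_star, Zsqrtd.im_star]
  push_cast
  rw [a1, b1, mul_pow, a2, b2]
  exact ⟨by ring, by ring⟩

theorem star_mul_self_eq {α : GaussianInt} {m : ℕ} (h : α.norm = m) :
    α * star α = (m : GaussianInt) := by
  rw [← Zsqrtd.norm_eq_mul_conj, h, Int.cast_natCast]

theorem psi_of_unit {u : GaussianInt} (h : u.norm = 1) : psi u = 1 := by
  have h1 : ∀ v ∈ ofNorm 1, psi v = 1 := by decide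
  exact h1 u (mem_ofNorm.2 (by simpa using h))

theorem natAbs_norm_coprime {α β : GaussianInt} {m n : ℕ} (hα : α.norm = m) (hβ : β.norm = n)
    (h : m.Coprime n) : IsCoprime α β := by
  have h1 : IsCoprime ((m : ℤ) : GaussianInt) ((n : ℤ) : GaussianInt) :=
    (Nat.isCoprime_iff_coprime.2 h).intCast
  refine (h1.of_isCoprime_of_dvd_left ?_).of_isCoprime_of_dvd_right ?_
  · exact ⟨star α, by rw [star_mul_self_eq hα, Int.cast_natCast]⟩
  · exact ⟨star β, by rw [star_mul_self_eq hβ, Int.cast_natCast]⟩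

theorem ne_zero_of_norm {α : GaussianInt} {m : ℕ} (hm : m ≠ 0) (h : α.norm = m) : α ≠ 0 := by
  rintro rfl
  rw [Zsqrtd.norm_zero] at h
  exact hm (by exact_mod_cast h.symm)

theorem exists_mul_of_norm {m n : ℕ} (hm : m ≠ 0) (h : m.Coprime n)
    {γ : GaussianInt} (hγ : γ.norm = (m * n : ℕ)) :
    ∃ α β : GaussianInt, α.norm = m ∧ β.norm = n ∧ α * β = γ := by
  have hdvd : γ ∣ (m : GaussianInt) * (n : GaussianInt) :=
    ⟨star γ, by rw [star_mul_self_eq hγ]; push_cast; rfl⟩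
  obtain ⟨α, β, hα, hβ, rfl⟩ := exists_dvd_and_dvd_of_dvd_mul hdvd
  have key : ∀ {δ : GaussianInt} {k : ℕ}, δ ∣ (k : GaussianInt) → δ.norm.natAbs ∣ k ^ 2 := by
    rintro δ k ⟨ε, hε⟩
    have h1 := congrArg (fun z : GaussianInt => (Zsqrtd.norm z).natAbs) hε
    simp only [Zsqrtd.norm_mul, Int.natAbs_mul] at h1
    refine ⟨ε.norm.natAbs, ?_⟩
    rw [← h1, norm_eq]
    simp [sq, Int.natAbs_mul]
  have h1 := key hα
  have h2 := key hβ
  rw [Zsqrtd.norm_mul] at hγ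
  have hA : ((α.norm.natAbs : ℕ) : ℤ) = α.norm := Int.natAbs_of_nonneg (GaussianInt.norm_nonneg α)
  have hB : ((β.norm.natAbs : ℕ) : ℤ) = β.norm := Int.natAbs_of_nonneg (GaussianInt.norm_nonneg β)
  generalize α.norm.natAbs = A at h1 hA
  generalize β.norm.natAbs = B at h2 hB
  rw [← hA, ← hB] at hγ
  have hAB : A * B = m * n := by exact_mod_cast hγ
  have hAn : A.Coprime n := (h.pow_left 2).coprime_dvd_left h1
  have hBm : B.Coprime m := (h.symm.pow_left 2).coprime_dvd_left h2
  have d1 : A ∣ m := hAn.dvd_of_dvd_mul_right ⟨B, hAB.symm⟩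
  have d2 : m ∣ A := hBm.symm.dvd_of_dvd_mul_right ⟨n, hAB⟩
  have e1 : A = m := Nat.dvd_antisymm d1 d2
  subst e1
  have e2 : B = n := Nat.eq_of_mul_eq_mul_left (Nat.pos_of_ne_zero hm) hAB
  exact ⟨α, β, hA.symm, by rw [← hB, e2], rfl⟩

theorem heckeSum_mul {m n : ℕ} (hm : m ≠ 0) (h : m.Coprime n) :
    heckeSum m * heckeSum n = 4 * heckeSum (m * n) := by
  have hmaps : ∀ z ∈ ofNorm m ×ˢ ofNorm n, z.1 * z.2 ∈ ofNorm (m * n) := by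
    intro z hz
    rw [mem_product, mem_ofNorm, mem_ofNorm] at hz
    rw [mem_ofNorm, Zsqrtd.norm_mul, hz.1, hz.2]
    push_cast; rfl
  rw [heckeSum, heckeSum, sum_mul_sum, ← sum_product', ← sum_fiberwise_of_maps_to hmaps, heckeSum,
    mul_sum]
  refine sum_congr rfl fun γ hγ => ?_
  have hconst : ∀ z ∈ (ofNorm m ×ˢ ofNorm n).filter (fun z => z.1 * z.2 = γ),
      psi z.1 * psi z.2 = psi γ := by
    intro z hz
    rw [← psi_mul, (mem_filter.1 hz).2]
  rw [sum_congr rfl hconst, sum_const, nsmul_eq_mul]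
  congr 1
  obtain ⟨α, β, hα, hβ, hαβ⟩ := exists_mul_of_norm hm h (mem_ofNorm.1 hγ)
  have hα0 := ne_zero_of_norm hm hα
  have hcard : (ofNorm 1).card = ((ofNorm m ×ˢ ofNorm n).filter (fun z => z.1 * z.2 = γ)).card := by
    refine card_nbij (fun u => (α * u, β * star u)) ?_ ?_ ?_
    · intro u hu
      have hu := mem_ofNorm.1 (mem_coe.1 hu)
      have hu1 := star_mul_self_eq hu
      refine mem_coe.2 (mem_filter.2 ⟨mem_product.2 ⟨?_, ?_⟩, ?_⟩)
      · rw [mem_ofNorm, Zsqrtd.norm_mul, hα, hu]; simp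
      · rw [mem_ofNorm, Zsqrtd.norm_mul, Zsqrtd.norm_conj, hβ, hu]; simp
      · rw [mul_mul_mul_comm, hαβ, hu1]; simp
    · intro u _ v _ huv
      exact mul_left_cancel₀ hα0 (congrArg Prod.fst huv)
    · rintro ⟨x, y⟩ hz
      obtain ⟨hz, hxy⟩ := mem_filter.1 (mem_coe.1 hz)
      obtain ⟨hx, hy⟩ := mem_product.1 hz
      rw [mem_ofNorm] at hx hy
      dsimp only at hx hy hxy
      have hdvd : α ∣ x := by
        refine (natAbs_norm_coprime hα hy h).dvd_of_dvd_mul_right (z := y) (y := x) ?_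
        exact ⟨β, by rw [hxy, hαβ]⟩
      obtain ⟨u, rfl⟩ := hdvd
      have hu : u.norm = (1 : ℕ) := by
        rw [Zsqrtd.norm_mul, hα] at hx
        have hm' : (m : ℤ) ≠ 0 := by exact_mod_cast hm
        have : (m : ℤ) * u.norm = m * 1 := by rw [hx, mul_one]
        rw [mul_left_cancel₀ hm' this]; rfl
      refine ⟨u, mem_coe.2 (mem_ofNorm.2 hu), ?_⟩
      have hu1 := star_mul_self_eq hu
      have h3 : u * y = β := by
        refine mul_left_cancel₀ hα0 ?_
        rw [hαβ, ← hxy]; ring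
      refine Prod.ext rfl ?_
      dsimp only
      rw [← h3, mul_right_comm, hu1]; simp
  rw [← hcard]
  decide

end Gaussian

section PrimePowers

theorem sum_image_mul {π : GaussianInt} (hπ : π ≠ 0) (m : ℕ) :
    ∑ γ ∈ (ofNorm m).image (π * ·), psi γ = psi π * heckeSum m := by
  rw [sum_image fun a _ b _ h => mul_left_cancel₀ hπ h, heckeSum, mul_sum]
  exact sum_congr rfl fun α _ => psi_mul π α

theorem mem_image_mul {π γ : GaussianInt} {p m : ℕ} (hp : p ≠ 0) (hπ : π.norm = p) :
    γ ∈ (ofNorm m).image (π * ·) ↔ π ∣ γ ∧ γ.norm = (p * m : ℕ) := by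
  rw [mem_image]
  constructor
  · rintro ⟨δ, hδ, rfl⟩
    rw [mem_ofNorm] at hδ
    exact ⟨dvd_mul_right _ _, by rw [Zsqrtd.norm_mul, hπ, hδ]; push_cast; rfl⟩
  · rintro ⟨⟨δ, rfl⟩, h⟩
    refine ⟨δ, mem_ofNorm.2 ?_, rfl⟩
    rw [Zsqrtd.norm_mul, hπ, Nat.cast_mul] at h
    exact mul_left_cancel₀ (by exact_mod_cast hp) h

theorem heckeSum_of_psi_eq_zero {m : ℕ} (h : ∀ α : GaussianInt, α.norm = m → psi α = 0) :
    heckeSum m = 0 :=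
  sum_eq_zero fun α hα => h α (mem_ofNorm.1 hα)

theorem prime_of_norm {p : ℕ} (hp : p.Prime) {π : GaussianInt} (hπ : π.norm = p) : Prime π := by
  refine Irreducible.prime ⟨fun hu => ?_, fun {a b} hab => ?_⟩
  · rw [← Zsqrtd.norm_eq_one_iff, hπ, Int.natAbs_natCast] at hu
    exact hp.one_lt.ne' hu
  · have h1 : a.norm.natAbs * b.norm.natAbs = p := by
      rw [← Int.natAbs_mul, ← Zsqrtd.norm_mul, ← hab, hπ, Int.natAbs_natCast]
    rw [← Zsqrtd.norm_eq_one_iff, ← Zsqrtd.norm_eq_one_iff]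
    have h2 := (Nat.prime_mul_iff.1 (h1.symm ▸ hp))
    tauto

/-- A Gaussian integer of odd prime norm does not divide its conjugate. -/
theorem not_dvd_star {p : ℕ} (hp : p.Prime) (h2 : p ≠ 2) {π : GaussianInt} (hπ : π.norm = p) :
    ¬ star π ∣ π := by
  intro hdvd
  have hsum : π + star π = ((2 * π.re : ℤ) : GaussianInt) := by
    ext
    · simp only [Zsqrtd.re_add, Zsqrtd.re_star, Zsqrtd.re_intCast]; ring
    · simp only [Zsqrtd.im_add, Zsqrtd.im_star, Zsqrtd.im_intCast]; ring
  have h1 : star π ∣ ((2 * π.re : ℤ) : GaussianInt) := hsum ▸ dvd_add hdvd dvd_rfl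
  have h3 : star π ∣ ((p : ℤ) : GaussianInt) :=
    ⟨π, by rw [mul_comm, star_mul_self_eq hπ, Int.cast_natCast]⟩
  have hpz : Prime (p : ℤ) := Nat.prime_iff_prime_int.1 hp
  have hcop : IsCoprime (2 * π.re : ℤ) (p : ℤ) := by
    refine ((hpz.irreducible.coprime_iff_not_dvd).2 fun hd => ?_).symm
    have hre : (p : ℤ) ∣ π.re := by
      refine (hpz.dvd_or_dvd hd).resolve_left fun h => h2 ?_
      exact (Nat.prime_dvd_prime_iff_eq hp Nat.prime_two).1 (by exact_mod_cast h)
    have him : (p : ℤ) ∣ π.im := by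
      rw [norm_eq] at hπ
      have : (p : ℤ) ∣ π.im * π.im :=
        (Int.dvd_add_right (Dvd.dvd.mul_right hre _)).1 ⟨1, by rw [hπ, mul_one]⟩
      exact (hpz.dvd_or_dvd this).elim id id
    obtain ⟨a, ha⟩ := hre
    obtain ⟨b, hb⟩ := him
    rw [norm_eq, ha, hb] at hπ
    have hp0 : (p : ℤ) ≠ 0 := by exact_mod_cast hp.ne_zero
    have h4 : (p : ℤ) * (a * a + b * b) = 1 := by
      refine mul_left_cancel₀ hp0 ?_
      linarith
    have h5 : (p : ℤ) ∣ 1 := ⟨_, h4.symm⟩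
    exact hpz.not_isUnit (isUnit_of_dvd_one h5)
  have hunit : IsUnit (star π) := (hcop.intCast (R := GaussianInt)).isUnit_of_dvd' h1 h3
  rw [← Zsqrtd.norm_eq_one_iff, Zsqrtd.norm_conj, hπ, Int.natAbs_natCast] at hunit
  exact hp.one_lt.ne' hunit

section Split

variable {p : ℕ} {π : GaussianInt}

theorem ofNorm_prime_pow_succ (hp : p.Prime) (hπ : π.norm = p) (k : ℕ) :
    ofNorm (p ^ (k + 1)) =
      (ofNorm (p ^ k)).image (π * ·) ∪ (ofNorm (p ^ k)).image (star π * ·) := by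
  have hπ' : (star π).norm = p := by rw [Zsqrtd.norm_conj, hπ]
  ext γ
  rw [mem_union, mem_image_mul hp.ne_zero hπ, mem_image_mul hp.ne_zero hπ', mem_ofNorm, pow_succ',
    ← or_and_right, iff_and_self]
  intro h
  have hpr := prime_of_norm hp hπ
  have hd : π ∣ γ * star γ := by
    rw [star_mul_self_eq h, Nat.cast_mul, ← star_mul_self_eq hπ, mul_assoc]
    exact dvd_mul_right _ _
  refine (hpr.dvd_or_dvd hd).imp id fun ⟨δ, hδ⟩ => ⟨star δ, ?_⟩
  rw [← star_star γ, hδ, star_mul']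

theorem ofNorm_inter (hp : p.Prime) (h2 : p ≠ 2) (hπ : π.norm = p) (k : ℕ) {γ : GaussianInt} :
    γ ∈ (ofNorm (p ^ k)).image (π * ·) ∩ (ofNorm (p ^ k)).image (star π * ·) ↔
      (p : GaussianInt) ∣ γ ∧ γ.norm = (p ^ (k + 1) : ℕ) := by
  have hπ' : (star π).norm = p := by rw [Zsqrtd.norm_conj, hπ]
  rw [mem_inter, mem_image_mul hp.ne_zero hπ, mem_image_mul hp.ne_zero hπ', ← pow_succ']
  constructor
  · rintro ⟨⟨⟨δ, rfl⟩, h⟩, h3, -⟩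
    refine ⟨?_, h⟩
    rw [← star_mul_self_eq hπ]
    exact mul_dvd_mul_left _ (((prime_of_norm hp hπ').dvd_or_dvd h3).resolve_left
      (not_dvd_star hp h2 hπ))
  · rintro ⟨hd, h⟩
    rw [← star_mul_self_eq hπ] at hd
    exact ⟨⟨(dvd_mul_right _ _).trans hd, h⟩, (dvd_mul_left _ _).trans hd, h⟩

theorem norm_natCast_eq (p : ℕ) : Zsqrtd.norm (p : GaussianInt) = (p * p : ℕ) := by
  rw [Zsqrtd.norm_natCast]; push_cast; rfl

theorem heckeSum_prime (hp : p.Prime) (h2 : p ≠ 2) (hπ : π.norm = p) :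
    heckeSum p = (psi π + psi (star π)) * 4 := by
  have hπ' : (star π).norm = p := by rw [Zsqrtd.norm_conj, hπ]
  have h1 := ofNorm_prime_pow_succ hp hπ 0
  have h3 := sum_union_inter (s₁ := (ofNorm (p ^ 0)).image (π * ·))
    (s₂ := (ofNorm (p ^ 0)).image (star π * ·)) (f := psi)
  rw [← h1, sum_image_mul (ne_zero_of_norm hp.ne_zero hπ),
    sum_image_mul (ne_zero_of_norm hp.ne_zero hπ')] at h3
  have h4 : (ofNorm (p ^ 0)).image (π * ·) ∩ (ofNorm (p ^ 0)).image (star π * ·) = ∅ := by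
    refine eq_empty_of_forall_notMem fun γ hγ => ?_
    obtain ⟨⟨δ, rfl⟩, h⟩ := (ofNorm_inter hp h2 hπ 0).1 hγ
    rw [Zsqrtd.norm_mul, norm_natCast_eq, zero_add, pow_one] at h
    have hp0 : (p : ℤ) ≠ 0 := by exact_mod_cast hp.ne_zero
    have h5 : (p : ℤ) * δ.norm = 1 := by
      refine mul_left_cancel₀ hp0 ?_
      push_cast at h
      linarith
    exact (Nat.prime_iff_prime_int.1 hp).not_isUnit (isUnit_of_dvd_one ⟨_, h5.symm⟩)
  rw [h4, sum_empty, add_zero, zero_add, pow_one, pow_zero, heckeSum_one] at h3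
  rw [heckeSum, h3]
  ring

theorem heckeSum_prime_pow_add_two (hp : p.Prime) (h2 : p ≠ 2) (hπ : π.norm = p) (k : ℕ) :
    heckeSum (p ^ (k + 2)) =
      (psi π + psi (star π)) * heckeSum (p ^ (k + 1)) -
        psi π * psi (star π) * heckeSum (p ^ k) := by
  have hπ' : (star π).norm = p := by rw [Zsqrtd.norm_conj, hπ]
  have h1 := ofNorm_prime_pow_succ hp hπ (k + 1)
  have h3 := sum_union_inter (s₁ := (ofNorm (p ^ (k + 1))).image (π * ·))
    (s₂ := (ofNorm (p ^ (k + 1))).image (star π * ·)) (f := psi)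
  have h4 : (ofNorm (p ^ (k + 1))).image (π * ·) ∩ (ofNorm (p ^ (k + 1))).image (star π * ·) =
      (ofNorm (p ^ k)).image ((p : GaussianInt) * ·) := by
    ext γ
    rw [ofNorm_inter hp h2 hπ, mem_image_mul (mul_ne_zero hp.ne_zero hp.ne_zero)
      (norm_natCast_eq p), ← sq, ← pow_add, add_comm 2 k]
  rw [← h1, h4, sum_image_mul (ne_zero_of_norm hp.ne_zero hπ),
    sum_image_mul (ne_zero_of_norm hp.ne_zero hπ'), sum_image_mul (by exact_mod_cast hp.ne_zero),
    ← star_mul_self_eq hπ, psi_mul] at h3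
  rw [heckeSum]
  linear_combination h3

end Split

theorem exists_norm_eq {p : ℕ} (hp : p.Prime) (h : p % 4 ≠ 3) :
    ∃ π : GaussianInt, π.norm = p := by
  have : Fact p.Prime := ⟨hp⟩
  obtain ⟨a, b, hab⟩ := Nat.Prime.sq_add_sq h
  refine ⟨⟨a, b⟩, ?_⟩
  rw [norm_eq, ← hab]
  push_cast; ring

theorem heckeSum_prime_pow_of_one_mod {p : ℕ} (hp : p.Prime) (h : p % 12 = 1) (k : ℕ) :
    heckeSum (p ^ k) ^ 2 = 16 * ((k : GaussianInt) + 1) ^ 2 := by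
  obtain ⟨π, hπ⟩ := exists_norm_eq hp (by omega)
  obtain ⟨h1, h2⟩ := psi_star_of_one_mod (α := π) (by omega)
  have hp2 : p ≠ 2 := by omega
  have key : ∀ k : ℕ, heckeSum (p ^ k) = 4 * ((k : GaussianInt) + 1) * psi π ^ k ∧
      heckeSum (p ^ (k + 1)) = 4 * ((k : GaussianInt) + 2) * psi π ^ (k + 1) := by
    intro k
    induction k with
    | zero =>
      rw [pow_zero, heckeSum_one, zero_add, pow_one, heckeSum_prime hp hp2 hπ, h1]
      constructor <;> push_cast <;> ring
    | succ k ih =>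
      refine ⟨by rw [ih.2]; push_cast; ring, ?_⟩
      rw [show k + 1 + 1 = k + 2 by rfl, heckeSum_prime_pow_add_two hp hp2 hπ, ih.1, ih.2, h1]
      push_cast
      ring
  rw [(key k).1, mul_pow, ← pow_mul, mul_comm k 2, pow_mul, h2, one_pow]
  ring

theorem heckeSum_prime_pow_of_five_mod {p : ℕ} (hp : p.Prime) (h : p % 12 = 5) (k : ℕ) :
    heckeSum (p ^ k) ^ 2 = if Even k then 16 else 0 := by
  obtain ⟨π, hπ⟩ := exists_norm_eq hp (by omega)
  obtain ⟨h1, h2⟩ := psi_star_of_five_mod (α := π) (by omega)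
  have hp2 : p ≠ 2 := by omega
  have hrec : ∀ k, heckeSum (p ^ (k + 2)) = -heckeSum (p ^ k) := by
    intro k
    rw [heckeSum_prime_pow_add_two hp hp2 hπ, h1]
    linear_combination heckeSum (p ^ k) * h2
  induction k using Nat.twoStepInduction with
  | zero => rw [pow_zero, heckeSum_one, if_pos (by decide)]; norm_num
  | one =>
    rw [pow_one, heckeSum_prime hp hp2 hπ, h1, if_neg (by decide)]
    ring
  | more k ih _ => rw [hrec, neg_sq, ih]; simp [Nat.even_add]

theorem psi_natCast {p : ℕ} (h : p % 12 = 7 ∨ p % 12 = 11) : psi (p : GaussianInt) = 1 := by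
  have h2 : ((p : ℤ) : ZMod 2) = 1 := by
    exact_mod_cast (ZMod.natCast_eq_natCast_iff' p 1 2).2 (by omega)
  have h3 : ∀ a : ZMod 3, a ≠ 0 → psiThree a 0 = 1 := by decide
  have h4 : ((p : ℤ) : ZMod 3) ≠ 0 := by
    rw [Int.cast_natCast, Ne, ZMod.natCast_eq_zero_iff]
    omega
  rw [psi, Zsqrtd.re_natCast, Zsqrtd.im_natCast, h2, Int.cast_zero, Int.cast_zero, h3 _ h4]
  decide

theorem heckeSum_prime_pow_of_inert {p : ℕ} (hp : p.Prime) (h : p % 12 = 7 ∨ p % 12 = 11) (k : ℕ) :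
    heckeSum (p ^ k) ^ 2 = if Even k then 16 else 0 := by
  have : Fact p.Prime := ⟨hp⟩
  have hpr : Prime (p : GaussianInt) :=
    GaussianInt.prime_of_nat_prime_of_mod_four_eq_three p (by omega)
  have hdvd : ∀ {γ : GaussianInt} {m : ℕ}, γ.norm = (p * m : ℕ) → (p : GaussianInt) ∣ γ := by
    intro γ m hγ
    have hd : (p : GaussianInt) ∣ γ * star γ := by
      rw [star_mul_self_eq hγ, Nat.cast_mul]
      exact dvd_mul_right _ _
    refine (hpr.dvd_or_dvd hd).elim id fun ⟨δ, hδ⟩ => ⟨star δ, ?_⟩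
    rw [← star_star γ, hδ, star_mul', star_natCast]
  have hrec : ∀ k, heckeSum (p ^ (k + 2)) = heckeSum (p ^ k) := by
    intro k
    have h1 := sum_image_mul (π := (p : GaussianInt)) (by exact_mod_cast hp.ne_zero) (p ^ k)
    rw [psi_natCast h, one_mul] at h1
    rw [← h1, heckeSum]
    congr 1
    ext γ
    rw [mem_ofNorm, mem_image_mul (mul_ne_zero hp.ne_zero hp.ne_zero) (norm_natCast_eq p), ← sq,
      ← pow_add, add_comm 2 k, iff_and_self]
    intro hγ
    exact hdvd (m := p ^ (k + 1)) (by rw [hγ]; ring_nf)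
  induction k using Nat.twoStepInduction with
  | zero => rw [pow_zero, heckeSum_one, if_pos (by decide)]; norm_num
  | one =>
    rw [pow_one, if_neg (by decide), heckeSum_of_psi_eq_zero, zero_pow two_ne_zero]
    intro α hα
    obtain ⟨δ, rfl⟩ := hdvd (m := 1) (by rw [hα, mul_one])
    rw [Zsqrtd.norm_mul, norm_natCast_eq] at hα
    have hp0 : (p : ℤ) ≠ 0 := by exact_mod_cast hp.ne_zero
    have h5 : (p : ℤ) * δ.norm = 1 := by
      refine mul_left_cancel₀ hp0 ?_
      push_cast at hα
      linarith
    exact absurd (isUnit_of_dvd_one ⟨_, h5.symm⟩) (Nat.prime_iff_prime_int.1 hp).not_isUnit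
  | more k ih _ => rw [hrec, ih]; simp [Nat.even_add]

theorem prime_mod_twelve {p : ℕ} (hp : p.Prime) :
    (p = 2 ∨ p = 3) ∨ p % 12 = 1 ∨ p % 12 = 5 ∨ p % 12 = 7 ∨ p % 12 = 11 := by
  rcases charFun_cases p with h | h | h | h | h
  · exact Or.inl (eq_two_or_three hp h.2.2.2.2)
  all_goals right; omega

theorem heckeSum_prime_pow {p : ℕ} (hp : p.Prime) {k : ℕ} (hk : k ≠ 0) :
    heckeSum (p ^ k) ^ 2 = 16 * (etaFun (p ^ k) : GaussianInt) := by
  have hcast : ((if Even k then 1 else 0 : ℤ) : GaussianInt) = if Even k then 1 else 0 := by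
    split_ifs <;> simp
  rcases prime_mod_twelve hp with h | h | h | h
  · rw [etaFun_prime_pow_of_dvd hp h hk, heckeSum_of_psi_eq_zero]
    · simp
    · intro α hα
      have hd : (p : ℤ) ∣ α.norm := by
        rw [hα, Nat.cast_pow]
        exact dvd_pow_self _ hk
      rcases h with rfl | rfl
      · exact psi_of_two_dvd hd
      · exact psi_of_three_dvd hd
  · rw [heckeSum_prime_pow_of_one_mod hp h, etaFun_prime_pow_of_eq_one hp h]
    push_cast; rfl
  · rw [heckeSum_prime_pow_of_five_mod hp h, etaFun_prime_pow_of_ne_one hp (Or.inl h), hcast]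
    split_ifs <;> simp
  · rw [heckeSum_prime_pow_of_inert hp h, etaFun_prime_pow_of_ne_one hp (Or.inr h), hcast]
    split_ifs <;> simp

theorem heckeSum_sq {m : ℕ} (hm : m ≠ 0) :
    heckeSum m ^ 2 = 16 * (etaFun m : GaussianInt) := by
  induction m using Nat.recOnPosPrimePosCoprime with
  | prime_pow p k hp hk => exact heckeSum_prime_pow hp hk.ne'
  | zero => exact absurd rfl hm
  | one => rw [heckeSum_one, isMultiplicative_etaFun.map_one]; norm_num
  | coprime a b ha hb hab iha ihb =>
    have h1 := heckeSum_mul (by omega) hab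
    have h2 := iha (by omega)
    have h3 := ihb (by omega)
    rw [isMultiplicative_etaFun.map_mul_of_coprime hab]
    have h16 : (16 : GaussianInt) ≠ 0 := by decide
    refine mul_left_cancel₀ h16 ?_
    have h4 := congrArg (· ^ 2) h1
    simp only [mul_pow] at h4
    rw [h2, h3] at h4
    push_cast
    linear_combination -h4

theorem mod_twelve_of_etaFun_ne_zero {m : ℕ} (h : etaFun m ≠ 0) : m % 12 = 1 := by
  induction m using Nat.recOnPosPrimePosCoprime with
  | prime_pow p k hp hk =>
    rcases prime_mod_twelve hp with hp' | hp' | hp'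
    · exact absurd (etaFun_prime_pow_of_dvd hp hp' hk.ne') h
    · rw [Nat.pow_mod, hp', one_pow]; rfl
    · rw [etaFun_prime_pow_of_ne_one hp hp'] at h
      have hk : Even k := by
        by_contra hk
        simp [hk] at h
      obtain ⟨i, rfl⟩ := hk
      rw [← two_mul, pow_mul, Nat.pow_mod, Nat.pow_mod p 2]
      rcases hp' with h' | h' | h' <;> rw [h'] <;> norm_num
  | zero => simp at h
  | one => rfl
  | coprime a b ha hb hab iha ihb =>
    rw [isMultiplicative_etaFun.map_mul_of_coprime hab] at h
    rw [Nat.mul_mod, iha (left_ne_zero_of_mul h), ihb (right_ne_zero_of_mul h)]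

end PrimePowers

section Assembly

open PowerSeries

theorem ofNorm_one : ofNorm 1 = {1, -1, ⟨0, 1⟩, ⟨0, -1⟩} := by decide

/-- The Gaussian integers of norm `m` congruent to `2` modulo `3`. -/
noncomputable def primaryOfNorm (m : ℕ) : Finset GaussianInt :=
  (ofNorm m).filter fun α => α.re % 3 = 2 ∧ α.im % 3 = 0

theorem mem_primaryOfNorm {m : ℕ} {α : GaussianInt} :
    α ∈ primaryOfNorm m ↔ α.norm = m ∧ α.re % 3 = 2 ∧ α.im % 3 = 0 := by
  rw [primaryOfNorm, mem_filter, mem_ofNorm]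

theorem exists_unit_mul_primary {m : ℕ} (hm : m % 3 = 1) {γ : GaussianInt} (hγ : γ ∈ ofNorm m) :
    ∃ u ∈ ofNorm 1, ∃ α ∈ primaryOfNorm m, u * α = γ := by
  obtain ⟨a, b⟩ := γ
  rw [mem_ofNorm, norm_eq] at hγ
  dsimp only at hγ
  rw [ofNorm_one]
  have h3 : (a * a + b * b) % 3 = 1 := by omega
  rw [Int.add_emod, Int.mul_emod a, Int.mul_emod b] at h3
  have ha : a % 3 = 0 ∨ a % 3 = 1 ∨ a % 3 = 2 := by omega
  have hb : b % 3 = 0 ∨ b % 3 = 1 ∨ b % 3 = 2 := by omega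
  rcases ha with ha | ha | ha <;> rcases hb with hb | hb | hb <;> rw [ha, hb] at h3 <;>
    norm_num at h3
  · refine ⟨⟨0, -1⟩, by simp, ⟨-b, a⟩, mem_primaryOfNorm.2 ⟨?_, ?_, ha⟩, ?_⟩
    · rw [norm_eq]; dsimp only; linarith
    · dsimp only; omega
    · rw [Zsqrtd.ext_iff, Zsqrtd.re_mul, Zsqrtd.im_mul]; dsimp only; constructor <;> ring
  · refine ⟨⟨0, 1⟩, by simp, ⟨b, -a⟩, mem_primaryOfNorm.2 ⟨?_, hb, ?_⟩, ?_⟩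
    · rw [norm_eq]; dsimp only; linarith
    · dsimp only; omega
    · rw [Zsqrtd.ext_iff, Zsqrtd.re_mul, Zsqrtd.im_mul]; dsimp only; constructor <;> ring
  · refine ⟨-1, by simp, ⟨-a, -b⟩, mem_primaryOfNorm.2 ⟨?_, ?_, ?_⟩, ?_⟩
    · rw [norm_eq]; dsimp only; linarith
    · dsimp only; omega
    · dsimp only; omega
    · rw [Zsqrtd.ext_iff]; simp
  · refine ⟨1, by simp, ⟨a, b⟩, mem_primaryOfNorm.2 ⟨?_, ha, hb⟩, one_mul _⟩
    rw [norm_eq]; exact hγ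

theorem unit_mul_primary_inj {m : ℕ} {u v α β : GaussianInt} (hu : u ∈ ofNorm 1)
    (hv : v ∈ ofNorm 1) (hα : α ∈ primaryOfNorm m) (hβ : β ∈ primaryOfNorm m)
    (h : u * α = v * β) : u = v ∧ α = β := by
  rw [mem_primaryOfNorm] at hα hβ
  obtain ⟨a, b⟩ := α
  obtain ⟨c, d⟩ := β
  obtain ⟨-, ha, hb⟩ := hα
  obtain ⟨-, hc, hd⟩ := hβ
  rw [ofNorm_one] at hu hv
  simp only [mem_insert, mem_singleton] at hu hv
  rw [Zsqrtd.ext_iff] at h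
  dsimp only at ha hb hc hd
  rcases hu with rfl | rfl | rfl | rfl <;> rcases hv with rfl | rfl | rfl | rfl <;>
    simp at h <;>
    first
    | exfalso; omega
    | refine ⟨rfl, ?_⟩; rw [Zsqrtd.ext_iff]; dsimp only; omega

theorem heckeSum_eq_four_mul {m : ℕ} (hm : m % 3 = 1) :
    heckeSum m = 4 * ∑ α ∈ primaryOfNorm m, psi α := by
  have hcard : (ofNorm 1).card = 4 := by rw [ofNorm_one]; decide
  have h : ∑ z ∈ ofNorm 1 ×ˢ primaryOfNorm m, psi z.2 = heckeSum m := by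
    refine sum_nbij (fun z => z.1 * z.2) ?_ ?_ ?_ ?_
    · rintro ⟨u, α⟩ hz
      rw [mem_product, mem_ofNorm, mem_primaryOfNorm] at hz
      rw [mem_ofNorm, Zsqrtd.norm_mul, hz.1, hz.2.1]
      simp
    · rintro ⟨u, α⟩ hz ⟨v, β⟩ hw h
      rw [mem_coe, mem_product] at hz hw
      obtain ⟨h1, h2⟩ := unit_mul_primary_inj hz.1 hw.1 hz.2 hw.2 h
      exact Prod.ext h1 h2
    · intro γ hγ
      obtain ⟨u, hu, α, hα, h⟩ := exists_unit_mul_primary hm (mem_coe.1 hγ)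
      exact ⟨(u, α), mem_coe.2 (mem_product.2 ⟨hu, hα⟩), h⟩
    · rintro ⟨u, α⟩ hz
      rw [mem_product, mem_ofNorm] at hz
      dsimp only
      rw [psi_mul, psi_of_unit (u := u) (by simpa using hz.1), one_mul]
  rw [← h, sum_product]
  dsimp only
  rw [sum_const, hcard, nsmul_eq_mul]
  rfl

/-- The Gaussian integer attached to a pair of indices of pentagonal numbers. -/
def pentagonalPair (z : ℤ × ℤ) : GaussianInt := ⟨3 * (z.1 + z.2) - 1, 3 * (z.1 - z.2)⟩

theorem norm_pentagonalPair (z : ℤ × ℤ) :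
    (pentagonalPair z).norm = 12 * (pentagonal z.1 + pentagonal z.2 : ℕ) + 1 := by
  have h1 := two_mul_natCast_pentagonal z.1
  have h2 := two_mul_natCast_pentagonal z.2
  rw [norm_eq, pentagonalPair]
  push_cast
  linear_combination (-6) * h1 - 6 * h2

theorem psi_pentagonalPair (z : ℤ × ℤ) :
    psi (pentagonalPair z) = ((z.1 + z.2).negOnePow : ℤ) := by
  obtain ⟨j, k⟩ := z
  have h3 : psiThree ((3 * (j + k) - 1 : ℤ) : ZMod 3) ((3 * (j - k) : ℤ) : ZMod 3) = 1 := by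
    have h30 : (3 : ZMod 3) = 0 := by decide
    push_cast
    rw [h30]
    simp only [zero_mul]
    decide
  rw [psi, pentagonalPair, h3, mul_one]
  rcases Int.even_or_odd (j + k) with h | h
  · have h1 : ((3 * (j + k) - 1 : ℤ) : ZMod 2) = 1 := by
      have := (ZMod.intCast_eq_intCast_iff_dvd_sub 1 (3 * (j + k) - 1) 2).2 (by grind)
      rw [← this, Int.cast_one]
    have h2 : ((3 * (j - k) : ℤ) : ZMod 2) = 0 :=
      (ZMod.intCast_zmod_eq_zero_iff_dvd _ 2).2 (by grind)
    dsimp only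
    rw [h1, h2, Int.negOnePow_even _ h]
    decide
  · have h1 : ((3 * (j + k) - 1 : ℤ) : ZMod 2) = 0 :=
      (ZMod.intCast_zmod_eq_zero_iff_dvd _ 2).2 (by grind)
    have h2 : ((3 * (j - k) : ℤ) : ZMod 2) = 1 := by
      have := (ZMod.intCast_eq_intCast_iff_dvd_sub 1 (3 * (j - k)) 2).2 (by grind)
      rw [← this, Int.cast_one]
    dsimp only
    rw [h1, h2, Int.negOnePow_odd _ h]
    decide

theorem prodMap_pentagonal_injective : Function.Injective (Prod.map pentagonal pentagonal) :=
  pentagonal_injective.prodMap pentagonal_injective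

/-- The pairs of indices whose pentagonal numbers add up to `n`. -/
noncomputable def pentagonalPairs (n : ℕ) : Finset (ℤ × ℤ) :=
  (antidiagonal n).preimage (Prod.map pentagonal pentagonal) prodMap_pentagonal_injective.injOn

theorem mem_pentagonalPairs {n : ℕ} {z : ℤ × ℤ} :
    z ∈ pentagonalPairs n ↔ pentagonal z.1 + pentagonal z.2 = n := by
  rw [pentagonalPairs, mem_preimage, HasAntidiagonal.mem_antidiagonal]
  rfl

theorem sum_psi_primaryOfNorm (n : ℕ) :
    ∑ α ∈ primaryOfNorm (12 * n + 1), psi α =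
      ((∑ z ∈ pentagonalPairs n, ((z.1 + z.2).negOnePow : ℤ) : ℤ) : GaussianInt) := by
  rw [Int.cast_sum]
  refine (sum_nbij pentagonalPair ?_ ?_ ?_ ?_).symm
  · intro z hz
    rw [mem_pentagonalPairs] at hz
    rw [mem_primaryOfNorm, norm_pentagonalPair, hz]
    refine ⟨by push_cast; rfl, ?_, ?_⟩ <;> rw [pentagonalPair] <;> dsimp only <;> omega
  · rintro ⟨j, k⟩ - ⟨j', k'⟩ - h
    rw [pentagonalPair, pentagonalPair, Zsqrtd.ext_iff] at h
    dsimp only at h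
    rw [Prod.ext_iff]
    dsimp only
    omega
  · rintro ⟨a, b⟩ h
    rw [mem_coe, mem_primaryOfNorm] at h
    obtain ⟨hn, ha, hb⟩ := h
    dsimp only at ha hb
    have hn' := hn
    rw [norm_eq] at hn'
    dsimp only at hn'
    have hodd : Odd (a * a + b * b) := by rw [hn']; push_cast; exact ⟨6 * n, by ring⟩
    have hab : a % 2 ≠ b % 2 := by
      intro h
      rw [Int.odd_iff, Int.add_emod, Int.mul_emod, Int.mul_emod b, ← h] at hodd
      omega
    have hz : pentagonalPair (((a + 1) / 3 + b / 3) / 2, ((a + 1) / 3 - b / 3) / 2) = ⟨a, b⟩ := by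
      rw [pentagonalPair, Zsqrtd.ext_iff]
      dsimp only
      omega
    refine ⟨_, mem_coe.2 (mem_pentagonalPairs.2 ?_), hz⟩
    rw [← hz, norm_pentagonalPair] at hn
    push_cast at hn
    have := add_right_cancel hn
    have := mul_left_cancel₀ (by norm_num) this
    exact_mod_cast this
  · intro z _
    exact (psi_pentagonalPair z).symm

theorem coeff_pentagonalSeries_sq (n : ℕ) :
    coeff n (pentagonalSeries ℤ ^ 2) = ∑ z ∈ pentagonalPairs n, ((z.1 + z.2).negOnePow : ℤ) := by
  rw [sq, coeff_mul, pentagonalPairs,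
    ← sum_preimage _ (antidiagonal n) prodMap_pentagonal_injective.injOn]
  · refine sum_congr rfl fun z _ => ?_
    rw [Prod.map_fst, Prod.map_snd, coeff_pentagonalSeries_pentagonal,
      coeff_pentagonalSeries_pentagonal, Int.negOnePow_add]
    push_cast
    rfl
  · rintro ⟨i, j⟩ _ h
    by_contra h0
    obtain ⟨h1, h2⟩ := ne_zero_and_ne_zero_of_mul h0
    rw [ne_eq, coeff_pentagonalSeries_eq_zero_iff, not_not] at h1 h2
    obtain ⟨x, hx⟩ := h1
    obtain ⟨y, hy⟩ := h2
    exact h ⟨(x, y), Prod.ext hx hy⟩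

theorem exists_coeff_prod_eq (n : ℕ) : ∃ N, n ≤ N ∧
    ((∏ m ∈ Icc 1 N, ((1 : Polynomial ℤ) - Polynomial.X ^ m)) ^ 2).coeff n =
      coeff n (pentagonalSeries ℤ ^ 2) := by
  have h : ∀ᶠ s : Finset ℕ in atTop, ∀ i ∈ range (n + 1),
      coeff i (∏ m ∈ s, (1 - (X : PowerSeries ℤ) ^ (m + 1))) = coeff i (pentagonalSeries ℤ) :=
    (eventually_all_finset _).2 fun i _ => coeff_prod_one_sub_X_pow_eventually_eq ℤ i
  obtain ⟨N, hN, hn⟩ := ((tendsto_finset_range.eventually h).and (eventually_ge_atTop n)).exists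
  refine ⟨N, hn, ?_⟩
  have hcoe : ((∏ m ∈ Icc 1 N, ((1 : Polynomial ℤ) - Polynomial.X ^ m) : Polynomial ℤ) :
      PowerSeries ℤ) = ∏ m ∈ range N, (1 - (X : PowerSeries ℤ) ^ (m + 1)) := by
    rw [range_eq_Ico, prod_Ico_add' (fun m => 1 - (X : PowerSeries ℤ) ^ m) 0 N 1,
      ← Polynomial.coeToPowerSeries.ringHom_apply, map_prod]
    refine prod_congr (by ext; simp) fun m _ => ?_
    simp
  rw [← Polynomial.coeff_coe, Polynomial.coe_pow, hcoe, sq, sq, coeff_mul, coeff_mul]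
  refine sum_congr rfl fun z hz => ?_
  rw [HasAntidiagonal.mem_antidiagonal] at hz
  rw [hN z.1 (mem_range.2 (by omega)), hN z.2 (mem_range.2 (by omega))]

theorem coeff_pentagonalSeries_sq_sq (n : ℕ) :
    (coeff n (pentagonalSeries ℤ ^ 2)) ^ 2 = etaFun (12 * n + 1) := by
  have h1 := heckeSum_sq (m := 12 * n + 1) (by omega)
  rw [heckeSum_eq_four_mul (by omega), sum_psi_primaryOfNorm, ← coeff_pentagonalSeries_sq] at h1
  have h2 : ((16 * (coeff n (pentagonalSeries ℤ ^ 2)) ^ 2 : ℤ) : GaussianInt) =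
      ((16 * etaFun (12 * n + 1) : ℤ) : GaussianInt) := by
    push_cast
    rw [← h1]
    ring
  have h3 := congrArg Zsqrtd.re h2
  rw [Zsqrtd.re_intCast, Zsqrtd.re_intCast] at h3
  omega

theorem sum_etaFun (N : ℕ) :
    ∑ n ∈ range (N + 1), (etaFun (12 * n + 1) : ℝ) = ∑ m ∈ Ioc 0 (12 * N + 1), (etaFun m : ℝ) := by
  refine sum_of_injOn (fun n => 12 * n + 1) ?_ ?_ ?_ fun _ _ => rfl
  · intro x _ y _ h
    dsimp only at h
    omega
  · intro n hn
    rw [mem_coe, mem_range] at hn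
    rw [mem_coe, mem_Ioc]
    dsimp only
    omega
  · intro m hm h
    by_contra h0
    have h1 := mod_twelve_of_etaFun_ne_zero (m := m) (by exact_mod_cast h0)
    rw [mem_Ioc] at hm
    exact h ⟨m / 12, mem_coe.2 (mem_range.2 (by omega)), by dsimp only; omega⟩

theorem tendsto_sum_etaFun_div {L : ℝ} (hL : 0 < L)
    (h : Tendsto (fun n : ℕ => (∑ m ∈ Ioc 0 n, (etaFun m : ℝ)) / n) atTop (𝓝 (L / 3))) :
    Tendsto (fun N : ℕ => (∑ n ∈ range (N + 1), (etaFun (12 * n + 1) : ℝ)) / (4 * L * N))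
      atTop (𝓝 1) := by
  have hu : Tendsto (fun N : ℕ => 12 * N + 1) atTop atTop :=
    tendsto_atTop_mono (fun N => by rw [id]; omega) tendsto_id
  have h1 := h.comp hu
  have h2 : Tendsto (fun N : ℕ => ((12 : ℝ) + 1 / N) / (4 * L)) atTop (𝓝 ((12 + 0) / (4 * L))) :=
    (tendsto_const_nhds.add tendsto_one_div_atTop_nhds_zero_nat).div_const _
  have h3 := h1.mul h2
  have h4 : L / 3 * ((12 + 0) / (4 * L)) = 1 := by field_simp; norm_num
  rw [h4] at h3
  refine h3.congr' ?_
  filter_upwards [eventually_gt_atTop 0] with N hN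
  have hN' : (0 : ℝ) < N := by exact_mod_cast hN
  rw [sum_etaFun, Function.comp_apply]
  push_cast
  field_simp

end Assembly

end EtaSquare

/-- With `a n` the coefficient of `q^n` in `∏ (1 - q^m)^2`, there is `D > 0`
with `∑_{n ≤ N} a_n^2 ~ D N`, where `D = 4 L` and `L` is the limit of the
stated partial Euler products. -/
theorem stmt_5 (a : ℕ → ℤ)
    (ha : ∀ n N : ℕ, n ≤ N →
      a n = (((∏ m ∈ Finset.Icc 1 N, ((1 : Polynomial ℤ) - Polynomial.X ^ m)) ^ 2).coeff n)) :
    ∃ D L : ℝ, 0 < D ∧ 0 < L ∧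
      Tendsto
        (fun x : ℕ => ∏ p ∈ (Finset.range (x + 1)).filter Nat.Prime,
          (if p % 12 = 5 ∨ p % 12 = 7 ∨ p % 12 = 11 then (1 + (p : ℝ)⁻¹)⁻¹
          else if p % 12 = 1 then (1 + (p : ℝ)⁻¹) * ((1 - (p : ℝ)⁻¹)⁻¹) ^ 2
          else 1))
        atTop (nhds L) ∧
      D = 4 * L ∧
      Tendsto
        (fun N : ℕ => (∑ n ∈ Finset.range (N + 1), ((a n : ℝ)) ^ 2) / (D * N))
        atTop (nhds 1) := by
  obtain ⟨L, hL, h1, h2⟩ := EtaSquare.exists_limit_eulerFactor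
  refine ⟨4 * L, L, by positivity, hL, h1, rfl, ?_⟩
  have h : ∀ n, ((a n : ℝ)) ^ 2 = (EtaSquare.etaFun (12 * n + 1) : ℝ) := by
    intro n
    obtain ⟨N, hn, hN⟩ := EtaSquare.exists_coeff_prod_eq n
    rw [← EtaSquare.coeff_pentagonalSeries_sq_sq, ← hN, ← ha n N hn]
    push_cast
    rfl
  simp_rw [h]
  exact EtaSquare.tendsto_sum_etaFun_div hL h2
end

section
/- Let b_n be the coefficient of q^n in ∏_{m=1}^∞ (1 - q^m)(1 - q^{2m}). Let g : ℕ → ℤ be the multiplicative arithmetic function determined on prime powers p^r (r ≥ 1) by: g(2) = 1; g(p^r) = 1 if p ≡ 5 or 7 (mod 8) and r is even; g(p^r) = (-1)^{r/2} if p ≡ 3 (mod 8) and r is even; g(p^r) = r + 1 if p ≡ 1 (mod 8) and (-4)^{(p-1)/8} ≡ 1 (mod p); g(p^r) = (-1)^r (r + 1) if p ≡ 1 (mod 8) and (-4)^{(p-1)/8} ≡ -1 (mod p); and g(p^r) = 0 otherwise. Then b_n = g(8n + 1) for all n ≥ 0. -/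
/-- The real part of `i ^ x`, as a function of the residue `x` modulo `4`. -/
def quarticCos (x : ZMod 4) : ℤ := if x = 0 then 1 else if x = 2 then -1 else 0

/-- The integer solutions of `a ^ 2 + 2 * b ^ 2 = M`. -/
noncomputable def normSolutions (M : ℤ) : Finset (ℤ × ℤ) :=
  (Finset.Icc (-M) M ×ˢ Finset.Icc (-M) M).filter fun v ↦ v.1 ^ 2 + 2 * v.2 ^ 2 = M

theorem mem_normSolutions {M : ℤ} {v : ℤ × ℤ} :
    v ∈ normSolutions M ↔ v.1 ^ 2 + 2 * v.2 ^ 2 = M := by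
  simp only [normSolutions, Finset.mem_filter, Finset.mem_product, Finset.mem_Icc,
    and_iff_right_iff_imp]
  have h (x : ℤ) : x ≤ x ^ 2 ∧ -x ≤ x ^ 2 :=
    ⟨Int.le_self_sq x, by simpa using Int.le_self_sq (-x)⟩
  intro hv
  have h1 := h v.1
  have h2 := h v.2
  have h3 := sq_nonneg v.1
  have h4 := sq_nonneg v.2
  refine ⟨⟨?_, ?_⟩, ?_, ?_⟩ <;> linarith

/-- The weight of a solution of `a ^ 2 + 2 * b ^ 2 = M`. -/
def normWeight (v : ℤ × ℤ) : ℤ := quarticCos (v.1 * v.2)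

/-- The theta coefficient attached to the form `a ^ 2 + 2 * b ^ 2` and `normWeight`. -/
noncomputable def normSum (M : ℤ) : ℤ := ∑ v ∈ normSolutions M, normWeight v

theorem ZMod.intCast_four_of_odd {a : ℤ} (ha : Odd a) : (a : ZMod 4) = 1 ∨ (a : ZMod 4) = 3 := by
  have h : a % 4 = 1 ∨ a % 4 = 3 := by grind
  rcases h with h | h
  · exact Or.inl (by exact_mod_cast (ZMod.intCast_eq_intCast_iff a 1 4).2 h)
  · exact Or.inr (by exact_mod_cast (ZMod.intCast_eq_intCast_iff a 3 4).2 h)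

theorem odd_fst_of_mem_normSolutions {M : ℤ} (hM : Odd M) {v : ℤ × ℤ}
    (hv : v ∈ normSolutions M) : Odd v.1 := by
  rw [mem_normSolutions] at hv
  rw [← hv] at hM
  by_contra h
  rw [Int.not_odd_iff_even] at h
  exact (Int.not_even_iff_odd.2 hM) ((h.pow_of_ne_zero two_ne_zero).add (even_two_mul _))

theorem normSum_one : normSum 1 = 2 := by
  decide

/-- Multiplication by `c + d √-2` maps the solutions for `M` onto the solutions for `p * M`
divisible by it. -/
theorem sum_normWeight_filter {p : ℕ} (hp : p.Prime) (hp2 : p ≠ 2) {c d : ℤ}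
    (hcd : (p : ℤ) = c ^ 2 + 2 * d ^ 2) {M : ℤ} (hM : Odd M) :
    ∑ v ∈ (normSolutions (p * M)).filter (fun v ↦ (p : ℤ) ∣ v.2 * c - v.1 * d), normWeight v =
      ∑ v ∈ normSolutions M, quarticCos (v.1 * v.2 + c * d) := by
  have hp0 : (p : ℤ) ≠ 0 := by exact_mod_cast hp.ne_zero
  have hpr : Prime (p : ℤ) := Nat.prime_iff_prime_int.1 hp
  have hc : Odd c := odd_fst_of_mem_normSolutions (M := p) (v := (c, d))
    (by exact_mod_cast hp.odd_of_ne_two hp2) (mem_normSolutions.2 hcd.symm)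
  symm
  refine Finset.sum_nbij' (fun v ↦ (c * v.1 - 2 * d * v.2, c * v.2 + d * v.1))
    (fun v ↦ ((v.1 * c + 2 * v.2 * d) / p, (v.2 * c - v.1 * d) / p)) ?_ ?_ ?_ ?_ ?_
  · rintro ⟨a, b⟩ hv
    rw [mem_normSolutions] at hv
    rw [Finset.mem_filter, mem_normSolutions]
    simp only at hv ⊢
    refine ⟨by rw [hcd, ← hv]; ring, b, by rw [hcd]; ring⟩
  · rintro ⟨a, b⟩ hv
    rw [Finset.mem_filter, mem_normSolutions] at hv
    rw [mem_normSolutions]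
    obtain ⟨hv, y, hy⟩ := hv
    simp only at hv hy ⊢
    have h1 : (a * c + 2 * b * d) ^ 2 + 2 * (b * c - a * d) ^ 2 = p * (p * M) := by
      rw [← hv, hcd]; ring
    have h2 : (p : ℤ) ∣ a * c + 2 * b * d := by
      refine hpr.dvd_of_dvd_pow (n := 2) ⟨p * M - 2 * p * y ^ 2, ?_⟩
      rw [hy] at h1
      linear_combination h1
    obtain ⟨x, hx⟩ := h2
    rw [hx, hy] at h1 ⊢
    rw [Int.mul_ediv_cancel_left _ hp0, Int.mul_ediv_cancel_left _ hp0]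
    apply mul_left_cancel₀ hp0
    apply mul_left_cancel₀ hp0
    linear_combination h1
  · rintro ⟨a, b⟩ hv
    simp only [Prod.mk.injEq]
    constructor
    · rw [show (c * a - 2 * d * b) * c + 2 * (c * b + d * a) * d = p * a by rw [hcd]; ring,
        Int.mul_ediv_cancel_left _ hp0]
    · rw [show (c * b + d * a) * c - (c * a - 2 * d * b) * d = p * b by rw [hcd]; ring,
        Int.mul_ediv_cancel_left _ hp0]
  · rintro ⟨a, b⟩ hv
    rw [Finset.mem_filter, mem_normSolutions] at hv
    obtain ⟨hv, y, hy⟩ := hv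
    simp only at hv hy ⊢
    have h1 : (a * c + 2 * b * d) ^ 2 + 2 * (b * c - a * d) ^ 2 = p * (p * M) := by
      rw [← hv, hcd]; ring
    have h2 : (p : ℤ) ∣ a * c + 2 * b * d := by
      refine hpr.dvd_of_dvd_pow (n := 2) ⟨p * M - 2 * p * y ^ 2, ?_⟩
      rw [hy] at h1
      linear_combination h1
    obtain ⟨x, hx⟩ := h2
    rw [hx, hy, Int.mul_ediv_cancel_left _ hp0, Int.mul_ediv_cancel_left _ hp0, Prod.mk.injEq]
    constructor
    · apply mul_left_cancel₀ hp0
      linear_combination -c * hx + 2 * d * hy - a * hcd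
    · apply mul_left_cancel₀ hp0
      linear_combination -c * hy - d * hx - b * hcd
  · rintro ⟨a, b⟩ hv
    have ha := ZMod.intCast_four_of_odd (odd_fst_of_mem_normSolutions hM hv)
    have hc := ZMod.intCast_four_of_odd hc
    simp only [normWeight] at ha ⊢
    push_cast
    generalize (a : ZMod 4) = a at *
    generalize (b : ZMod 4) = b at *
    generalize (c : ZMod 4) = c at *
    generalize (d : ZMod 4) = d at *
    clear * - ha hc
    decide +revert

/-- The contribution to `normSum (p * M)` of the solutions divisible by `p`. -/
noncomputable def normSumDvd (p M : ℤ) : ℤ :=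
  ∑ v ∈ (normSolutions (p * M)).filter (fun v ↦ p ∣ v.1 ∧ p ∣ v.2), normWeight v

theorem normSumDvd_of_not_dvd {p M : ℤ} (hp : p ≠ 0) (h : ¬ p ∣ M) : normSumDvd p M = 0 := by
  refine Finset.sum_eq_zero fun v hv ↦ (h ?_).elim
  rw [Finset.mem_filter, mem_normSolutions] at hv
  obtain ⟨h1, ⟨x, hx⟩, y, hy⟩ := hv
  refine ⟨x ^ 2 + 2 * y ^ 2, mul_left_cancel₀ hp ?_⟩
  rw [hx, hy] at h1
  linear_combination -h1

theorem normSumDvd_mul {p : ℤ} (hp : Odd p) (M : ℤ) : normSumDvd p (p * M) = normSum M := by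
  have hp0 : p ≠ 0 := by rintro rfl; simp at hp
  symm
  refine Finset.sum_nbij' (fun v ↦ (p * v.1, p * v.2)) (fun v ↦ (v.1 / p, v.2 / p))
    ?_ ?_ ?_ ?_ ?_
  · rintro ⟨a, b⟩ hv
    rw [mem_normSolutions] at hv
    rw [Finset.mem_filter, mem_normSolutions]
    exact ⟨by rw [← hv]; ring, dvd_mul_right _ _, dvd_mul_right _ _⟩
  · rintro ⟨a, b⟩ hv
    rw [Finset.mem_filter, mem_normSolutions] at hv
    obtain ⟨h1, ⟨x, hx⟩, y, hy⟩ := hv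
    rw [mem_normSolutions]
    simp only at hx hy h1 ⊢
    rw [hx, hy] at h1 ⊢
    rw [Int.mul_ediv_cancel_left _ hp0, Int.mul_ediv_cancel_left _ hp0]
    apply mul_left_cancel₀ hp0
    apply mul_left_cancel₀ hp0
    linear_combination h1
  · rintro ⟨a, b⟩ hv
    simp [hp0]
  · rintro ⟨a, b⟩ hv
    rw [Finset.mem_filter, mem_normSolutions] at hv
    exact Prod.ext (Int.mul_ediv_cancel' hv.2.1) (Int.mul_ediv_cancel' hv.2.2)
  · rintro ⟨a, b⟩ hv
    have hp := ZMod.intCast_four_of_odd hp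
    simp only [normWeight]
    push_cast
    generalize (a : ZMod 4) = a at *
    generalize (b : ZMod 4) = b at *
    generalize (p : ZMod 4) = p at *
    clear * - hp
    decide +revert

theorem normSum_mul_of_split {p : ℕ} (hp : p.Prime) (hp2 : p ≠ 2) {c d : ℤ}
    (hcd : (p : ℤ) = c ^ 2 + 2 * d ^ 2) {M : ℤ} (hM : Odd M) :
    normSum (p * M) + normSumDvd p M = 2 * quarticCos (c * d) * normSum M := by
  have hpr : Prime (p : ℤ) := Nat.prime_iff_prime_int.1 hp
  have hcodd : Odd c := odd_fst_of_mem_normSolutions (M := p) (v := (c, d))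
    (by exact_mod_cast hp.odd_of_ne_two hp2) (mem_normSolutions.2 hcd.symm)
  have h1 := sum_normWeight_filter hp hp2 hcd hM
  have h2 := sum_normWeight_filter hp hp2 (c := c) (d := -d) (by rw [hcd]; ring) hM
  have h3 := Finset.sum_union_inter (f := normWeight)
    (s₁ := (normSolutions (p * M)).filter (fun v ↦ (p : ℤ) ∣ v.2 * c - v.1 * d))
    (s₂ := (normSolutions (p * M)).filter (fun v ↦ (p : ℤ) ∣ v.2 * c - v.1 * -d))
  rw [h1, h2, ← Finset.filter_or, ← Finset.filter_and, Finset.filter_true_of_mem,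
    ← Finset.sum_add_distrib] at h3
  · rw [normSum, normSum, normSumDvd, Finset.mul_sum]
    convert h3 using 2
    · refine Finset.sum_congr (Finset.filter_congr ?_) fun _ _ ↦ rfl
      rintro ⟨a, b⟩ -
      simp only
      constructor
      · rintro ⟨ha, hb⟩
        exact ⟨dvd_sub (hb.mul_right _) (ha.mul_right _), dvd_sub (hb.mul_right _) (ha.mul_right _)⟩
      · rintro ⟨h1, h2⟩
        have hlt : ∀ x : ℤ, (p : ℤ) ∣ x → x ^ 2 < p → x = 0 := by
          intro x hx hlt
          by_contra h0
          obtain ⟨k, rfl⟩ := hx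
          have hk : k ≠ 0 := by rintro rfl; simp at h0
          have hp0 : (0 : ℤ) < p := by exact_mod_cast hp.pos
          have h1 : 0 < p * k ^ 2 := by positivity
          have h2 : p * (p * k ^ 2) < p * 1 := by linarith [mul_pow (p : ℤ) k 2]
          linarith [lt_of_mul_lt_mul_left h2 hp0.le]
        have hp2' : ¬ (p : ℤ) ∣ 2 := by
          intro h
          have := Int.le_of_dvd (by norm_num) h
          have := hp.two_le
          omega
        have hp1 : (1 : ℤ) < p := by exact_mod_cast hp.one_lt
        have hd0 : d ≠ 0 := by
          rintro rfl
          refine hpr.irreducible.not_isSquare ⟨c, by rw [hcd]; ring⟩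
        have hc : ¬ (p : ℤ) ∣ c := by
          intro h
          have := hlt c h (by have : 0 < d ^ 2 := by positivity
                              linarith)
          exact (by rintro rfl; simp at hcodd : c ≠ 0) this
        have hd : ¬ (p : ℤ) ∣ d := by
          intro h
          have := hlt d h (by have : 0 < d ^ 2 := by positivity
                              have := sq_nonneg c
                              linarith)
          exact hd0 this
        have h3 : (p : ℤ) ∣ 2 * (b * c) := by
          have := dvd_add h1 h2
          ring_nf at this ⊢
          exact this
        have h4 : (p : ℤ) ∣ 2 * (a * d) := by
          have := dvd_sub h2 h1
          ring_nf at this ⊢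
          exact this
        exact ⟨((hpr.dvd_or_dvd h4).resolve_left hp2' |> hpr.dvd_or_dvd).resolve_right hd,
          ((hpr.dvd_or_dvd h3).resolve_left hp2' |> hpr.dvd_or_dvd).resolve_right hc⟩
    · rename_i v _
      simp only [normWeight]
      push_cast
      generalize (v.1 : ZMod 4) * v.2 = x
      have hy : (c : ZMod 4) * -d = - (c * d) := by ring
      rw [hy]
      generalize (c : ZMod 4) * d = y
      clear * -
      decide +revert
  · rintro ⟨a, b⟩ hv
    rw [mem_normSolutions] at hv
    simp only at hv ⊢
    refine hpr.dvd_or_dvd ⟨b ^ 2 - M * d ^ 2, ?_⟩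
    linear_combination -d ^ 2 * hv - b ^ 2 * hcd

theorem normSum_mul_of_inert {p : ℕ} (hp : p.Prime) (h8 : p % 8 = 5 ∨ p % 8 = 7) (M : ℤ) :
    normSum (p * M) = normSumDvd p M := by
  have hpr : Prime (p : ℤ) := Nat.prime_iff_prime_int.1 hp
  have : Fact p.Prime := ⟨hp⟩
  rw [normSum, normSumDvd, Finset.filter_true_of_mem]
  rintro ⟨a, b⟩ hv
  rw [mem_normSolutions] at hv
  simp only at hv ⊢
  have hb : (p : ℤ) ∣ b := by
    by_contra hb
    rw [← ZMod.intCast_zmod_eq_zero_iff_dvd] at hb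
    have h2 : ¬ IsSquare (-2 : ZMod p) := by
      rw [ZMod.exists_sq_eq_neg_two_iff (by omega)]
      omega
    apply h2
    have h3 := congrArg (Int.cast : ℤ → ZMod p) hv
    push_cast at h3
    rw [CharP.cast_eq_zero, zero_mul] at h3
    refine ⟨a / b, ?_⟩
    field_simp
    linear_combination -h3
  refine ⟨hpr.dvd_of_dvd_pow (n := 2) ?_, hb⟩
  obtain ⟨y, rfl⟩ := hb
  exact ⟨M - 2 * p * y ^ 2, by linear_combination hv⟩

/-- The sum over solutions with `a + b` divisible by `3` vanishes. -/
theorem sum_normWeight_filter_three {M : ℤ} (hM : M % 8 = 1) :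
    ∑ v ∈ (normSolutions M).filter (fun v ↦ (v.1 + v.2) % 3 = 0), normWeight v = 0 := by
  set S := (normSolutions M).filter (fun v ↦ (v.1 + v.2) % 3 = 0) with hS
  have hmem (v : ℤ × ℤ) : v ∈ S ↔ v.1 ^ 2 + 2 * v.2 ^ 2 = M ∧ (v.1 + v.2) % 3 = 0 := by
    rw [hS, Finset.mem_filter, mem_normSolutions]
  have key : ∀ v ∈ S, ∃ s t : ℤ, -v.1 - 4 * v.2 = 3 * s ∧ v.2 - 2 * v.1 = 3 * t := by
    rintro ⟨a, b⟩ hv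
    have := ((hmem _).1 hv).2
    simp only at this ⊢
    exact ⟨(-a - 4 * b) / 3, (b - 2 * a) / 3, by omega, by omega⟩
  suffices h : ∑ v ∈ S, normWeight v = ∑ v ∈ S, -normWeight v by
    rw [Finset.sum_neg_distrib] at h
    omega
  refine Finset.sum_nbij' (fun v ↦ ((-v.1 - 4 * v.2) / 3, (v.2 - 2 * v.1) / 3))
    (fun v ↦ ((-v.1 - 4 * v.2) / 3, (v.2 - 2 * v.1) / 3)) ?_ ?_ ?_ ?_ ?_
  iterate 2
    rintro ⟨a, b⟩ hv
    obtain ⟨s, t, h1, h2⟩ := key _ hv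
    rw [hmem] at hv ⊢
    simp only at hv h1 h2 ⊢
    rw [h1, h2, Int.mul_ediv_cancel_left _ (by norm_num), Int.mul_ediv_cancel_left _ (by norm_num)]
    refine ⟨?_, by omega⟩
    have h3 : 9 * (s ^ 2 + 2 * t ^ 2) = 9 * (a ^ 2 + 2 * b ^ 2) := by
      have : 9 * (s ^ 2 + 2 * t ^ 2) = (3 * s) ^ 2 + 2 * (3 * t) ^ 2 := by ring
      rw [this, ← h1, ← h2]
      ring
    linarith [hv.1]
  iterate 2
    rintro ⟨a, b⟩ hv
    obtain ⟨s, t, h1, h2⟩ := key _ hv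
    simp only at h1 h2
    simp only [Prod.mk.injEq]
    constructor <;> omega
  · rintro ⟨a, b⟩ hv
    obtain ⟨s, t, h1, h2⟩ := key _ hv
    have hb := ((hmem _).1 hv).1
    have ha : Odd a := odd_fst_of_mem_normSolutions (v := (a, b)) (Int.odd_iff.2 (by omega))
      (Finset.mem_filter.1 hv).1
    simp only [normWeight] at hb h1 h2 ⊢
    rw [h1, h2, Int.mul_ediv_cancel_left _ (by norm_num), Int.mul_ediv_cancel_left _ (by norm_num)]
    have hb : Even b := by
      have h4 : a ^ 2 % 4 = 1 := Int.sq_mod_four_eq_one_of_odd ha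
      have : Even (b ^ 2) := Int.even_iff.2 (by omega)
      exact (Int.even_pow' two_ne_zero).1 this
    obtain ⟨d, rfl⟩ := hb
    have ha := ZMod.intCast_four_of_odd ha
    have h1 := congrArg (Int.cast : ℤ → ZMod 4) h1
    have h2 := congrArg (Int.cast : ℤ → ZMod 4) h2
    push_cast at h1 h2 ⊢
    rw [show (s : ZMod 4) = (-a - 4 * (d + d)) * 3 by rw [h1]; ring_nf; reduce_mod_char,
      show (t : ZMod 4) = (d + d - 2 * a) * 3 by rw [h2]; ring_nf; reduce_mod_char]
    generalize (a : ZMod 4) = a at *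
    generalize (d : ZMod 4) = d at *
    clear * - ha
    decide +revert

/-- Up to sign there is one solution in each class of `a + b` prime to `3`. -/
theorem two_mul_sum_normWeight_filter {M : ℤ} (hM : M % 8 = 1) :
    2 * ∑ v ∈ (normSolutions M).filter (fun v ↦ (v.1 + v.2) % 3 = 2), normWeight v =
      normSum M := by
  have h1 : ∑ v ∈ (normSolutions M).filter (fun v ↦ (v.1 + v.2) % 3 = 1), normWeight v =
      ∑ v ∈ (normSolutions M).filter (fun v ↦ (v.1 + v.2) % 3 = 2), normWeight v := by
    refine Finset.sum_nbij' (fun v ↦ (-v.1, -v.2)) (fun v ↦ (-v.1, -v.2)) ?_ ?_ ?_ ?_ ?_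
    iterate 2
      rintro ⟨a, b⟩ hv
      rw [Finset.mem_filter, mem_normSolutions] at hv ⊢
      simp only at hv ⊢
      exact ⟨by rw [← hv.1]; ring, by omega⟩
    · simp
    · simp
    · simp [normWeight]
  have h2 : normSum M = ∑ v ∈ normSolutions M,
      ((if (v.1 + v.2) % 3 = 0 then normWeight v else 0) +
        (if (v.1 + v.2) % 3 = 1 then normWeight v else 0) +
        (if (v.1 + v.2) % 3 = 2 then normWeight v else 0)) := by
    refine Finset.sum_congr rfl fun v _ ↦ ?_
    split_ifs <;> omega
  rw [h2, Finset.sum_add_distrib, Finset.sum_add_distrib, ← Finset.sum_filter,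
    ← Finset.sum_filter, ← Finset.sum_filter, sum_normWeight_filter_three hM, h1]
  ring

open Polynomial in
/-- The pentagonal number theorem for finite products. -/
theorem coeff_prod_one_sub_X_pow_eventually (n : ℕ) :
    ∀ᶠ N in Filter.atTop, ∀ i ≤ n, (∏ m ∈ Finset.Icc 1 N, ((1 : ℤ[X]) - X ^ m)).coeff i =
      (PowerSeries.pentagonalSeries ℤ).coeff i := by
  have h : ∀ i ∈ Finset.range (n + 1), ∀ᶠ N in Filter.atTop,
      (∏ m ∈ Finset.Icc 1 N, ((1 : ℤ[X]) - X ^ m)).coeff i =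
        (PowerSeries.pentagonalSeries ℤ).coeff i := by
    intro i _
    have := Filter.tendsto_finset_range.eventually
      (PowerSeries.coeff_prod_one_sub_X_pow_eventually_eq ℤ i)
    filter_upwards [this] with N hN
    rw [← hN, ← Polynomial.coeff_coe, ← Polynomial.coeToPowerSeries.ringHom_apply, map_prod,
      Finset.range_eq_Ico, Finset.prod_Ico_add' (fun m ↦ (1 : PowerSeries ℤ) - PowerSeries.X ^ m)]
    simp [Finset.Ico_add_one_right_eq_Icc]
  filter_upwards [(Filter.eventually_all_finset _).2 h] with N hN i hi
  exact hN i (Finset.mem_range.2 (by omega))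

theorem PowerSeries.coeff_pentagonalSeries_eq_sum {n i : ℕ} (hi : i ≤ n) :
    (PowerSeries.pentagonalSeries ℤ).coeff i =
      ∑ k ∈ Finset.Icc (-n : ℤ) n, if pentagonal k = i then (Int.negOnePow k : ℤ) else 0 := by
  by_cases h : i ∈ Set.range pentagonal
  · obtain ⟨k, rfl⟩ := h
    rw [PowerSeries.coeff_pentagonalSeries_pentagonal]
    simp only [pentagonal_inj]
    rw [Finset.sum_ite_eq', if_pos]
    · exact Int.cast_id
    have h1 := two_mul_natCast_pentagonal k
    have h2 : (pentagonal k : ℤ) ≤ n := by exact_mod_cast hi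
    rw [Finset.mem_Icc]
    have h3 := Int.le_self_sq k
    have h4 := Int.le_self_sq (-k)
    have h5 : k * (3 * k - 1) = 3 * k ^ 2 - k := by ring
    constructor <;> nlinarith
  · rw [PowerSeries.coeff_pentagonalSeries_eq_zero _ h]
    symm
    refine Finset.sum_eq_zero fun k _ ↦ if_neg fun hk ↦ h ⟨k, hk⟩

open Polynomial in
theorem coeff_eq_sum_pentagonal (b : ℕ → ℤ)
    (hb : ∀ n N : ℕ, n ≤ N →
      b n = ((∏ m ∈ Finset.Icc 1 N,
        (((1 : ℤ[X]) - X ^ m) * ((1 : ℤ[X]) - X ^ (2 * m)))).coeff n)) (n : ℕ) :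
    b n = ∑ v ∈ (Finset.Icc (-n : ℤ) n ×ˢ Finset.Icc (-n : ℤ) n).filter
      (fun v ↦ pentagonal v.1 + 2 * pentagonal v.2 = n),
      (Int.negOnePow (v.1 + v.2) : ℤ) := by
  obtain ⟨N, hN, hnN⟩ :=
    ((coeff_prod_one_sub_X_pow_eventually n).and (Filter.eventually_ge_atTop n)).exists
  have hexp : ∏ m ∈ Finset.Icc 1 N, ((1 : ℤ[X]) - X ^ (2 * m)) =
      expand ℤ 2 (∏ m ∈ Finset.Icc 1 N, ((1 : ℤ[X]) - X ^ m)) := by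
    simp [map_prod, pow_mul]
  rw [hb n N hnN, Finset.prod_mul_distrib, hexp, coeff_mul]
  have h1 : ∀ x ∈ Finset.HasAntidiagonal.antidiagonal n,
      (∏ m ∈ Finset.Icc 1 N, ((1 : ℤ[X]) - X ^ m)).coeff x.1 *
        (expand ℤ 2 (∏ m ∈ Finset.Icc 1 N, ((1 : ℤ[X]) - X ^ m))).coeff x.2 =
      ∑ k ∈ Finset.Icc (-n : ℤ) n, ∑ l ∈ Finset.Icc (-n : ℤ) n,
        if x = (pentagonal k, 2 * pentagonal l) then (Int.negOnePow (k + l) : ℤ) else 0 := by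
    rintro ⟨i, j⟩ hx
    rw [Finset.HasAntidiagonal.mem_antidiagonal] at hx
    simp only at hx ⊢
    rw [coeff_expand two_pos, hN i (by omega),
      PowerSeries.coeff_pentagonalSeries_eq_sum (show i ≤ n by omega)]
    split_ifs with hj
    · obtain ⟨j, rfl⟩ := hj
      rw [Nat.mul_div_cancel_left _ two_pos, hN j (by omega),
        PowerSeries.coeff_pentagonalSeries_eq_sum (show j ≤ n by omega), Finset.sum_mul_sum]
      refine Finset.sum_congr rfl fun k _ ↦ Finset.sum_congr rfl fun l _ ↦ ?_
      simp only [Prod.mk.injEq, mul_right_inj' (two_ne_zero (α := ℕ)), ite_and,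
        eq_comm (a := i), eq_comm (a := j), Int.negOnePow_add]
      split_ifs <;> simp
    · rw [mul_zero]
      symm
      refine Finset.sum_eq_zero fun k _ ↦ Finset.sum_eq_zero fun l _ ↦ if_neg ?_
      rintro h
      exact hj ⟨_, (Prod.ext_iff.1 h).2⟩
  rw [Finset.sum_congr rfl h1, Finset.sum_comm, Finset.sum_filter, Finset.sum_product]
  refine Finset.sum_congr rfl fun k _ ↦ ?_
  rw [Finset.sum_comm]
  refine Finset.sum_congr rfl fun l _ ↦ ?_
  rw [Finset.sum_ite_eq']
  simp only [Finset.HasAntidiagonal.mem_antidiagonal]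

theorem sum_pentagonal_eq_sum_normWeight (n : ℕ) :
    ∑ v ∈ (Finset.Icc (-n : ℤ) n ×ˢ Finset.Icc (-n : ℤ) n).filter
      (fun v ↦ pentagonal v.1 + 2 * pentagonal v.2 = n), (Int.negOnePow (v.1 + v.2) : ℤ) =
    ∑ v ∈ (normSolutions (8 * n + 1)).filter (fun v ↦ (v.1 + v.2) % 3 = 2), normWeight v := by
  have hpent (k l : ℤ) : pentagonal k + 2 * pentagonal l = n ↔
      (6 * k - 1) ^ 2 + 2 * (6 * l - 1) ^ 2 = 3 * (8 * n + 1) := by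
    have h1 := two_mul_natCast_pentagonal k
    have h2 := two_mul_natCast_pentagonal l
    rw [← Nat.cast_inj (R := ℤ)]
    push_cast
    constructor <;> intro h <;> nlinarith
  have hodd (a b : ℤ) (h : a ^ 2 + 2 * b ^ 2 = 8 * n + 1) : a % 2 = 1 ∧ b % 2 = 0 := by
    have ha : Odd a := odd_fst_of_mem_normSolutions (v := (a, b)) (M := 8 * n + 1)
      (Int.odd_iff.2 (by omega)) (mem_normSolutions.2 h)
    refine ⟨Int.odd_iff.1 ha, ?_⟩
    have h4 : a ^ 2 % 4 = 1 := Int.sq_mod_four_eq_one_of_odd ha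
    have : Even (b ^ 2) := Int.even_iff.2 (by omega)
    exact Int.even_iff.1 ((Int.even_pow' two_ne_zero).1 this)
  refine Finset.sum_nbij' (fun v ↦ (2 * v.1 + 4 * v.2 - 1, 2 * (v.2 - v.1)))
    (fun v ↦ ((v.1 - 2 * v.2 + 1) / 6, (v.1 + v.2 + 1) / 6)) ?_ ?_ ?_ ?_ ?_
  · rintro ⟨k, l⟩ hv
    rw [Finset.mem_filter, hpent] at hv
    rw [Finset.mem_filter, mem_normSolutions]
    simp only at hv ⊢
    exact ⟨by nlinarith [hv.2], by omega⟩
  · rintro ⟨a, b⟩ hv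
    rw [Finset.mem_filter, mem_normSolutions] at hv
    simp only at hv
    obtain ⟨hv, h3⟩ := hv
    obtain ⟨ha, hb⟩ := hodd a b hv
    obtain ⟨k, hk⟩ : ∃ k, a - 2 * b + 1 = 6 * k := ⟨(a - 2 * b + 1) / 6, by omega⟩
    obtain ⟨l, hl⟩ : ∃ l, a + b + 1 = 6 * l := ⟨(a + b + 1) / 6, by omega⟩
    have h4 : pentagonal k + 2 * pentagonal l = n := by
      rw [hpent, ← hk, ← hl, ← hv]
      ring
    have hbd (m : ℤ) (h : pentagonal m ≤ n) : -n ≤ m ∧ m ≤ n := by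
      have h1 := two_mul_natCast_pentagonal m
      have h2 : (pentagonal m : ℤ) ≤ n := by exact_mod_cast h
      have h3 := Int.le_self_sq m
      have h4 := Int.le_self_sq (-m)
      have h5 : m * (3 * m - 1) = 3 * m ^ 2 - m := by ring
      constructor <;> nlinarith
    simp only [Finset.mem_filter, Finset.mem_product, Finset.mem_Icc]
    rw [hk, hl, Int.mul_ediv_cancel_left _ (by norm_num), Int.mul_ediv_cancel_left _ (by norm_num)]
    exact ⟨⟨hbd k (by omega), hbd l (by omega)⟩, h4⟩
  · rintro ⟨k, l⟩ hv
    simp only [Prod.mk.injEq]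
    constructor <;> omega
  · rintro ⟨a, b⟩ hv
    rw [Finset.mem_filter, mem_normSolutions] at hv
    simp only at hv
    have := hodd a b hv.1
    simp only [Prod.mk.injEq]
    constructor <;> omega
  · rintro ⟨k, l⟩ hv
    simp only [normWeight]
    rcases Int.even_or_odd (k + l) with h | h
    · rw [Int.negOnePow_even _ h]
      obtain ⟨m, hm⟩ := h
      rw [show l = m + m - k by omega]
      push_cast
      generalize (k : ZMod 4) = k at *
      generalize (m : ZMod 4) = m at *
      clear * -
      decide +revert
    · rw [Int.negOnePow_odd _ h]
      obtain ⟨m, hm⟩ := h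
      rw [show l = 2 * m + 1 - k by omega]
      push_cast
      generalize (k : ZMod 4) = k at *
      generalize (m : ZMod 4) = m at *
      clear * -
      decide +revert

theorem Nat.Prime.exists_eq_sq_add_two_mul_sq {p : ℕ} (hp : p.Prime)
    (h8 : p % 8 = 1 ∨ p % 8 = 3) : ∃ c d : ℤ, (p : ℤ) = c ^ 2 + 2 * d ^ 2 := by
  have : Fact p.Prime := ⟨hp⟩
  obtain ⟨u, hu⟩ := (ZMod.exists_sq_eq_neg_two_iff (p := p) (by omega)).2 h8
  set s := Nat.sqrt p with hs
  have hlt : p < (s + 1) * (s + 1) := Nat.lt_succ_sqrt p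
  have hle : s * s ≤ p := Nat.sqrt_le p
  have hne : s * s ≠ p := fun h ↦ hp.prime.irreducible.not_isSquare ⟨s, h.symm⟩
  obtain ⟨v, hv, w, hw, hvw, h⟩ := Finset.exists_ne_map_eq_of_card_lt_of_maps_to
    (s := Finset.range (s + 1) ×ˢ Finset.range (s + 1)) (t := (Finset.univ : Finset (ZMod p)))
    (f := fun v ↦ (v.1 : ZMod p) - u * v.2)
    (by simpa [ZMod.card] using hlt) (fun _ _ ↦ Finset.mem_coe.2 (Finset.mem_univ _))
  simp only [Finset.mem_product, Finset.mem_range] at hv hw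
  obtain ⟨x, hx⟩ : ∃ x : ℤ, x = v.1 - w.1 := ⟨_, rfl⟩
  obtain ⟨y, hy⟩ : ∃ y : ℤ, y = v.2 - w.2 := ⟨_, rfl⟩
  have hsq : ∀ z : ℤ, -s ≤ z → z ≤ s → z ^ 2 < p := by
    intro z h1 h2
    have h3 : (s : ℤ) * s < p := by exact_mod_cast lt_of_le_of_ne hle hne
    nlinarith
  have hx2 := hsq x (by omega) (by omega)
  have hy2 := hsq y (by omega) (by omega)
  have hdvd : (p : ℤ) ∣ x ^ 2 + 2 * y ^ 2 := by
    rw [← ZMod.intCast_zmod_eq_zero_iff_dvd]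
    have h3 : (x : ZMod p) = u * y := by
      rw [hx, hy]
      push_cast
      linear_combination h
    push_cast
    rw [h3]
    linear_combination (-(y : ZMod p) ^ 2) * hu
  have hpos : 0 < x ^ 2 + 2 * y ^ 2 := by
    by_contra h0
    have hx0 : x = 0 := by nlinarith [sq_nonneg x, sq_nonneg y]
    have hy0 : y = 0 := by nlinarith [sq_nonneg x, sq_nonneg y]
    exact hvw (Prod.ext (by omega) (by omega))
  obtain ⟨k, hk⟩ := hdvd
  have hp0 : (0 : ℤ) < p := by exact_mod_cast hp.pos
  have hk1 : 0 < k := by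
    by_contra h0
    nlinarith
  have hk3 : k < 3 := by
    by_contra h0
    nlinarith
  obtain rfl | rfl : k = 1 ∨ k = 2 := by omega
  · exact ⟨x, y, by linarith⟩
  · have hx : Even x := by
      have : Even (x ^ 2) := ⟨p - y ^ 2, by linarith⟩
      exact (Int.even_pow' two_ne_zero).1 this
    obtain ⟨z, rfl⟩ := hx
    exact ⟨y, z, by linarith⟩

theorem jacobiSym_eq_one_of_sq_add {p c y : ℕ} (hp : p.Prime) (h8 : p % 8 = 1)
    (h : p = c ^ 2 + 8 * y ^ 2) : jacobiSym y p = 1 := by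
  have hpo : Odd p := Nat.odd_iff.2 (by omega)
  have hy : y ≠ 0 := by
    rintro rfl
    exact hp.prime.irreducible.not_isSquare ⟨c, by rw [h]; ring⟩
  obtain ⟨j, z, hz, rfl⟩ := Nat.exists_eq_two_pow_mul_odd hy
  have h2 : jacobiSym 2 p = 1 := by
    rw [jacobiSym.at_two hpo, ZMod.χ₈_nat_eq_if_mod_eight]
    simp [h8, Nat.odd_iff.1 hpo]
  push_cast
  rw [jacobiSym.mul_left, jacobiSym.pow_left, h2, one_pow, one_mul,
    jacobiSym.quadratic_reciprocity_one_mod_four' hz (by omega), jacobiSym.mod_left, h]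
  have hcop : (c : ℤ).gcd z = 1 := by
    rw [Int.gcd_natCast_natCast]
    by_contra hg
    obtain ⟨q, hq, hqg⟩ := Nat.exists_prime_and_dvd hg
    obtain ⟨c', rfl⟩ := hqg.trans (Nat.gcd_dvd_left c z)
    obtain ⟨z', rfl⟩ := hqg.trans (Nat.gcd_dvd_right _ z)
    apply (Nat.squarefree_iff_prime_squarefree.1 hp.prime.irreducible.squarefree) q hq
    exact ⟨c' ^ 2 + 8 * (2 ^ j * z') ^ 2, by rw [h]; ring⟩
  have : ((c ^ 2 + 8 * (2 ^ j * z) ^ 2 : ℕ) : ℤ) % z = (c : ℤ) ^ 2 % z := by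
    push_cast
    rw [show (c : ℤ) ^ 2 + 8 * (2 ^ j * z) ^ 2 = c ^ 2 + z * (8 * 2 ^ (2 * j) * z) by ring,
      Int.add_mul_emod_self_left]
  rw [this, ← jacobiSym.mod_left, jacobiSym.sq_one' hcop]

theorem jacobiSym_eq_χ₈_of_sq_add {p c y : ℕ} (hp : p.Prime) (h8 : p % 8 = 1)
    (h : p = c ^ 2 + 8 * y ^ 2) (hc : Odd c) : jacobiSym c p = ZMod.χ₈ c := by
  have hcop : ((2 * y : ℕ) : ℤ).gcd c = 1 := by
    rw [Int.gcd_natCast_natCast]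
    by_contra hg
    obtain ⟨q, hq, hqg⟩ := Nat.exists_prime_and_dvd hg
    obtain ⟨z, hz⟩ := hqg.trans (Nat.gcd_dvd_left _ c)
    obtain ⟨c', rfl⟩ := hqg.trans (Nat.gcd_dvd_right _ c)
    apply (Nat.squarefree_iff_prime_squarefree.1 hp.prime.irreducible.squarefree) q hq
    refine ⟨c' ^ 2 + 2 * z ^ 2, ?_⟩
    calc p = (q * c') ^ 2 + 2 * (2 * y) ^ 2 := by rw [h]; ring
      _ = _ := by rw [hz]; ring
  rw [jacobiSym.quadratic_reciprocity_one_mod_four' hc (by omega), jacobiSym.mod_left, h]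
  have : ((c ^ 2 + 8 * y ^ 2 : ℕ) : ℤ) % c = (2 * ((2 * y : ℕ) : ℤ) ^ 2) % c := by
    push_cast
    rw [show (c : ℤ) ^ 2 + 8 * y ^ 2 = 2 * (2 * y) ^ 2 + c * c by ring,
      Int.add_mul_emod_self_left]
  rw [this, ← jacobiSym.mod_left, jacobiSym.mul_left, jacobiSym.sq_one' hcop, mul_one,
    jacobiSym.at_two hc]

theorem neg_four_pow_of_sq_add {p c y : ℕ} (hp : p.Prime) (h8 : p % 8 = 1)
    (h : p = c ^ 2 + 8 * y ^ 2) : (p : ℤ) ∣ (-4) ^ ((p - 1) / 8) - (-1) ^ y := by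
  have : Fact p.Prime := ⟨hp⟩
  have hc : Odd c := by
    by_contra hc
    rw [Nat.not_odd_iff_even] at hc
    obtain ⟨x, rfl⟩ := hc
    have : p = 2 * (2 * x ^ 2 + 4 * y ^ 2) := by rw [h]; ring
    omega
  obtain ⟨k, hk⟩ : ∃ k, p = 8 * k + 1 := ⟨p / 8, by omega⟩
  have hk1 : (p - 1) / 8 = k := by omega
  have hk2 : p / 2 = 4 * k := by omega
  have h1 := legendreSym.eq_pow p (y : ℤ)
  have h2 := legendreSym.eq_pow p (c : ℤ)
  have h3 := legendreSym.eq_pow p (2 : ℤ)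
  rw [jacobiSym.legendreSym.to_jacobiSym, hk2] at h1 h2 h3
  rw [jacobiSym_eq_one_of_sq_add hp h8 h] at h1
  rw [jacobiSym_eq_χ₈_of_sq_add hp h8 h hc] at h2
  have h4 : jacobiSym 2 p = 1 := by
    rw [jacobiSym.at_two (Nat.odd_iff.2 (by omega)), ZMod.χ₈_nat_eq_if_mod_eight]
    simp [h8, show p % 2 = 1 by omega]
  rw [h4] at h3
  push_cast at h1 h2 h3
  have h5 : (c : ZMod p) ^ 2 = -8 * y ^ 2 := by
    have := congrArg (Nat.cast : ℕ → ZMod p) h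
    push_cast at this
    rw [CharP.cast_eq_zero] at this
    linear_combination -this
  have h6 : (4 : ZMod p) ^ k = ((ZMod.χ₈ c : ℤ) : ZMod p) := by
    have e1 : ((4 : ZMod p) ^ k) ^ 2 = 1 := by
      rw [h3, ← pow_mul, show (4 : ZMod p) = 2 ^ 2 by norm_num, ← pow_mul]
      congr 1; ring
    calc (4 : ZMod p) ^ k = 4 ^ k * (4 ^ k) ^ 2 := by rw [e1, mul_one]
      _ = ((-8) ^ 2) ^ k * y ^ (4 * k) := by
        rw [← h1, mul_one, pow_right_comm, ← mul_pow]
        norm_num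
      _ = (c ^ 2) ^ (2 * k) := by rw [h5, mul_pow, ← pow_mul, ← pow_mul]; congr 2; ring
      _ = _ := by rw [h2, ← pow_mul]; congr 1; ring
  have h7 : (-1) ^ k * ZMod.χ₈ c = (-1) ^ y := by
    rw [ZMod.χ₈_nat_eq_if_mod_eight]
    have e1 : 8 * k + 1 = c ^ 2 + 8 * y ^ 2 := by rw [← hk, h]
    have e2 : c % 2 = 1 := Nat.odd_iff.1 hc
    have e3 : y ^ 2 % 2 = y % 2 := by
      rw [Nat.pow_mod]
      rcases Nat.mod_two_eq_zero_or_one y with h | h <;> simp [h]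
    have e4 : c ^ 2 % 16 = if c % 8 = 1 ∨ c % 8 = 7 then 1 else 9 := by
      rw [Nat.pow_mod, ← Nat.mod_mod_of_dvd c (by norm_num : 8 ∣ 16)]
      have e5 : c % 16 % 2 = 1 := by omega
      have e6 : c % 16 < 16 := Nat.mod_lt _ (by norm_num)
      generalize c % 16 = t at *
      clear * - e5 e6
      interval_cases t <;> simp_all
    rw [if_neg (by omega)]
    split_ifs at e4 ⊢ with e5
    · have : Even k ↔ Even y := by simp only [Nat.even_iff]; omega
      rw [mul_one, neg_one_pow_congr this]
    · have : Even (k + 1) ↔ Even y := by simp only [Nat.even_iff]; omega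
      rw [← pow_succ, neg_one_pow_congr this]
  rw [← ZMod.intCast_zmod_eq_zero_iff_dvd, ← h7, hk1]
  push_cast
  rw [← h6, neg_pow, sub_self]

/-- The factor relating `normSum (p ^ r * m)` to `normSum m` when `p` is split. -/
theorem normSum_prime_pow_mul_of_split {p : ℕ} (hp : p.Prime) (hp2 : p ≠ 2) {c d : ℤ}
    (hcd : (p : ℤ) = c ^ 2 + 2 * d ^ 2) {m : ℤ} (hm : Odd m) (hpm : ¬ (p : ℤ) ∣ m) (r : ℕ)
    (u : ℕ → ℤ) (hu0 : u 0 = 1) (hu1 : u 1 = 2 * quarticCos (c * d))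
    (hu : ∀ r, u (r + 2) = 2 * quarticCos (c * d) * u (r + 1) - u r) :
    normSum (p ^ r * m) = u r * normSum m := by
  have hpo : Odd (p : ℤ) := by exact_mod_cast hp.odd_of_ne_two hp2
  induction r using Nat.twoStepInduction with
  | zero => simp [hu0]
  | one =>
    have h := normSum_mul_of_split hp hp2 hcd hm
    rw [normSumDvd_of_not_dvd (by exact_mod_cast hp.ne_zero) hpm] at h
    rw [pow_one, hu1]
    linarith
  | more r h0 h1 =>
    have h := normSum_mul_of_split hp hp2 hcd ((hpo.pow (n := r + 1)).mul hm)
    have e1 : (p : ℤ) ^ (r + 1) * m = p * (p ^ r * m) := by ring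
    have e2 : (p : ℤ) ^ (r + 2) * m = p * (p ^ (r + 1) * m) := by ring
    rw [e1, normSumDvd_mul hpo, h0, ← e1, ← e2, h1] at h
    rw [hu]
    linear_combination h

theorem normSum_prime_pow_mul_of_inert {p : ℕ} (hp : p.Prime) (h8 : p % 8 = 5 ∨ p % 8 = 7)
    {m : ℤ} (hpm : ¬ (p : ℤ) ∣ m) (r : ℕ) :
    normSum (p ^ r * m) = (if Even r then 1 else 0) * normSum m := by
  have hpo : Odd (p : ℤ) := by exact_mod_cast Nat.odd_iff.2 (by omega : p % 2 = 1)
  induction r using Nat.twoStepInduction with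
  | zero => simp
  | one =>
    rw [pow_one, normSum_mul_of_inert hp h8,
      normSumDvd_of_not_dvd (by exact_mod_cast hp.ne_zero) hpm]
    simp
  | more r h0 h1 =>
    rw [pow_succ', mul_assoc, normSum_mul_of_inert hp h8, pow_succ', mul_assoc,
      normSumDvd_mul hpo, h0]
    simp [Nat.even_add]

theorem quarticCos_of_prime_three_mod_eight {p : ℕ} (h8 : p % 8 = 3) {c d : ℤ}
    (hcd : (p : ℤ) = c ^ 2 + 2 * d ^ 2) : quarticCos (c * d) = 0 := by
  have hp : (p : ZMod 4) = 3 := by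
    have : ((p : ℤ) : ZMod 4) = ((3 : ℤ) : ZMod 4) :=
      (ZMod.intCast_eq_intCast_iff p 3 4).2 (show (p : ℤ) % 4 = 3 % 4 by omega)
    exact_mod_cast this
  have h := congrArg (Int.cast : ℤ → ZMod 4) hcd
  push_cast at h
  rw [hp] at h
  generalize (c : ZMod 4) = c at *
  generalize (d : ZMod 4) = d at *
  clear * - h
  decide +revert

theorem neg_four_pow_eq_quarticCos {p : ℕ} (hp : p.Prime) (h8 : p % 8 = 1) {c d : ℤ}
    (hcd : (p : ℤ) = c ^ 2 + 2 * d ^ 2) :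
    (p : ℤ) ∣ (-4) ^ ((p - 1) / 8) - quarticCos (c * d) ∧
      (quarticCos (c * d) = 1 ∨ quarticCos (c * d) = -1) := by
  have hc : Odd c := odd_fst_of_mem_normSolutions (M := p) (v := (c, d))
    (Int.odd_iff.2 (by omega)) (mem_normSolutions.2 hcd.symm)
  obtain ⟨e, rfl⟩ : Even d := by
    have h4 : c ^ 2 % 4 = 1 := Int.sq_mod_four_eq_one_of_odd hc
    have : Even (d ^ 2) := Int.even_iff.2 (by omega)
    exact (Int.even_pow' two_ne_zero).1 this
  have h : p = c.natAbs ^ 2 + 8 * e.natAbs ^ 2 := by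
    zify
    rw [sq_abs, sq_abs, hcd]
    ring
  have hq : quarticCos (c * ((e + e : ℤ) : ZMod 4)) = (-1) ^ e.natAbs := by
    have hc := ZMod.intCast_four_of_odd hc
    generalize (c : ZMod 4) = c at *
    rcases Int.even_or_odd e with he | he
    · rw [(Int.natAbs_even.2 he).neg_one_pow]
      obtain ⟨f, rfl⟩ := he
      push_cast
      generalize (f : ZMod 4) = f at *
      clear * - hc
      decide +revert
    · rw [(Int.natAbs_odd.2 he).neg_one_pow]
      obtain ⟨f, rfl⟩ := he
      push_cast
      generalize (f : ZMod 4) = f at *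
      clear * - hc
      decide +revert
  rw [hq]
  exact ⟨neg_four_pow_of_sq_add hp h8 h, neg_one_pow_eq_or ℤ _⟩


/-- With `b n` the coefficient of `q^n` in `∏ (1 - q^m)(1 - q^{2m})`, and `g`
the multiplicative function with the stated values on prime powers, we have
`b n = g (8 n + 1)` for all `n`. -/
theorem stmt_6 (b : ℕ → ℤ)
    (hb : ∀ n N : ℕ, n ≤ N →
      b n = ((∏ m ∈ Finset.Icc 1 N,
        (((1 : Polynomial ℤ) - Polynomial.X ^ m) *
          ((1 : Polynomial ℤ) - Polynomial.X ^ (2 * m)))).coeff n))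
    (g : ℕ → ℤ)
    (hg1 : g 1 = 1)
    (hgmul : ∀ m n : ℕ, Nat.Coprime m n → g (m * n) = g m * g n)
    (hg2 : g 2 = 1)
    (hga : ∀ p r : ℕ, p.Prime → 1 ≤ r → (p % 8 = 5 ∨ p % 8 = 7) → Even r →
      g (p ^ r) = 1)
    (hgb : ∀ p r : ℕ, p.Prime → 1 ≤ r → p % 8 = 3 → Even r →
      g (p ^ r) = (-1) ^ (r / 2))
    (hgc : ∀ p r : ℕ, p.Prime → 1 ≤ r → p % 8 = 1 →
      (p : ℤ) ∣ ((-4) ^ ((p - 1) / 8) - 1) →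
      g (p ^ r) = r + 1)
    (hgd : ∀ p r : ℕ, p.Prime → 1 ≤ r → p % 8 = 1 →
      (p : ℤ) ∣ ((-4) ^ ((p - 1) / 8) + 1) →
      g (p ^ r) = (-1) ^ r * (r + 1))
    (hg0 : ∀ p r : ℕ, p.Prime → 1 ≤ r →
      ¬((p = 2 ∧ r = 1) ∨
        ((p % 8 = 3 ∨ p % 8 = 5 ∨ p % 8 = 7) ∧ Even r) ∨
        (p % 8 = 1 ∧ ((p : ℤ) ∣ ((-4) ^ ((p - 1) / 8) - 1) ∨
          (p : ℤ) ∣ ((-4) ^ ((p - 1) / 8) + 1)))) →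
      g (p ^ r) = 0) :
    ∀ n : ℕ, b n = g (8 * n + 1) := by
  have key : ∀ p r : ℕ, ∀ m : ℤ, p.Prime → p ≠ 2 → 0 < r → Odd m → ¬ (p : ℤ) ∣ m →
      normSum (p ^ r * m) = g (p ^ r) * normSum m := by
    intro p r m hp hp2 hr hm hpm
    have hpodd : p % 2 = 1 := Nat.odd_iff.1 (hp.odd_of_ne_two hp2)
    obtain h8 | h8 | h8 : p % 8 = 1 ∨ p % 8 = 3 ∨ (p % 8 = 5 ∨ p % 8 = 7) := by omega
    · obtain ⟨c, d, hcd⟩ := hp.exists_eq_sq_add_two_mul_sq (Or.inl h8)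
      obtain ⟨hdvd, h | h⟩ := neg_four_pow_eq_quarticCos hp h8 hcd
      · rw [h] at hdvd
        rw [hgc p r hp hr h8 hdvd]
        exact normSum_prime_pow_mul_of_split hp hp2 hcd hm hpm r (fun r ↦ r + 1) (by simp)
          (by simp [h]) (fun r ↦ by rw [h]; push_cast; ring)
      · rw [h, sub_neg_eq_add] at hdvd
        rw [hgd p r hp hr h8 hdvd]
        exact normSum_prime_pow_mul_of_split hp hp2 hcd hm hpm r (fun r ↦ (-1) ^ r * (r + 1))
          (by simp) (by simp [h]) (fun r ↦ by rw [h]; push_cast; ring)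
    · obtain ⟨c, d, hcd⟩ := hp.exists_eq_sq_add_two_mul_sq (Or.inr h8)
      have h := quarticCos_of_prime_three_mod_eight h8 hcd
      have hg : g (p ^ r) = if Even r then (-1) ^ (r / 2) else 0 := by
        split_ifs with he
        · exact hgb p r hp hr h8 he
        · exact hg0 p r hp hr (by simp [he, hp2, h8])
      rw [hg]
      refine normSum_prime_pow_mul_of_split hp hp2 hcd hm hpm r
        (fun r ↦ if Even r then (-1) ^ (r / 2) else 0) (by simp) (by simp [h]) (fun r ↦ ?_)
      rw [h, Nat.add_div_right _ two_pos, pow_succ]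
      by_cases hr : Even r <;> simp [Nat.even_add, hr]
    · have hg : g (p ^ r) = if Even r then 1 else 0 := by
        split_ifs with he
        · exact hga p r hp hr h8 he
        · refine hg0 p r hp hr ?_
          rintro (h | h | h)
          exacts [hp2 h.1, he h.2, by omega]
      rw [hg]
      exact normSum_prime_pow_mul_of_inert hp h8 hpm r
  have hsum : ∀ M : ℕ, Odd M → normSum M = 2 * g M := by
    intro M
    induction M using Nat.recOnPrimePow with
    | zero => simp
    | one => simp [normSum_one, hg1]
    | prime_pow_mul a p r hp hpa hr ih =>
      intro hodd
      rw [Nat.odd_mul, Nat.odd_pow_iff hr.ne'] at hodd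
      have hp2 : p ≠ 2 := by
        rintro rfl
        exact absurd hodd.1 (by decide)
      rw [hgmul _ _ (Nat.Coprime.pow_left r ((Nat.Prime.coprime_iff_not_dvd hp).2 hpa))]
      push_cast
      rw [key p r a hp hp2 hr (by exact_mod_cast hodd.2) (by exact_mod_cast hpa), ih hodd.2]
      ring
  intro n
  have h1 := two_mul_sum_normWeight_filter (M := 8 * n + 1) (by omega)
  have h2 := hsum (8 * n + 1) (Nat.odd_iff.2 (by omega))
  rw [coeff_eq_sum_pentagonal b hb, sum_pentagonal_eq_sum_normWeight]
  push_cast at h2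
  linarith
end
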